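/- arXiv:2111.08583 — 2 statements merged into one kernel-verified Lean document; each statement's English description precedes it below -/
import Mathlib

section
/- Let f : S² → S² be an orientation-preserving homeomorphism of finite order n ≥ 2. Then f has exactly two fixed points. -/
/-- The group structure on self-homeomorphisms of a space, under composition. -/
instance homeoGroup (X : Type*) [TopologicalSpace X] : Group (X ≃ₜ X) where
  mul f g := g.trans f
  one := Homeomorph.refl X
  inv := Homeomorph.symm
  mul_assoc _ _ _ := Homeomorph.ext fun _ => rfl
  one_mul _ := Homeomorph.ext fun _ => rfl
  mul_one _ := Homeomorph.ext fun _ => rfl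
  inv_mul_cancel f := Homeomorph.ext fun x => f.symm_apply_apply x

/-- The unit 2-sphere `S²` in `ℝ³`. -/
abbrev TwoSphere : Type := Metric.sphere (0 : EuclideanSpace ℝ (Fin 3)) 1

/-- A homeomorphism of `S²` is orientation preserving iff (equivalently) it is
homotopic to the identity. -/
def SphereOrientationPreserving (f : TwoSphere ≃ₜ TwoSphere) : Prop :=
  (⟨f, f.continuous⟩ : C(TwoSphere, TwoSphere)).Homotopic (ContinuousMap.id TwoSphere)

section

open Complex Set Topology Filter
open scoped ComplexConjugate

/-- A nonvanishing continuous function on a nonempty open convex set has a continuous logarithm. -/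
theorem exists_continuousOn_log {E : Type*} [NormedAddCommGroup E] [NormedSpace ℝ E] {U : Set E}
    (hc : Convex ℝ U) (ho : IsOpen U) (hne : U.Nonempty) {g : E → ℂ} (hg : ContinuousOn g U)
    (h0 : ∀ x ∈ U, g x ≠ 0) : ∃ l : E → ℂ, ContinuousOn l U ∧ ∀ x ∈ U, exp (l x) = g x := by
  have hs : IsSimplyConnected U := by
    have := hc.contractibleSpace hne
    exact (inferInstance : SimplyConnectedSpace U)
  obtain ⟨l, hl, h⟩ := exists_continuousOn_eqOn_exp_comp hs ho hg
    (by rintro ⟨x, hx, h⟩; exact h0 x hx h)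
  exact ⟨l, hl, fun x hx => h hx⟩

theorem exists_continuous_log {E : Type*} [NormedAddCommGroup E] [NormedSpace ℝ E]
    {g : E → ℂ} (hg : Continuous g) (h0 : ∀ x, g x ≠ 0) :
    ∃ l : E → ℂ, Continuous l ∧ ∀ x, exp (l x) = g x := by
  obtain ⟨l, hl, h⟩ := exists_continuousOn_log convex_univ isOpen_univ univ_nonempty
    (continuousOn_univ.2 hg) fun x _ => h0 x
  exact ⟨l, continuousOn_univ.1 hl, fun x => h x trivial⟩

/-- Two continuous logarithms on a preconnected set differ by a constant in `2πiℤ`. -/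
theorem exists_int_log_eq {X : Type*} [TopologicalSpace X] {s : Set X} (hs : IsPreconnected s)
    {l₁ l₂ : X → ℂ} (h₁ : ContinuousOn l₁ s) (h₂ : ContinuousOn l₂ s)
    (h : ∀ x ∈ s, exp (l₁ x) = exp (l₂ x)) :
    ∃ n : ℤ, ∀ x ∈ s, l₁ x = l₂ x + n * (2 * Real.pi * I) := by
  rcases s.eq_empty_or_nonempty with rfl | ⟨x₀, hx₀⟩
  · exact ⟨0, by simp⟩
  choose! n hn using fun x hx => exp_eq_exp_iff_exists_int.1 (h x hx)
  have hc : ContinuousOn n s := by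
    rw [Int.isClosedEmbedding_coe_real.isInducing.continuousOn_iff]
    have : ContinuousOn (fun x => ((l₁ x - l₂ x) / (2 * Real.pi * I)).re) s := by fun_prop
    refine this.congr fun x hx => ?_
    have h2 : (2 * Real.pi * I : ℂ) ≠ 0 := two_pi_I_ne_zero
    simp only [Function.comp_apply]
    rw [hn x hx, add_sub_cancel_left, mul_div_cancel_right₀ _ h2, intCast_re]
  refine ⟨n x₀, fun x hx => ?_⟩
  rw [hn x hx, hs.constant hc hx hx₀]

/-- `h` is a planar embedding of degree one: the difference quotient
`(h x - h y) / (x - y)` has a continuous logarithm off the diagonal. -/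
def PlaneOriented (h : ℂ → ℂ) : Prop :=
  ∃ L : ℂ × ℂ → ℂ, ContinuousOn L {q | q.1 ≠ q.2} ∧
    ∀ x y, x ≠ y → h x - h y = exp (L (x, y)) * (x - y)

theorem PlaneOriented.injective {h : ℂ → ℂ} (hh : PlaneOriented h) : Function.Injective h := by
  obtain ⟨L, -, hL⟩ := hh
  intro x y hxy
  by_contra hne
  have := hL x y hne
  rw [hxy, sub_self] at this
  exact mul_ne_zero (exp_ne_zero _) (sub_ne_zero.2 hne) this.symm

theorem PlaneOriented.comp {h k : ℂ → ℂ} (hh : PlaneOriented h) (hk : PlaneOriented k)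
    (hkc : Continuous k) : PlaneOriented (h ∘ k) := by
  have hi := hk.injective
  obtain ⟨L, hL, hL'⟩ := hh
  obtain ⟨K, hK, hK'⟩ := hk
  refine ⟨fun q => L (k q.1, k q.2) + K q, ?_, fun x y hxy => ?_⟩
  · refine ContinuousOn.add (hL.comp (by fun_prop) fun q hq => ?_) hK
    exact hi.ne hq
  · simp only [Function.comp]
    rw [hL' _ _ (hi.ne hxy), hK' _ _ hxy, exp_add, mul_assoc]

theorem PlaneOriented.symm {h : ℂ ≃ₜ ℂ} (hh : PlaneOriented h) : PlaneOriented h.symm := by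
  obtain ⟨L, hL, hL'⟩ := hh
  refine ⟨fun q => -L (h.symm q.1, h.symm q.2), ?_, fun x y hxy => ?_⟩
  · exact (hL.comp (by fun_prop) fun q hq => h.symm.injective.ne hq).neg
  · have := hL' (h.symm x) (h.symm y) (h.symm.injective.ne hxy)
    rw [h.apply_symm_apply, h.apply_symm_apply] at this
    rw [this, ← mul_assoc, ← exp_add]
    simp

theorem planeOriented_id : PlaneOriented id :=
  ⟨fun _ => 0, continuousOn_const, fun x y _ => by simp⟩

theorem PlaneOriented.iterate {h : ℂ → ℂ} (hh : PlaneOriented h) (hc : Continuous h) (n : ℕ) :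
    PlaneOriented h^[n] := by
  induction n with
  | zero => exact planeOriented_id
  | succ n ih => exact ih.comp hh hc

theorem isPreconnected_offDiag_complex : IsPreconnected {q : ℂ × ℂ | q.1 ≠ q.2} := by
  have : {q : ℂ × ℂ | q.1 ≠ q.2} = range (fun q : ℂ × ℂ => (q.1 + exp q.2, q.1)) := by
    ext ⟨x, y⟩
    constructor
    · intro h
      exact ⟨(y, log (x - y)), by simp [exp_log (sub_ne_zero.2 h)]⟩
    · rintro ⟨⟨a, b⟩, h⟩
      simp only [Prod.mk.injEq] at h
      obtain ⟨rfl, rfl⟩ := h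
      simp [exp_ne_zero]
  rw [this]
  exact isPreconnected_range (by fun_prop)

/-- A difference-quotient logarithm is symmetric. -/
theorem planeOriented_log_symm {h : ℂ → ℂ} {L : ℂ × ℂ → ℂ}
    (hL : ContinuousOn L {q | q.1 ≠ q.2})
    (hL' : ∀ x y, x ≠ y → h x - h y = exp (L (x, y)) * (x - y)) {x y : ℂ} (hxy : x ≠ y) :
    L (x, y) = L (y, x) := by
  obtain ⟨n, hn⟩ := exists_int_log_eq isPreconnected_offDiag_complex hL
    (l₂ := fun q => L (q.2, q.1))
    (hL.comp (by fun_prop) fun q (hq : q.1 ≠ q.2) => hq.symm) (by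
      rintro ⟨a, b⟩ (hab : a ≠ b)
      have h1 := hL' a b hab
      have h2 := hL' b a hab.symm
      have : (exp (L (a, b)) - exp (L (b, a))) * (a - b) = 0 := by linear_combination -h1 - h2
      exact sub_eq_zero.1 ((mul_eq_zero.1 this).resolve_right (sub_ne_zero.2 hab)))
  have h1 := hn (x, y) hxy
  have h2 := hn (y, x) hxy.symm
  simp only at h1 h2
  have : (n : ℂ) * (2 * Real.pi * I) = 0 := by linear_combination (-1/2) * h1 - (1/2) * h2
  rw [h1, this, add_zero]

/-- The logarithm can be normalised when two points are fixed, and then its sum over orbits of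
pairs vanishes. -/
theorem PlaneOriented.exists_normalized_log {g : ℂ → ℂ} (hg : Continuous g) (ho : PlaneOriented g)
    {p : ℕ} (hp : g^[p] = id) {a b : ℂ} (hab : a ≠ b) (ha : g a = a) (hb : g b = b) :
    ∃ L : ℂ × ℂ → ℂ, ContinuousOn L {q | q.1 ≠ q.2} ∧
      (∀ x y, x ≠ y → g x - g y = exp (L (x, y)) * (x - y)) ∧
      ∀ x y, x ≠ y → ∑ i ∈ Finset.range p, L (g^[i] x, g^[i] y) = 0 := by
  have hi := ho.injective
  obtain ⟨L, hL, hL'⟩ := ho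
  have hexp : exp (L (a, b)) = 1 := by
    have := hL' a b hab
    rw [ha, hb] at this
    exact (mul_right_cancel₀ (sub_ne_zero.2 hab) ((one_mul _).trans this)).symm
  have hK : ContinuousOn (fun q => L q - L (a, b)) {q : ℂ × ℂ | q.1 ≠ q.2} :=
    hL.sub continuousOn_const
  have hK' : ∀ x y, x ≠ y → g x - g y = exp (L (x, y) - L (a, b)) * (x - y) := by
    intro x y hxy
    rw [exp_sub, hexp, div_one, hL' x y hxy]
  refine ⟨_, hK, hK', ?_⟩
  have key : ∀ n : ℕ, ∀ x y, x ≠ y → g^[n] x - g^[n] y =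
      exp (∑ i ∈ Finset.range n, (L (g^[i] x, g^[i] y) - L (a, b))) * (x - y) := by
    intro n x y hxy
    induction n with
    | zero => simp
    | succ n ih =>
      rw [Finset.sum_range_succ, exp_add, mul_right_comm, ← ih, mul_comm,
        ← hK' _ _ ((hi.iterate n).ne hxy), Function.iterate_succ_apply',
        Function.iterate_succ_apply']
  obtain ⟨n, hn⟩ := exists_int_log_eq isPreconnected_offDiag_complex
    (l₁ := fun q : ℂ × ℂ => ∑ i ∈ Finset.range p, (L (g^[i] q.1, g^[i] q.2) - L (a, b)))
    (l₂ := fun _ => 0)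
    (continuousOn_finsetSum _ fun i _ => by
      have := hg.iterate i
      exact hK.comp (f := fun q : ℂ × ℂ => (g^[i] q.1, g^[i] q.2)) (by fun_prop)
        fun q hq => (hi.iterate i).ne hq) continuousOn_const (by
      rintro ⟨x, y⟩ (hxy : x ≠ y)
      have := key p x y hxy
      rw [hp] at this
      simp only [exp_zero]
      exact (mul_right_cancel₀ (sub_ne_zero.2 hxy) ((one_mul _).trans this)).symm)
  have h0 : (0 : ℂ) = n * (2 * Real.pi * I) := by
    have := hn (a, b) hab
    simpa [Function.iterate_fixed ha, Function.iterate_fixed hb] using this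
  intro x y hxy
  have := hn (x, y) hxy
  rw [← h0] at this
  simpa using this

/-- A degree one involution of the plane with two fixed points is the identity. -/
theorem PlaneOriented.involutive_eq_id {h : ℂ → ℂ} (hc : Continuous h) (ho : PlaneOriented h)
    (hi : Function.Involutive h) {a b : ℂ} (hab : a ≠ b) (ha : h a = a) (hb : h b = b) (x : ℂ) :
    h x = x := by
  by_contra hx
  obtain ⟨L, hL, hL', hs⟩ := ho.exists_normalized_log hc (p := 2) (funext hi) hab ha hb
  have h1 := hs x (h x) (Ne.symm hx)
  simp only [Finset.sum_range_succ, Finset.range_zero, Finset.sum_empty, Function.iterate_succ,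
    Function.iterate_zero, Function.comp, id, hi x, zero_add] at h1
  rw [planeOriented_log_symm hL hL' hx] at h1
  have h2 : L (x, h x) = 0 := by linear_combination h1 / 2
  have h3 := hL' x (h x) (Ne.symm hx)
  rw [hi x, h2, exp_zero] at h3
  exact hx (by linear_combination (1/2) * h3)

/-- Parameter pairs of distinct points on a simple closed curve of period `p`. -/
def chordDomain (p : ℝ) : Set (ℝ × ℝ) := {q | q.1 < q.2 ∧ q.2 < q.1 + p}

theorem convex_chordDomain (p : ℝ) : Convex ℝ (chordDomain p) := by
  rintro ⟨a, b⟩ ⟨h1, h2⟩ ⟨c, d⟩ ⟨h3, h4⟩ s t hs ht hst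
  simp only at h1 h2 h3 h4
  obtain rfl : t = 1 - s := by linarith
  refine ⟨?_, ?_⟩ <;> simp only [Prod.fst_add, Prod.smul_fst, Prod.snd_add, Prod.smul_snd,
    smul_eq_mul]
  · rcases hs.eq_or_lt with rfl | hs
    · simpa using h3
    · nlinarith [mul_pos hs (sub_pos.2 h1), mul_nonneg ht (sub_pos.2 h3).le]
  · rcases hs.eq_or_lt with rfl | hs
    · simpa using h4
    · nlinarith [mul_pos hs (sub_pos.2 h2), mul_nonneg ht (sub_pos.2 h4).le]

theorem isOpen_chordDomain (p : ℝ) : IsOpen (chordDomain p) :=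
  (isOpen_lt continuous_fst continuous_snd).inter
    (isOpen_lt continuous_snd (continuous_fst.add continuous_const))

/-- The chords of a simple closed curve have a continuous logarithm, and its change under
exchanging the end points is an odd multiple of `πi`. -/
theorem exists_chord_log {C : ℝ → ℂ} (hC : Continuous C) {p : ℝ} (hp : 0 < p)
    (hper : ∀ r, C (r + p) = C r) (hinj : ∀ r r', r < r' → r' < r + p → C r' ≠ C r) :
    ∃ (l : ℝ × ℝ → ℂ) (W : ℤ), ContinuousOn l (chordDomain p) ∧
      (∀ q ∈ chordDomain p, exp (l q) = C q.2 - C q.1) ∧ Odd W ∧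
      ∀ q ∈ chordDomain p, l (q.2, q.1 + p) = l q + Real.pi * I * W := by
  obtain ⟨l, hl, hl'⟩ := exists_continuousOn_log (convex_chordDomain p) (isOpen_chordDomain p)
    ⟨(0, p / 2), by constructor <;> simp <;> linarith⟩
    (g := fun q => C q.2 - C q.1) (by fun_prop) fun q hq => sub_ne_zero.2 (hinj _ _ hq.1 hq.2)
  have hswap : ∀ q ∈ chordDomain p, ((q.2, q.1 + p) : ℝ × ℝ) ∈ chordDomain p :=
    fun q hq => ⟨hq.2, by simpa using hq.1⟩
  obtain ⟨n, hn⟩ := exists_int_log_eq (convex_chordDomain p).isPreconnected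
    (l₁ := fun q => l (q.2, q.1 + p)) (l₂ := fun q => l q + Real.pi * I)
    (hl.comp (by fun_prop) hswap) (hl.add continuousOn_const) fun q hq => by
      rw [hl' _ (hswap q hq), exp_add, hl' q hq, exp_pi_mul_I, hper]
      ring
  refine ⟨l, 2 * n + 1, hl, hl', ⟨n, rfl⟩, fun q hq => ?_⟩
  rw [hn q hq]
  push_cast
  ring

/-- A map of the plane permuting cyclically the arcs of a simple closed curve has a fixed point. -/
theorem exists_fixed_of_invariant_curve {G : ℂ → ℂ} (hG : Continuous G) {C : ℝ → ℂ}
    (hC : Continuous C) {p : ℝ} (hp : 1 < p) (hper : ∀ r, C (r + p) = C r)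
    (hinj : ∀ r r', r < r' → r' < r + p → C r' ≠ C r) (hGC : ∀ r, C (r + 1) = G (C r)) :
    ∃ z, G z = z := by
  by_contra! hfix
  obtain ⟨l, W, hl, hl', hW, hlW⟩ := exists_chord_log hC (by linarith) hper hinj
  obtain ⟨k, hk, hk'⟩ := exists_continuous_log (g := fun z => G z - z) (by fun_prop)
    fun z => sub_ne_zero.2 (hfix z)
  have hmem : ∀ r : ℝ, ((r, r + 1) : ℝ × ℝ) ∈ chordDomain p := fun r => ⟨by simp, by simpa⟩
  obtain ⟨n, hn⟩ := exists_int_log_eq isPreconnected_univ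
    (l₁ := fun r : ℝ => l (r, r + 1)) (l₂ := fun r => k (C r))
    (hl.comp (by fun_prop) fun r _ => hmem r) (by fun_prop) fun r _ => by
      rw [hl' _ (hmem r), hk', hGC]
  have h1 := hlW _ (hmem 0)
  have h2 := hlW (0 + 1, 0 + p) ⟨by simpa, by simp⟩
  have h3 := hn 0 trivial
  have h4 := hn p trivial
  simp only at h1 h2 h3 h4
  have h5 : C p = C 0 := by simpa using hper 0
  rw [h5] at h4
  simp only [zero_add] at h1 h2 h3
  rw [add_comm 1 p] at h2
  have h6 : (Real.pi * I : ℂ) * W = 0 := by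
    linear_combination (1/2 : ℂ) * (h4 - h3 - h2 - h1)
  have h7 : W = 0 := by
    simpa [Real.pi_ne_zero] using h6
  rw [h7] at hW
  simp at hW

/-- If the sum of the difference-quotient logarithm over orbits vanishes, the rotation number of
an invariant simple closed curve is divisible by the order. -/
theorem dvd_rotation {G : ℂ → ℂ} {L : ℂ × ℂ → ℂ}
    (hL : ContinuousOn L {q | q.1 ≠ q.2})
    (hL' : ∀ x y, x ≠ y → G x - G y = exp (L (x, y)) * (x - y)) {p : ℕ} (hp : 0 < p)
    (hs : ∀ x y, x ≠ y → ∑ i ∈ Finset.range p, L (G^[i] x, G^[i] y) = 0) {C : ℝ → ℂ}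
    (hC : Continuous C) (hinj : ∀ r r' : ℝ, r < r' → r' < r + p → C r' ≠ C r)
    (hGC : ∀ r, C (r + 1) = G (C r)) {l : ℝ × ℝ → ℂ} {W : ℤ}
    (hl : ContinuousOn l (chordDomain p))
    (hl' : ∀ q ∈ chordDomain p, exp (l q) = C q.2 - C q.1)
    (hlW : ∀ q ∈ chordDomain p, l (q.2, q.1 + p) = l q + Real.pi * I * W) : (p : ℤ) ∣ W := by
  have hmem : ∀ n : ℕ, ∀ q ∈ chordDomain (p : ℝ),
      ((q.1 + n, q.2 + n) : ℝ × ℝ) ∈ chordDomain (p : ℝ) := fun n q hq =>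
    ⟨by simpa using hq.1, by have := hq.2; simp only; linarith⟩
  have hmem1 : ∀ q ∈ chordDomain (p : ℝ), ((q.1 + 1, q.2 + 1) : ℝ × ℝ) ∈ chordDomain (p : ℝ) :=
    fun q hq => by simpa using hmem 1 q hq
  obtain ⟨c, hc⟩ := exists_int_log_eq (convex_chordDomain (p : ℝ)).isPreconnected
    (l₁ := fun q => l (q.1 + 1, q.2 + 1)) (l₂ := fun q => l q + L (C q.2, C q.1))
    (hl.comp (by fun_prop) hmem1)
    (hl.add (hL.comp (f := fun q : ℝ × ℝ => (C q.2, C q.1)) (by fun_prop)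
      fun q hq => hinj _ _ hq.1 hq.2)) fun q hq => by
      rw [hl' _ (hmem1 q hq), exp_add, hl' q hq]
      simp only
      rw [hGC, hGC, hL' _ _ (hinj _ _ hq.1 hq.2), mul_comm]
  have hCn : ∀ (n : ℕ) (r : ℝ), C (r + n) = G^[n] (C r) := by
    intro n r
    induction n with
    | zero => simp
    | succ n ih => rw [Function.iterate_succ_apply', ← ih, ← hGC]; push_cast; ring_nf
  have key : ∀ n : ℕ, ∀ q ∈ chordDomain (p : ℝ), l (q.1 + n, q.2 + n) =
      l q + ∑ i ∈ Finset.range n, L (G^[i] (C q.2), G^[i] (C q.1)) +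
        n * (c * (2 * Real.pi * I)) := by
    intro n q hq
    induction n with
    | zero => simp
    | succ n ih =>
      have := hc _ (hmem n q hq)
      simp only at this
      rw [Finset.sum_range_succ, ← hCn, ← hCn]
      push_cast
      rw [← add_assoc, ← add_assoc, this, ih]
      ring
  have hp' : (0 : ℝ) < p := by exact_mod_cast hp
  have h0 : ((0, p / 2) : ℝ × ℝ) ∈ chordDomain (p : ℝ) := by
    constructor <;> simp <;> linarith
  have h1 := key p _ h0
  have h2 := hlW _ h0
  have h3 := hlW (p / 2, 0 + p) ⟨by simp; linarith, by simp; linarith⟩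
  simp only [] at h1 h2 h3
  rw [hs _ _ (hinj _ _ h0.1 h0.2)] at h1
  refine ⟨c, ?_⟩
  have h4 : (2 * Real.pi * I : ℂ) * W = (2 * Real.pi * I) * (p * c) := by
    linear_combination h1 - h2 - h3
  have := mul_left_cancel₀ two_pi_I_ne_zero h4
  exact_mod_cast this

theorem log_sub_eq_of_ratio {s : Set ℝ} (hs : IsPreconnected s) {f h ρ : ℝ → ℂ}
    (hf : ContinuousOn f s) (hh : ContinuousOn h s) (hρ : ContinuousOn ρ s)
    (hm : ∀ t ∈ s, ρ t ∈ slitPlane) (he : ∀ t ∈ s, exp (f t) = exp (h t) * ρ t) {a b : ℝ}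
    (ha : a ∈ s) (hb : b ∈ s) : f b - f a = h b - h a + (log (ρ b) - log (ρ a)) := by
  obtain ⟨n, hn⟩ := exists_int_log_eq hs hf (hh.add (hρ.clog hm)) fun t ht => by
    simp only [Pi.add_apply]
    rw [he t ht, exp_add, exp_log (slitPlane_ne_zero (hm t ht))]
  have h1 := hn a ha
  have h2 := hn b hb
  simp only [Pi.add_apply] at h1 h2
  rw [h1, h2]
  ring

theorem log_one_add_eq {ξ : ℂ} (hξ : ξ ∈ slitPlane) :
    log (1 + ξ) = log ξ + log (1 + 1 / ξ) := by
  have h0 : ξ ≠ 0 := slitPlane_ne_zero hξ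
  have h1 : 1 + 1 / ξ ≠ 0 := by
    intro h
    have : ξ = -1 := by
      field_simp at h
      linear_combination h
    rw [this] at hξ
    exact absurd hξ (by simp [mem_slitPlane_iff])
  have h2 : 1 + ξ = ξ * (1 + 1 / ξ) := by field_simp; ring
  have him : (1 + 1 / ξ).im = - ξ.im / normSq ξ := by simp [inv_im]
  have hN : 0 < normSq ξ := normSq_pos.2 h0
  rw [h2, log_mul h0 h1]
  have b1 := neg_pi_lt_arg ξ
  have b2 := (arg_le_pi ξ).lt_of_ne (mem_slitPlane_iff_arg.1 hξ).1
  have b3 := neg_pi_lt_arg (1 + 1 / ξ)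
  have b4 := arg_le_pi (1 + 1 / ξ)
  have e1 : ξ.im < 0 ↔ ξ.arg < 0 := arg_neg_iff.symm
  have e2 : 0 ≤ (1 + 1 / ξ).im ↔ 0 ≤ (1 + 1 / ξ).arg := arg_nonneg_iff.symm
  rcases lt_trichotomy ξ.im 0 with h | h | h
  · have h3 : 0 ≤ (1 + 1 / ξ).arg := e2.1 (him ▸ div_nonneg (by linarith) hN.le)
    have h4 := e1.1 h
    constructor <;> linarith
  · have hre : 0 < ξ.re := by
      rcases mem_slitPlane_iff.1 hξ with h' | h'
      · exact h'
      · exact absurd h h'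
    have a1 : ξ.arg = 0 := arg_eq_zero_iff.2 ⟨hre.le, h⟩
    have a2 : (1 + 1 / ξ).arg = 0 := by
      refine arg_eq_zero_iff.2 ⟨?_, by rw [him, h]; simp⟩
      have : (1 + 1 / ξ).re = 1 + ξ.re / normSq ξ := by simp [inv_re]
      rw [this]
      positivity
    rw [a1, a2]
    constructor <;> linarith [Real.pi_pos]
  · have h3 : ¬ 0 ≤ (1 + 1 / ξ).arg := fun h' => by
      have := e2.2 h'
      rw [him, neg_div] at this
      have := div_pos h hN
      linarith
    have h4 := e1.not.1 (by linarith)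
    constructor <;> linarith

theorem one_sub_segment_mem_slitPlane {w : ℂ} (hw : 1 - w ∈ slitPlane) {t : ℝ} (h0 : 0 ≤ t)
    (h1 : t ≤ 1) : 1 - t * w ∈ slitPlane := by
  have := starConvex_one_slitPlane hw (sub_nonneg.2 h1) h0 (by ring)
  convert this using 1
  simp
  ring

theorem one_sub_mem_slitPlane_of_norm_lt {w : ℂ} (hw : ‖w‖ < 1) : 1 - w ∈ slitPlane := by
  refine mem_slitPlane_iff.2 (Or.inl ?_)
  have := (re_le_norm w).trans_lt hw
  simpa using this

/-- Local computation at the corner of a curve: a ray from `x` missing `x + d`. -/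
theorem one_sub_div_mem_slitPlane {C : ℝ → ℂ} {x v d : ℂ} {s : ℝ}
    (hC : ∀ u ∈ Icc (0 : ℝ) (1 / 2), C (s * u) = x + 2 * u * v) (hne : ∀ t, C t ≠ x + d)
    (hd : ‖d‖ < ‖v‖) : 1 - v / d ∈ slitPlane ∧ -(v / d) ∈ slitPlane := by
  have hd0 : d ≠ 0 := by
    rintro rfl
    refine hne (s * 0) ?_
    rw [hC 0 (by constructor <;> norm_num)]
    simp
  have hw : 1 < ‖v / d‖ := by
    rw [norm_div, one_lt_div (norm_pos_iff.2 hd0)]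
    exact hd
  have key : ¬ ((v / d).im = 0 ∧ 0 ≤ (v / d).re) := by
    rintro ⟨h1, h2⟩
    have e : v / d = ((v / d).re : ℂ) := Complex.ext (by simp) (by simp [h1])
    have h3 : 1 < (v / d).re := by
      rw [e, norm_real, Real.norm_eq_abs, abs_of_nonneg h2] at hw
      exact hw
    refine hne (s * (1 / (2 * (v / d).re))) ?_
    have e2 : v = (v / d).re * d := by rw [← e]; field_simp
    have e3 : ((v / d).re : ℂ) ≠ 0 := by
      exact_mod_cast (by linarith : (v / d).re ≠ 0)
    rw [hC]
    · congr 1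
      conv_lhs => rw [e2]
      generalize (v / d).re = t at *
      push_cast
      field_simp
      simp [e3]
    · constructor
      · positivity
      · rw [div_le_div_iff₀ (by positivity) (by norm_num)]
        linarith
  constructor
  · by_contra h
    rw [mem_slitPlane_iff, not_or] at h
    simp only [sub_re, one_re, sub_im, one_im, not_not, not_lt] at h
    exact key ⟨by linarith [h.2], by linarith [h.1]⟩
  · by_contra h
    rw [mem_slitPlane_iff, not_or] at h
    simp only [neg_re, neg_im, not_not, not_lt] at h
    exact key ⟨by linarith [h.2], by linarith [h.1]⟩

/-- A simple closed curve with a straight corner inside a round disc, and with winding number zero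
about a point of that disc, has rotation number `±1`. -/
theorem rotation_eq_of_corner {C : ℝ → ℂ} (hC : Continuous C) {p : ℝ} (hp : 1 ≤ p)
    (hper : ∀ r, C (r + p) = C r) {x v₁ v₂ d : ℂ} (hv : ‖v₁‖ = ‖v₂‖) (hne : v₁ ≠ v₂)
    (hC₂ : ∀ u ∈ Icc (0 : ℝ) (1 / 2), C u = x + 2 * u * v₂)
    (hC₁ : ∀ u ∈ Icc (0 : ℝ) (1 / 2), C (-u) = x + 2 * u * v₁)
    (hout : ∀ σ ∈ Icc (1 / 2) (p - 1 / 2), ‖v₁‖ ≤ ‖C σ - x‖) (hd : ‖d‖ < ‖v₁‖)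
    {ω : ℝ → ℂ} (hω : Continuous ω) (hω' : ∀ r, exp (ω r) = C r - (x + d))
    (hωp : ∀ r, ω (r + p) = ω r) {l : ℝ × ℝ → ℂ} {W : ℤ}
    (hl : ContinuousOn l (chordDomain p))
    (hl' : ∀ q ∈ chordDomain p, exp (l q) = C q.2 - C q.1) (hW : Odd W)
    (hlW : ∀ q ∈ chordDomain p, l (q.2, q.1 + p) = l q + Real.pi * I * W) : |W| = 1 := by
  have hmiss : ∀ t, C t ≠ x + d := fun t h => exp_ne_zero (ω t) (by rw [hω', h, sub_self])
  obtain ⟨m2, n2⟩ := one_sub_div_mem_slitPlane (s := 1) (C := C) (x := x) (v := v₂) (d := d)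
    (by simpa using hC₂) hmiss (by rwa [← hv])
  obtain ⟨m1, n1⟩ := one_sub_div_mem_slitPlane (s := -1) (C := C) (x := x) (v := v₁) (d := d)
    (by simpa using hC₁) hmiss hd
  have hv1 : v₁ ≠ 0 := norm_pos_iff.1 ((norm_nonneg d).trans_lt hd)
  have hv2 : v₂ ≠ 0 := norm_pos_iff.1 (hv ▸ (norm_nonneg d).trans_lt hd)
  have hd0 : d ≠ 0 := by
    rintro rfl
    simp at n1
  have nξ : -(v₂ / v₁) ∈ slitPlane := by
    by_contra h
    rw [mem_slitPlane_iff, not_or] at h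
    simp only [neg_re, neg_im, not_not, not_lt] at h
    have e : v₂ / v₁ = ((v₂ / v₁).re : ℂ) := Complex.ext (by simp) (by simp; linarith [h.2])
    have h1 : ‖v₂ / v₁‖ = 1 := by
      rw [norm_div, hv, div_self (norm_ne_zero_iff.2 hv2)]
    rw [e, norm_real, Real.norm_eq_abs, abs_of_nonneg (by linarith [h.1])] at h1
    rw [h1, ofReal_one, div_eq_one_iff_eq hv1] at e
    exact hne e.symm
  -- the chord of constant length through the corner
  have s1 : l (1 / 2, p) - l (0, p - 1 / 2) = log (-(v₂ / v₁)) := by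
    have hm : ∀ u ∈ Icc (0 : ℝ) (1 / 2), ((u, u + (p - 1 / 2)) : ℝ × ℝ) ∈ chordDomain p :=
      fun u hu => ⟨by simp; linarith, by simp⟩
    have hD : ∀ u ∈ Icc (0 : ℝ) (1 / 2), exp (l (u, u + (p - 1 / 2))) =
        v₁ * (1 - u * (2 * (1 + v₂ / v₁) - 0)) := fun u hu => by
      have := hC₁ (1 / 2 - u) ⟨by linarith [hu.2], by linarith [hu.1]⟩
      rw [hl' _ (hm u hu)]
      simp only
      rw [hC₂ u hu, show u + (p - 1 / 2) = -(1 / 2 - u) + p by ring, hper, this]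
      push_cast
      field_simp
      ring
    have hm' : ∀ u ∈ Icc (0 : ℝ) (1 / 2), (1 - u * (2 * (1 + v₂ / v₁) - 0) : ℂ) ∈ slitPlane := by
      intro u hu
      have := one_sub_segment_mem_slitPlane (w := 1 + v₂ / v₁) (t := 2 * u)
        (by convert nξ using 1; ring) (by linarith [hu.1]) (by linarith [hu.2])
      convert this using 1
      push_cast
      ring
    have := log_sub_eq_of_ratio (s := Icc (0 : ℝ) (1 / 2)) isPreconnected_Icc
      (f := fun u => l (u, u + (p - 1 / 2))) (h := fun _ => log v₁)
      (hl.comp (by fun_prop) hm) continuousOn_const (by fun_prop) hm'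
      (fun u hu => by rw [exp_log hv1]; exact hD u hu)
      (a := 0) (b := 1 / 2) (by constructor <;> norm_num) (by constructor <;> norm_num)
    simp only [zero_add] at this
    rw [show (1 / 2 + (p - 1 / 2) : ℝ) = p by ring] at this
    rw [this]
    simp
  have cx : C 0 = x := by simpa using hC₂ 0 (by constructor <;> norm_num)
  have c2 : C (1 / 2) = x + v₂ := by
    rw [hC₂ (1 / 2) (by constructor <;> norm_num)]; push_cast; ring
  have c1 : C (p - 1 / 2) = x + v₁ := by
    rw [show p - 1 / 2 = -(1 / 2) + p by ring, hper,
      hC₁ (1 / 2) (by constructor <;> norm_num)]; push_cast; ring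
  -- the chords from the corner to the outer part of the curve
  have s2 : ω (p - 1 / 2) - ω (1 / 2) = l (0, p - 1 / 2) - l (0, 1 / 2) +
      (log (1 - d / v₁) - log (1 - d / v₂)) := by
    have hm : ∀ u ∈ Icc (1 / 2) (p - 1 / 2), ((0, u) : ℝ × ℝ) ∈ chordDomain p :=
      fun u hu => ⟨by simp; linarith [hu.1], by simp; linarith [hu.2]⟩
    have h0 : ∀ u ∈ Icc (1 / 2) (p - 1 / 2), C u - x ≠ 0 := fun u hu h => by
      have := hout u hu
      rw [h, norm_zero] at this
      linarith [norm_nonneg d]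
    have := log_sub_eq_of_ratio (s := Icc (1 / 2) (p - 1 / 2)) isPreconnected_Icc
      (f := ω) (h := fun u => l (0, u)) (ρ := fun u => 1 - d / (C u - x))
      hω.continuousOn (hl.comp (by fun_prop) hm)
      (continuousOn_const.sub (continuousOn_const.div (by fun_prop) h0))
      (fun u hu => one_sub_mem_slitPlane_of_norm_lt (by
        rw [norm_div, div_lt_one (norm_pos_iff.2 (h0 u hu))]
        exact hd.trans_le (hout u hu)))
      (fun u hu => by
        rw [hω', hl' _ (hm u hu)]
        simp only
        rw [cx]
        have := h0 u hu
        field_simp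
        ring)
      (a := 1 / 2) (b := p - 1 / 2) (by constructor <;> linarith) (by constructor <;> linarith)
    simp only [c1, c2, add_sub_cancel_left] at this
    exact this
  -- the two rays at the corner
  have ray : ∀ (s : ℝ) (v : ℂ), (∀ u ∈ Icc (0 : ℝ) (1 / 2), C (s * u) = x + 2 * u * v) →
      1 - v / d ∈ slitPlane → ω (s * (1 / 2)) - ω 0 = log (1 - v / d) := by
    intro s v hv hm
    have := log_sub_eq_of_ratio (s := Icc (0 : ℝ) (1 / 2)) isPreconnected_Icc
      (f := fun u => ω (s * u)) (h := fun _ => ω 0) (ρ := fun u => 1 - (2 * u : ℝ) * (v / d))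
      (by fun_prop) continuousOn_const (by fun_prop)
      (fun u hu => one_sub_segment_mem_slitPlane hm (by linarith [hu.1]) (by linarith [hu.2]))
      (fun u hu => by
        rw [hω', hω', cx, hv u hu]
        push_cast
        field_simp
        ring)
      (a := 0) (b := 1 / 2) (by constructor <;> norm_num) (by constructor <;> norm_num)
    simpa using this
  have r2 := ray 1 v₂ (by simpa using hC₂) m2
  have r1 := ray (-1) v₁ (by simpa using hC₁) m1
  have r1' := hωp (-1 * (1 / 2))
  rw [show (-1 * (1 / 2) + p : ℝ) = p - 1 / 2 by ring] at r1'
  have q1 := log_one_add_eq n1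
  have q2 := log_one_add_eq n2
  have w := hlW (0, 1 / 2) ⟨by simp, by simp; linarith⟩
  simp only [zero_add] at w
  rw [← sub_eq_add_neg, show 1 + 1 / -(v₁ / d) = 1 - d / v₁ by field_simp; ring] at q1
  rw [← sub_eq_add_neg, show 1 + 1 / -(v₂ / d) = 1 - d / v₂ by field_simp; ring] at q2
  rw [one_mul] at r2
  have fin : (Real.pi * I * W : ℂ) = log (-(v₂ / v₁)) + log (-(v₁ / d)) - log (-(v₂ / d)) := by
    linear_combination s1 - w - s2 + r1' + r1 - r2 + q1 - q2
  have fin2 := congrArg Complex.im fin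
  simp [log_im] at fin2
  have b : ∀ z ∈ slitPlane, -Real.pi < arg z ∧ arg z < Real.pi := fun z hz =>
    ⟨neg_pi_lt_arg z, (arg_le_pi z).lt_of_ne (mem_slitPlane_iff_arg.1 hz).1⟩
  have b1 := b _ nξ
  have b2 := b _ n1
  have b3 := b _ n2
  have hlt : |Real.pi * W| < Real.pi * 3 := by
    rw [abs_lt, fin2]
    constructor <;> linarith [b1.1, b1.2, b2.1, b2.2, b3.1, b3.2]
  rw [abs_mul, abs_of_pos Real.pi_pos] at hlt
  have hlt2 := lt_of_mul_lt_mul_left hlt Real.pi_pos.le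
  have hlt3 : |W| < 3 := by exact_mod_cast hlt2
  obtain ⟨k, rfl⟩ := hW
  rw [abs_lt] at hlt3
  have : k = 0 ∨ k = -1 := by omega
  rcases this with rfl | rfl <;> simp

/-- The closed curve `C` of period `p` misses `c` and has winding number zero about `c`. -/
def ZeroWinding (C : ℝ → ℂ) (p : ℝ) (c : ℂ) : Prop :=
  ∃ ω : ℝ → ℂ, Continuous ω ∧ (∀ r, exp (ω r) = C r - c) ∧ ∀ r, ω (r + p) = ω r

theorem ZeroWinding.ne {C : ℝ → ℂ} {p : ℝ} {c : ℂ} (h : ZeroWinding C p c) (r : ℝ) : C r ≠ c := by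
  obtain ⟨ω, -, h, -⟩ := h
  intro hr
  exact exp_ne_zero (ω r) (by rw [h, hr, sub_self])

theorem ZeroWinding.of_near {C : ℝ → ℂ} (hC : Continuous C) {p : ℝ} (hper : ∀ r, C (r + p) = C r)
    {c c' : ℂ} (h : ZeroWinding C p c) (hcc : ∀ r, ‖c' - c‖ < ‖C r - c‖) : ZeroWinding C p c' := by
  have hne : ∀ r, C r - c ≠ 0 := fun r => sub_ne_zero.2 (h.ne r)
  have hm : ∀ r, 1 - (c' - c) / (C r - c) ∈ slitPlane := fun r =>
    one_sub_mem_slitPlane_of_norm_lt (by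
      rw [norm_div, div_lt_one (norm_pos_iff.2 (hne r))]
      exact hcc r)
  obtain ⟨ω, hω, h1, h2⟩ := h
  refine ⟨fun r => ω r + log (1 - (c' - c) / (C r - c)), ?_, fun r => ?_, fun r => ?_⟩
  · refine hω.add (Continuous.clog ?_ hm)
    exact continuous_const.sub (continuous_const.div (by fun_prop) hne)
  · rw [exp_add, h1, exp_log (slitPlane_ne_zero (hm r))]
    have := hne r
    field_simp
    ring
  · simp only [h2, hper]

theorem zeroWinding_of_norm_lt {C : ℝ → ℂ} (hC : Continuous C) {p : ℝ}
    (hper : ∀ r, C (r + p) = C r) {c : ℂ} (h : ∀ r, ‖C r‖ < ‖c‖) : ZeroWinding C p c := by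
  have hc : c ≠ 0 := norm_pos_iff.1 ((norm_nonneg _).trans_lt (h 0))
  have hm : ∀ r, 1 - C r / c ∈ slitPlane := fun r =>
    one_sub_mem_slitPlane_of_norm_lt (by
      rw [norm_div, div_lt_one (norm_pos_iff.2 hc)]
      exact h r)
  refine ⟨fun r => log (-c) + log (1 - C r / c), ?_, fun r => ?_, fun r => ?_⟩
  · exact continuous_const.add (Continuous.clog (by fun_prop) hm)
  · rw [exp_add, exp_log (neg_ne_zero.2 hc), exp_log (slitPlane_ne_zero (hm r))]
    field_simp
    ring
  · simp only [hper]

theorem ZeroWinding.map {C : ℝ → ℂ} (hC : Continuous C) {p : ℝ} (hper : ∀ r, C (r + p) = C r)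
    {G : ℂ → ℂ} (ho : PlaneOriented G) (hGC : ∀ r, C (r + 1) = G (C r)) {c : ℂ}
    (h : ZeroWinding C p c) : ZeroWinding C p (G c) := by
  have hne := h.ne
  obtain ⟨L, hL, hL'⟩ := ho
  obtain ⟨ω, hω, h1, h2⟩ := h
  refine ⟨fun r => ω (r - 1) + L (C (r - 1), c), ?_, fun r => ?_, fun r => ?_⟩
  · exact (hω.comp (by fun_prop)).add
      (hL.comp_continuous (f := fun r => (C (r - 1), c)) (by fun_prop) fun r => hne _)
  · have := hGC (r - 1)
    rw [sub_add_cancel] at this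
    rw [exp_add, h1, this, hL' _ _ (hne _), mul_comm]
  · simp only [add_sub_right_comm, h2, hper]

theorem exists_zeroWinding {C : ℝ → ℂ} (hC : Continuous C) {p : ℕ} (hp : 0 < p)
    (hper : ∀ r, C (r + p) = C r) {G : ℂ → ℂ} (hG : Continuous G) (ho : PlaneOriented G)
    (hGC : ∀ r, C (r + 1) = G (C r)) {B T : Set ℂ} (hB : IsOpen B)
    (hT : T.Countable) (hTC : T ⊆ range C) (hcov : ∀ r, C r ∉ T → ∃ i : ℕ, G^[i] (C r) ∈ B)
    {x : ℂ} (hx : x ∈ B) (hxT : x ∉ T) : ∃ c ∈ B, ZeroWinding C p c := by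
  by_contra! hno
  have hp' : (0 : ℝ) < p := by exact_mod_cast hp
  have hcpt : IsCompact (range C) := by
    have hP : Function.Periodic C p := hper
    rw [← hP.image_Icc hp' 0]
    exact isCompact_Icc.image hC
  have hGi : ∀ i : ℕ, ∀ c, ZeroWinding C p c → ZeroWinding C p (G^[i] c) := by
    intro i c hc
    induction i with
    | zero => exact hc
    | succ i ih => rw [Function.iterate_succ_apply']; exact ih.map hC hper ho hGC
  have gap : ∀ c ∉ range C, ∃ ε > 0, ∀ r, ε ≤ ‖C r - c‖ := by
    intro c hc
    obtain ⟨ε, hε, h⟩ := Metric.isOpen_iff.1 hcpt.isClosed.isOpen_compl c hc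
    refine ⟨ε, hε, fun r => ?_⟩
    by_contra! hlt
    exact h (by rwa [Metric.mem_ball, dist_eq_norm]) ⟨r, rfl⟩
  have hU : IsOpen {c | ZeroWinding C p c} := by
    rw [Metric.isOpen_iff]
    intro c hc
    obtain ⟨ε, hε, h⟩ := gap c (by rintro ⟨r, hr⟩; exact hc.ne r hr)
    refine ⟨ε, hε, fun c' hc' => hc.of_near hC hper fun r => ?_⟩
    rw [Metric.mem_ball, dist_eq_norm] at hc'
    exact hc'.trans_le (h r)
  have hV : IsOpen {c | c ∉ range C ∧ ¬ ZeroWinding C p c} := by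
    rw [Metric.isOpen_iff]
    rintro c ⟨hc, hz⟩
    obtain ⟨ε, hε, h⟩ := gap c hc
    refine ⟨ε / 2, half_pos hε, fun c' hc' => ?_⟩
    rw [Metric.mem_ball, dist_eq_norm] at hc'
    have h' : ∀ r, ε / 2 ≤ ‖C r - c'‖ := fun r => by
      have h1 := h r
      have h2 := norm_sub_le_norm_sub_add_norm_sub (C r) c' c
      linarith
    refine ⟨?_, fun hz' => hz (hz'.of_near hC hper fun r => ?_)⟩
    · rintro ⟨r, rfl⟩
      have := h' r
      simp at this
      linarith
    · rw [norm_sub_rev]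
      exact hc'.trans_le (h' r)
  have hconn : IsPreconnected Tᶜ :=
    (hT.isConnected_compl_of_one_lt_rank (by simp [rank_real_complex])).isPreconnected
  obtain ⟨c, hcT, hc1, hc2⟩ := hconn _ _ hU (hV.union (isOpen_iUnion fun i : ℕ =>
      hB.preimage (hG.iterate i))) (fun c hc => by
        by_cases hz : ZeroWinding C p c
        · exact Or.inl hz
        · by_cases hr : c ∈ range C
          · obtain ⟨r, rfl⟩ := hr
            exact Or.inr (Or.inr (mem_iUnion.2 (hcov r hc)))
          · exact Or.inr (Or.inl ⟨hr, hz⟩))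
    (by
      obtain ⟨M, hM⟩ := hcpt.isBounded.exists_norm_le
      have hc : ZeroWinding C p ((|M| + 1 : ℝ) : ℂ) := zeroWinding_of_norm_lt hC hper fun r => by
        rw [norm_real, Real.norm_of_nonneg (by positivity)]
        linarith [hM _ ⟨r, rfl⟩, le_abs_self M]
      refine ⟨_, fun h => ?_, hc⟩
      obtain ⟨r, hr⟩ := hTC h
      exact hc.ne r hr)
    ⟨x, hxT, Or.inr (mem_iUnion.2 ⟨0, hx⟩)⟩
  rcases hc2 with h | h
  · exact h.2 hc1
  · obtain ⟨i, hi⟩ := mem_iUnion.1 h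
    exact hno _ hi (hGi i c hc1)

theorem Equiv.Perm.continuous_zpow {X : Type*} [TopologicalSpace X] {E : Equiv.Perm X}
    (hE : Continuous E) {p : ℕ} (hp : 0 < p) (hEp : E ^ p = 1) (n : ℤ) :
    Continuous ⇑(E ^ n) := by
  have h1 : E ^ n = E ^ ((n % p).toNat) := by
    rw [zpow_eq_zpow_emod' n hEp, ← zpow_natCast,
      Int.toNat_of_nonneg (Int.emod_nonneg _ (by omega))]
  rw [h1, ← Equiv.Perm.iterate_eq_pow]
  exact hE.iterate _

/-- The broken segment from `x + v₁` through `x` to `x + v₂`, parametrised by `[-1/2, 1/2]`. -/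
noncomputable def cornerPath (x v₁ v₂ : ℂ) (t : ℝ) : ℂ :=
  x + (2 * max t 0 : ℝ) * v₂ + (2 * max (-t) 0 : ℝ) * v₁

section
variable {x v₁ v₂ : ℂ}

theorem continuous_cornerPath : Continuous (cornerPath x v₁ v₂) := by
  unfold cornerPath
  fun_prop

theorem cornerPath_of_nonneg {t : ℝ} (ht : 0 ≤ t) : cornerPath x v₁ v₂ t = x + 2 * t * v₂ := by
  simp [cornerPath, ht]

theorem cornerPath_of_nonpos {t : ℝ} (ht : t ≤ 0) : cornerPath x v₁ v₂ t = x + 2 * (-t) * v₁ := by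
  simp [cornerPath, ht]

theorem norm_cornerPath_sub (hv : ‖v₁‖ = ‖v₂‖) (t : ℝ) :
    ‖cornerPath x v₁ v₂ t - x‖ = 2 * |t| * ‖v₁‖ := by
  rcases le_total 0 t with ht | ht
  · rw [cornerPath_of_nonneg ht, add_sub_cancel_left, abs_of_nonneg ht, hv, norm_mul, norm_mul,
      norm_real, Real.norm_of_nonneg ht]
    simp
  · rw [cornerPath_of_nonpos ht, add_sub_cancel_left, abs_of_nonpos ht, norm_mul, norm_mul,
      norm_neg, norm_real, Real.norm_of_nonpos ht]
    simp

theorem cornerPath_injective (hv : ‖v₁‖ = ‖v₂‖) (hne : v₁ ≠ v₂) :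
    Function.Injective (cornerPath x v₁ v₂) := by
  have h0 : 0 < ‖v₁‖ := by
    rcases (norm_nonneg v₁).eq_or_lt with h | h
    · exact absurd ((norm_eq_zero.1 h.symm).trans (norm_eq_zero.1 (hv ▸ h.symm)).symm) hne
    · exact h
  intro s t hst
  have h1 := norm_cornerPath_sub (x := x) hv s
  rw [hst, norm_cornerPath_sub hv] at h1
  have h2 : |t| = |s| := by
    have := mul_right_cancel₀ h0.ne' h1
    linarith
  have aux : ∀ s : ℝ, 0 ≤ s → cornerPath x v₁ v₂ s = cornerPath x v₁ v₂ (-s) → s = 0 := by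
    intro s hs h
    rw [cornerPath_of_nonneg hs, cornerPath_of_nonpos (neg_nonpos.2 hs)] at h
    by_contra h0
    push_cast at h
    rw [neg_neg] at h
    exact hne (mul_left_cancel₀ (a := (2 * s : ℂ)) (by exact_mod_cast (by simpa using h0))
      (add_left_cancel h)).symm
  rcases abs_eq_abs.1 h2 with h | h
  · exact h.symm
  · subst h
    rcases le_total 0 s with hs | hs
    · simp [aux s hs hst]
    · have := aux (-s) (by linarith) (by rw [neg_neg]; exact hst.symm)
      linarith

end

/-- The orbit of an arc `γ : [-1/2, 1/2] → X` whose end is the image of its start. -/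
noncomputable def orbitCurve {X : Type*} (E : Equiv.Perm X) (γ : ℝ → X) (t : ℝ) : X :=
  (E ^ ⌊t + 1 / 2⌋) (γ (t - ⌊t + 1 / 2⌋))

section
variable {X : Type*} {E : Equiv.Perm X} {γ : ℝ → X}

theorem orbitCurve_add_one (t : ℝ) : orbitCurve E γ (t + 1) = E (orbitCurve E γ t) := by
  unfold orbitCurve
  rw [add_right_comm, Int.floor_add_one, add_comm ⌊t + 1 / 2⌋, zpow_add, zpow_one,
    Equiv.Perm.mul_apply]
  push_cast
  congr 3
  ring

theorem orbitCurve_add_nat (t : ℝ) (n : ℕ) :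
    orbitCurve E γ (t + n) = (E ^ n) (orbitCurve E γ t) := by
  induction n with
  | zero => simp
  | succ n ih =>
    rw [Nat.cast_succ, ← add_assoc, orbitCurve_add_one, ih, pow_succ', Equiv.Perm.mul_apply]

theorem orbitCurve_eq (hγ : γ (1 / 2) = E (γ (-(1 / 2)))) {n : ℤ} {t : ℝ} (h1 : n - 1 / 2 ≤ t)
    (h2 : t ≤ n + 1 / 2) : orbitCurve E γ t = (E ^ n) (γ (t - n)) := by
  rcases h2.lt_or_eq with h | h
  · have : ⌊t + 1 / 2⌋ = n := Int.floor_eq_iff.2 ⟨by linarith, by linarith⟩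
    rw [orbitCurve, this]
  · have : ⌊t + 1 / 2⌋ = n + 1 := Int.floor_eq_iff.2 ⟨by push_cast; linarith, by push_cast; linarith⟩
    rw [orbitCurve, this, h, add_comm n 1, zpow_add, zpow_one, ← zpow_one_add, add_comm 1 n,
      zpow_add, zpow_one, Equiv.Perm.mul_apply, add_sub_cancel_left, hγ]
    congr 3
    push_cast
    ring

theorem continuous_orbitCurve [TopologicalSpace X] (hE : Continuous E) {p : ℕ} (hp : 0 < p)
    (hEp : E ^ p = 1) (hγc : Continuous γ) (hγ : γ (1 / 2) = E (γ (-(1 / 2)))) :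
    Continuous (orbitCurve E γ) := by
  refine LocallyFinite.continuous (f := fun n : ℤ => Icc ((n : ℝ) - 1 / 2) (n + 1 / 2)) ?_ ?_
    (fun n => isClosed_Icc) fun n => ?_
  · intro t
    refine ⟨Ioo (t - 1) (t + 1), Ioo_mem_nhds (by linarith) (by linarith),
      (finite_Icc (⌊t⌋ - 3) (⌊t⌋ + 3)).subset ?_⟩
    rintro n ⟨s, ⟨h1, h2⟩, h3, h4⟩
    have h5 := Int.floor_le t
    have h6 := Int.lt_floor_add_one t
    constructor
    · have : ((⌊t⌋ - 3 : ℤ) : ℝ) < n := by push_cast; linarith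
      exact_mod_cast this.le
    · have : (n : ℝ) < (⌊t⌋ + 3 : ℤ) := by push_cast; linarith
      exact_mod_cast this.le
  · refine eq_univ_of_forall fun t => mem_iUnion.2 ⟨⌊t + 1 / 2⌋, ?_⟩
    constructor
    · linarith [Int.floor_le (t + 1 / 2)]
    · linarith [Int.lt_floor_add_one (t + 1 / 2)]
  · have : ContinuousOn (fun t => (E ^ n) (γ (t - n))) (Icc ((n : ℝ) - 1 / 2) (n + 1 / 2)) :=
      ((E.continuous_zpow hE hp hEp n).comp (hγc.comp (by fun_prop))).continuousOn
    exact this.congr fun t ht => orbitCurve_eq hγ ht.1 ht.2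

end

theorem Equiv.Perm.apply_eq_of_zpow_apply_eq {X : Type*} {E : Equiv.Perm X} {p : ℕ}
    (hp : p.Prime) (hEp : E ^ p = 1) {j : ℤ} (hj : ¬ (p : ℤ) ∣ j) {y : X}
    (h : (E ^ j) y = y) : E y = y := by
  have hc : IsCoprime (p : ℤ) j := (Nat.prime_iff_prime_int.1 hp).coprime_iff_not_dvd.2 hj
  obtain ⟨a, b, hab⟩ := hc
  have h1 : E = (E ^ j) ^ b := by
    conv_lhs => rw [← zpow_one E, ← hab, zpow_add, mul_comm a, zpow_mul, zpow_natCast, hEp, one_zpow,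
      one_mul, mul_comm, zpow_mul]
  rw [h1]
  exact Function.IsFixedPt.perm_zpow h b

theorem exists_free_disc {E : Equiv.Perm ℂ} (hE : Continuous E) {p : ℕ} (hp : p.Prime)
    (hEp : E ^ p = 1) {x : ℂ} (hx : ∀ y, ‖y - x‖ ≤ ‖E x - x‖ → E y ≠ y) :
    ∃ (k : ℕ) (y : ℂ) (r : ℝ), ¬ p ∣ k ∧ 0 < r ∧ ‖y - x‖ = r ∧ ‖(E ^ k) y - x‖ = r ∧ E y ≠ y ∧
      ∀ j : ℤ, ¬ (p : ℤ) ∣ j → ∀ z, ‖z - x‖ < r → r ≤ ‖(((E ^ k) ^ j) z) - x‖ := by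
  have hc : ∀ n : ℤ, Continuous ⇑(E ^ n) := E.continuous_zpow hE hp.pos hEp
  have hmin : ∀ k : ℕ, ∃ y, ∀ z, max ‖y - x‖ ‖(E ^ k) y - x‖ ≤ max ‖z - x‖ ‖(E ^ k) z - x‖ := by
    intro k
    have := hc k
    rw [zpow_natCast] at this
    refine Continuous.exists_forall_le (f := fun z => max ‖z - x‖ ‖(E ^ k) z - x‖) (by fun_prop) ?_
    refine tendsto_atTop_mono (fun z => le_max_left _ _) ?_
    have : Tendsto (fun z : ℂ => ‖z‖ + -‖x‖) (cocompact ℂ) atTop :=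
      tendsto_atTop_add_const_right _ _ (tendsto_norm_cocompact_atTop)
    exact tendsto_atTop_mono (fun z => by linarith [norm_sub_norm_le z x]) this
  choose y hy using hmin
  obtain ⟨k, hk, hkmin⟩ := Finset.exists_min_image (Finset.Ico 1 p)
    (fun k => max ‖y k - x‖ ‖(E ^ k) (y k) - x‖) ⟨1, by simp [hp.one_lt]⟩
  rw [Finset.mem_Ico] at hk
  have hpk : ¬ p ∣ k := Nat.not_dvd_of_pos_of_lt hk.1 hk.2
  set r := max ‖y k - x‖ ‖(E ^ k) (y k) - x‖ with hr
  have hrle : ∀ j : ℤ, ¬ (p : ℤ) ∣ j → ∀ z, r ≤ max ‖z - x‖ ‖(E ^ j) z - x‖ := by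
    intro j hj z
    have h0 := Int.emod_nonneg j (b := (p : ℤ)) (by have := hp.pos; omega)
    have h1 : j % p ≠ 0 := fun h => hj (Int.dvd_of_emod_eq_zero h)
    have h2 := Int.emod_lt_of_pos j (b := (p : ℤ)) (by have := hp.pos; omega)
    have := (hkmin (j % p).toNat (by rw [Finset.mem_Ico]; omega)).trans (hy _ z)
    rwa [← zpow_natCast, Int.toNat_of_nonneg h0, ← zpow_eq_zpow_emod' j hEp] at this
  have hp1 : ¬ (p : ℤ) ∣ 1 := by
    have := hp.one_lt
    intro h
    have := Int.le_of_dvd one_pos h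
    omega
  have hrx : r ≤ ‖E x - x‖ := by
    have := hrle 1 hp1 x
    simpa using this
  have hfree : ∀ j : ℤ, ¬ (p : ℤ) ∣ j → ∀ z, ‖z - x‖ < r → r ≤ ‖(((E ^ k) ^ j) z) - x‖ := by
    intro j hj z hz
    have := hrle (k * j) (fun h => by
      rcases (Nat.prime_iff_prime_int.1 hp).dvd_or_dvd h with h | h
      · exact hpk (by exact_mod_cast h)
      · exact hj h) z
    rw [zpow_mul, zpow_natCast] at this
    rcases le_max_iff.1 this with h | h
    · linarith
    · exact h
  have hEk : ∀ z, (E ^ k) z = z → E z = z := fun z hz =>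
    Equiv.Perm.apply_eq_of_zpow_apply_eq hp hEp (j := k) (by exact_mod_cast hpk)
      (by rwa [zpow_natCast])
  have hr0 : 0 < r := by
    refine lt_of_le_of_ne ((norm_nonneg _).trans (le_max_left _ _)) fun h => ?_
    have h1 : ‖y k - x‖ ≤ 0 := h ▸ le_max_left _ _
    have h2 : ‖(E ^ k) (y k) - x‖ ≤ 0 := h ▸ le_max_right _ _
    have h3 := sub_eq_zero.1 (norm_le_zero_iff.1 h1)
    have h4 := sub_eq_zero.1 (norm_le_zero_iff.1 h2)
    rw [h3] at h4
    exact hx x (by simp) (hEk x h4)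
  have hclos : ∀ (n : ℤ) (z : ℂ), ‖z - x‖ ≤ r → ‖((E ^ n) z) - x‖ < r →
      ∃ w, ‖w - x‖ < r ∧ ‖((E ^ n) w) - x‖ < r := by
    intro n z hz hn
    have h1 : z ∈ closure (Metric.ball x r) := by
      rw [closure_ball _ hr0.ne']
      simpa [dist_eq_norm] using hz
    have h2 : IsOpen ((E ^ n) ⁻¹' Metric.ball x r) := Metric.isOpen_ball.preimage (hc n)
    obtain ⟨w, hw1, hw2⟩ := mem_closure_iff.1 h1 _ h2 (by simpa [dist_eq_norm] using hn)
    exact ⟨w, by simpa [dist_eq_norm] using hw2, by simpa [dist_eq_norm] using hw1⟩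
  have hp1' : ¬ (p : ℤ) ∣ -1 := by rwa [dvd_neg]
  refine ⟨k, y k, r, hpk, hr0, ?_, ?_, fun h => ?_, hfree⟩
  · refine (le_max_left _ _).antisymm (le_of_not_gt fun h => ?_)
    obtain ⟨w, h1, h2⟩ := hclos (-k) ((E ^ k) (y k)) (le_max_right _ _)
      (by rwa [zpow_neg, zpow_natCast, Equiv.Perm.inv_def, Equiv.symm_apply_apply])
    have := hfree (-1) hp1' w h1
    rw [zpow_neg_one, ← zpow_natCast, ← zpow_neg] at this
    linarith
  · refine (le_max_right _ _).antisymm (le_of_not_gt fun h => ?_)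
    obtain ⟨w, h1, h2⟩ := hclos k (y k) (le_max_left _ _) (by rwa [zpow_natCast])
    have := hfree 1 hp1 w h1
    rw [zpow_one, ← zpow_natCast] at this
    linarith
  · exact hx (y k) ((le_max_left _ _).trans hrx) h

/-- A periodic map of prime period, without fixed points near `x`, has a power `G` with an invariant
simple closed curve which is a broken segment near `x` and stays in the orbit of a disc. -/
theorem exists_invariant_curve {E : Equiv.Perm ℂ} (hE : Continuous E) {p : ℕ} (hp : p.Prime)
    (hEp : E ^ p = 1) {x : ℂ} (hx : ∀ y, ‖y - x‖ ≤ ‖E x - x‖ → E y ≠ y) :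
    ∃ (k : ℕ) (C : ℝ → ℂ) (v₁ v₂ : ℂ) (T : Set ℂ), ¬ p ∣ k ∧ Continuous C ∧
      (∀ r, C (r + p) = C r) ∧ (∀ r r' : ℝ, r < r' → r' < r + p → C r' ≠ C r) ∧
      (∀ r, C (r + 1) = (E ^ k) (C r)) ∧ ‖v₁‖ = ‖v₂‖ ∧ v₁ ≠ v₂ ∧
      (∀ u ∈ Icc (0 : ℝ) (1 / 2), C u = x + 2 * u * v₂) ∧
      (∀ u ∈ Icc (0 : ℝ) (1 / 2), C (-u) = x + 2 * u * v₁) ∧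
      (∀ σ ∈ Icc (1 / 2) ((p : ℝ) - 1 / 2), ‖v₁‖ ≤ ‖C σ - x‖) ∧ 0 < ‖v₁‖ ∧ T.Countable ∧
      T ⊆ range C ∧ x ∉ T ∧ ∀ r, C r ∉ T → ∃ i : ℕ, ‖((E ^ k) ^ i) (C r) - x‖ < ‖v₁‖ := by
  obtain ⟨k, y, r, hpk, hr, hy, hGy, hEy, hfree⟩ := exists_free_disc hE hp hEp hx
  have hG : Continuous ⇑(E ^ k) := by
    simpa using E.continuous_zpow hE hp.pos hEp k
  have hGp : (E ^ k) ^ p = 1 := by rw [← pow_mul, mul_comm, pow_mul, hEp, one_pow]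
  set G := E ^ k with hGdef
  have hc := G.continuous_zpow hG hp.pos hGp
  have hyG : ∀ j : ℤ, (G ^ j) y = y → (p : ℤ) ∣ j := by
    intro j h
    by_contra hj
    refine hEy (Equiv.Perm.apply_eq_of_zpow_apply_eq hp hEp (j := k * j) (fun h' => ?_)
      (by rwa [zpow_mul, zpow_natCast]))
    rcases (Nat.prime_iff_prime_int.1 hp).dvd_or_dvd h' with h | h
    · exact hpk (by exact_mod_cast h)
    · exact hj h
  have hv1 : ‖y - x‖ = ‖G y - x‖ := hy.trans hGy.symm
  have hne : y - x ≠ G y - x := by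
    intro h
    have := hyG 1 (by simpa using (sub_left_injective h).symm)
    have h1 := Int.le_of_dvd one_pos this
    have := hp.one_lt
    omega
  have hGj : ∀ j : ℤ, (p : ℤ) ∣ j → G ^ j = 1 := by
    rintro _ ⟨m, rfl⟩
    rw [zpow_mul, zpow_natCast, hGp, one_zpow]
  -- images of the closed disc meet the open disc only for trivial powers
  have hD : ∀ (j : ℤ) (b : ℂ), ‖b - x‖ ≤ r → ‖(G ^ j) b - x‖ < r → (p : ℤ) ∣ j := by
    intro j b hb hjb
    by_contra hj
    have h1 : b ∈ closure (Metric.ball x r) := by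
      rw [closure_ball _ hr.ne']
      simpa [dist_eq_norm] using hb
    obtain ⟨w, hw1, hw2⟩ := mem_closure_iff.1 h1 _ (Metric.isOpen_ball.preimage (hc j))
      (by simpa [dist_eq_norm] using hjb)
    have := hfree j hj w (by simpa [dist_eq_norm] using hw2)
    rw [mem_preimage, Metric.mem_ball, dist_eq_norm] at hw1
    linarith
  set γ := cornerPath x (y - x) (G y - x) with hγ
  have hγn : ∀ t, ‖γ t - x‖ = 2 * |t| * r := fun t => by rw [hγ, norm_cornerPath_sub hv1, hy]
  have hγ1 : γ (-(1 / 2)) = y := by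
    rw [hγ, cornerPath_of_nonpos (by norm_num)]
    push_cast
    ring
  have hγ2 : γ (1 / 2) = G (γ (-(1 / 2))) := by
    rw [hγ1, hγ, cornerPath_of_nonneg (by norm_num)]
    push_cast
    ring
  have hγle : ∀ t : ℝ, -(1 / 2) ≤ t → t ≤ 1 / 2 → ‖γ t - x‖ ≤ r := fun t h1 h2 => by
    rw [hγn]
    have : |t| ≤ 1 / 2 := abs_le.2 ⟨by linarith, h2⟩
    nlinarith
  have hγlt : ∀ t : ℝ, -(1 / 2) < t → t < 1 / 2 → ‖γ t - x‖ < r := fun t h1 h2 => by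
    rw [hγn]
    have : |t| < 1 / 2 := abs_lt.2 ⟨by linarith, h2⟩
    nlinarith
  have hfl : ∀ t : ℝ, -(1 / 2) ≤ t - ⌊t + 1 / 2⌋ ∧ t - ⌊t + 1 / 2⌋ < 1 / 2 := fun t => by
    constructor
    · linarith [Int.floor_le (t + 1 / 2)]
    · linarith [Int.lt_floor_add_one (t + 1 / 2)]
  have hC0 : ∀ u : ℝ, -(1 / 2) ≤ u → u ≤ 1 / 2 → orbitCurve G γ u = γ u := fun u h1 h2 => by
    rw [orbitCurve_eq hγ2 (n := 0) (by push_cast; linarith) (by push_cast; linarith)]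
    simp
  refine ⟨k, orbitCurve G γ, y - x, G y - x, range fun n : ℤ => (G ^ n) y, hpk,
    continuous_orbitCurve hG hp.pos hGp continuous_cornerPath hγ2, fun t => ?_, ?_,
    orbitCurve_add_one, hv1, hne, ?_, ?_, ?_, by rwa [hy], countable_range _, ?_, ?_, ?_⟩
  · rw [orbitCurve_add_nat, hGp, Equiv.Perm.one_apply]
  · intro t t' h1 h2 heq
    have f1 := hfl t
    have f2 := hfl t'
    unfold orbitCurve at heq
    set n := ⌊t + 1 / 2⌋
    set n' := ⌊t' + 1 / 2⌋
    have e1 : (G ^ (n' - n)) (γ (t' - n')) = γ (t - n) := by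
      rw [sub_eq_neg_add, zpow_add, Equiv.Perm.mul_apply, heq, zpow_neg,
        Equiv.Perm.inv_def, Equiv.symm_apply_apply]
    have e2 : (p : ℤ) ∣ n' - n := by
      rcases f1.1.eq_or_lt with h | h
      · rcases f2.1.eq_or_lt with h' | h'
        · rw [← h, ← h', hγ1] at e1
          exact hyG _ e1
        · rw [← neg_sub, dvd_neg]
          refine hD (n - n') (γ (t - n)) (hγle _ f1.1 f1.2.le) ?_
          rw [← e1, ← Equiv.Perm.mul_apply, ← zpow_add, sub_add_sub_cancel, sub_self, zpow_zero,
            Equiv.Perm.one_apply]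
          exact hγlt _ h' f2.2
      · exact hD _ (γ (t' - n')) (hγle _ f2.1 f2.2.le) (e1 ▸ hγlt _ h f1.2)
    rw [hGj _ e2, Equiv.Perm.one_apply] at e1
    have e3 := cornerPath_injective hv1 hne e1
    have e4 : t' - t = ((n' - n : ℤ) : ℝ) := by push_cast; linarith
    have e5 : 0 < n' - n := by exact_mod_cast (e4 ▸ sub_pos.2 h1 : (0 : ℝ) < ((n' - n : ℤ) : ℝ))
    have e6 : ((n' - n : ℤ) : ℝ) < (p : ℤ) := by rw [← e4]; push_cast; linarith
    have e7 : n' - n < p := by exact_mod_cast e6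
    have := Int.le_of_dvd e5 e2
    omega
  · intro u hu
    rw [hC0 u (by linarith [hu.1]) hu.2, hγ, cornerPath_of_nonneg hu.1]
  · intro u hu
    rw [hC0 (-u) (by linarith [hu.2]) (by linarith [hu.1]), hγ,
      cornerPath_of_nonpos (by linarith [hu.1])]
    push_cast
    ring
  · intro σ hσ
    rw [hy]
    by_contra! hlt
    have f := hfl σ
    have hn1 : 1 ≤ ⌊σ + 1 / 2⌋ := Int.le_floor.2 (by push_cast; linarith [hσ.1])
    have hnp : ⌊σ + 1 / 2⌋ ≤ p := by
      have h1 : ((⌊σ + 1 / 2⌋ : ℤ) : ℝ) ≤ (p : ℤ) := by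
        push_cast
        linarith [hσ.2, Int.floor_le (σ + 1 / 2)]
      exact_mod_cast h1
    have h2 := Int.le_of_dvd (by omega) (hD _ _ (hγle _ f.1 f.2.le) hlt)
    have h3 : ⌊σ + 1 / 2⌋ = p := by omega
    have h4 : (⌊σ + 1 / 2⌋ : ℝ) = p := by exact_mod_cast h3
    have h5 : σ - ⌊σ + 1 / 2⌋ = -(1 / 2) := by
      rw [h4] at f ⊢
      linarith [f.1, hσ.2]
    rw [orbitCurve, h5, h3, hγ1, zpow_natCast, hGp, Equiv.Perm.one_apply, hy] at hlt
    exact lt_irrefl _ hlt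
  · rintro _ ⟨n, rfl⟩
    refine ⟨n - 1 / 2, ?_⟩
    rw [orbitCurve_eq hγ2 (n := n) le_rfl (by linarith), show (n - 1 / 2 - n : ℝ) = -(1 / 2) by ring,
      hγ1]
  · rintro ⟨n, hn⟩
    simp only at hn
    have h1 := hD n y hy.le (by rw [hn]; simpa)
    rw [hGj n h1, Equiv.Perm.one_apply] at hn
    rw [hn] at hy
    simp at hy
    exact hr.ne hy
  · intro t ht
    have f := hfl t
    rw [hy]
    have h1 : -(1 / 2) < t - ⌊t + 1 / 2⌋ := f.1.lt_of_ne fun h => by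
      refine ht ⟨⌊t + 1 / 2⌋, ?_⟩
      simp only
      rw [orbitCurve, ← h, hγ1]
    have h0 := Int.emod_nonneg (-⌊t + 1 / 2⌋) (b := (p : ℤ)) (by have := hp.pos; omega)
    refine ⟨((-⌊t + 1 / 2⌋) % p).toNat, ?_⟩
    rw [← zpow_natCast, Int.toNat_of_nonneg h0, ← zpow_eq_zpow_emod' _ hGp, orbitCurve, zpow_neg,
      Equiv.Perm.inv_def, Equiv.symm_apply_apply]
    exact hγlt _ h1 f.2

theorem exists_fixed_of_prime_period {E : Equiv.Perm ℂ} (hE : Continuous E) {p : ℕ}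
    (hp : p.Prime) (hEp : E ^ p = 1) : ∃ z, E z = z := by
  by_contra! hno
  obtain ⟨k, C, v₁, v₂, T, hpk, hC, hper, hinj, hGC, -⟩ :=
    exists_invariant_curve hE hp hEp (x := 0) fun y _ => hno y
  have hG : Continuous ⇑(E ^ k) := by
    simpa using E.continuous_zpow hE hp.pos hEp k
  obtain ⟨z, hz⟩ := exists_fixed_of_invariant_curve hG hC (by exact_mod_cast hp.one_lt) hper hinj
    hGC
  exact hno z (Equiv.Perm.apply_eq_of_zpow_apply_eq hp hEp (j := k) (by exact_mod_cast hpk)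
      (by rwa [zpow_natCast]))

theorem exists_fixed_near_of_two_fixed {E : Equiv.Perm ℂ} (hE : Continuous E)
    (ho : PlaneOriented E) {p : ℕ} (hp : p.Prime) (hEp : E ^ p = 1) {a b : ℂ} (hab : a ≠ b)
    (ha : E a = a) (hb : E b = b) (x : ℂ) : ∃ y, ‖y - x‖ ≤ ‖E x - x‖ ∧ E y = y := by
  by_contra! hno
  obtain ⟨k, C, v₁, v₂, T, hpk, hC, hper, hinj, hGC, hv, hne, hC₂, hC₁, hout, hpos, hT, hTC, hxT,
    hcov⟩ := exists_invariant_curve hE hp hEp hno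
  have hG : Continuous ⇑(E ^ k) := by
    simpa using E.continuous_zpow hE hp.pos hEp k
  have hGo : PlaneOriented ⇑(E ^ k) := by
    rw [← Equiv.Perm.iterate_eq_pow]
    exact ho.iterate hE k
  have hGp : (⇑(E ^ k))^[p] = id := by
    rw [Equiv.Perm.iterate_eq_pow, ← pow_mul, mul_comm, pow_mul, hEp, one_pow]
    rfl
  have hfix : ∀ z, E z = z → (E ^ k) z = z := fun z hz => by
    rw [← Equiv.Perm.iterate_eq_pow]
    exact Function.iterate_fixed hz k
  obtain ⟨L, hL, hL', hs⟩ := hGo.exists_normalized_log hG hGp hab (hfix a ha) (hfix b hb)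
  obtain ⟨l, W, hl, hl', hW, hlW⟩ := exists_chord_log hC (by exact_mod_cast hp.pos) hper hinj
  have hdvd := dvd_rotation hL hL' hp.pos hs hC hinj hGC hl hl' hlW
  obtain ⟨c, hc, ω, hω, hω', hωp⟩ := exists_zeroWinding hC hp.pos hper hG hGo hGC
    (B := Metric.ball x ‖v₁‖) Metric.isOpen_ball hT hTC (fun r hr => by
      obtain ⟨i, hi⟩ := hcov r hr
      refine ⟨i, ?_⟩
      rwa [Equiv.Perm.iterate_eq_pow, Metric.mem_ball, dist_eq_norm]) (by simpa using hpos) hxT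
  have := rotation_eq_of_corner hC (by exact_mod_cast hp.one_le) hper hv hne hC₂ hC₁ hout
    (d := c - x) (by simpa [dist_eq_norm] using hc) hω (by simpa using hω') hωp hl hl' hW hlW
  have h1 := Int.le_of_dvd (by omega) ((dvd_abs _ _).2 hdvd)
  have := hp.one_lt
  omega

theorem planeOriented_id_add {u : ℂ → ℂ} {c : NNReal} (hc : c < 1) (hu : LipschitzWith c u) :
    PlaneOriented fun z => z + u z := by
  have hm : ∀ x y : ℂ, x ≠ y → 1 - (-((u x - u y) / (x - y))) ∈ slitPlane := fun x y hxy => by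
    refine one_sub_mem_slitPlane_of_norm_lt ?_
    have h0 : 0 < ‖x - y‖ := norm_pos_iff.2 (sub_ne_zero.2 hxy)
    rw [norm_neg, norm_div, div_lt_one h0]
    have := hu.dist_le_mul x y
    rw [dist_eq_norm, dist_eq_norm] at this
    have hc' : (c : ℝ) < 1 := by exact_mod_cast hc
    nlinarith
  refine ⟨fun q => log (1 - (-((u q.1 - u q.2) / (q.1 - q.2)))), ?_, fun x y hxy => ?_⟩
  · refine ContinuousOn.clog ?_ fun q hq => hm _ _ hq
    have := hu.continuous
    exact continuousOn_const.sub (ContinuousOn.neg (ContinuousOn.div (by fun_prop) (by fun_prop)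
      fun q hq => sub_ne_zero.2 hq))
  · have := sub_ne_zero.2 hxy
    rw [exp_log (slitPlane_ne_zero (hm x y hxy))]
    field_simp
    ring

theorem exists_planeOriented_push (a : ℂ) {ε : ℝ} {v : ℂ} (hv : ‖v‖ < ε) :
    ∃ τ : ℂ ≃ₜ ℂ, PlaneOriented τ ∧ τ a = a + v ∧ ∀ z, ε ≤ ‖z - a‖ → τ z = z := by
  have hε : 0 < ε := (norm_nonneg v).trans_lt hv
  let c : NNReal := ⟨‖v‖ / ε, by positivity⟩
  have hc : c < 1 := by
    rw [← NNReal.coe_lt_coe]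
    exact (div_lt_one hε).2 hv
  let u : ℂ → ℂ := fun z => (max 0 (1 - ‖z - a‖ / ε) : ℝ) * v
  have hu : LipschitzWith c u := by
    refine LipschitzWith.of_dist_le_mul fun z w => ?_
    rw [dist_eq_norm, dist_eq_norm, ← sub_mul, ← ofReal_sub, norm_mul, norm_real, Real.norm_eq_abs]
    have h1 : |max 0 (1 - ‖z - a‖ / ε) - max 0 (1 - ‖w - a‖ / ε)| ≤ ‖z - w‖ / ε := by
      refine (abs_max_sub_max_le_max 0 _ 0 _).trans ?_
      rw [sub_self, abs_zero, max_eq_right (abs_nonneg _)]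
      rw [show 1 - ‖z - a‖ / ε - (1 - ‖w - a‖ / ε) = (‖w - a‖ - ‖z - a‖) / ε by ring, abs_div,
        abs_of_pos hε]
      gcongr
      have := abs_norm_sub_norm_le (w - a) (z - a)
      rwa [sub_sub_sub_cancel_right, norm_sub_rev w z] at this
    calc _ ≤ ‖z - w‖ / ε * ‖v‖ := by gcongr
      _ = ‖v‖ / ε * ‖z - w‖ := by ring
  have happ : ApproximatesLinearOn (fun z => z + u z) (ContinuousLinearEquiv.refl ℝ ℂ : ℂ →L[ℝ] ℂ)
      univ c := by
    intro x _ y _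
    have := hu.dist_le_mul x y
    rw [dist_eq_norm, dist_eq_norm] at this
    rwa [show x + u x - (y + u y) - (ContinuousLinearEquiv.refl ℝ ℂ : ℂ →L[ℝ] ℂ) (x - y) =
      u x - u y by simp; ring]
  have hcN : c < ‖((ContinuousLinearEquiv.refl ℝ ℂ).symm : ℂ →L[ℝ] ℂ)‖₊⁻¹ := by
    have : ‖((ContinuousLinearEquiv.refl ℝ ℂ).symm : ℂ →L[ℝ] ℂ)‖₊ = 1 := by
      simp
    rw [this, inv_one]
    exact hc
  let τ := happ.toHomeomorph _ (Or.inr hcN)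
  have hτ : ∀ z, τ z = z + u z := fun z => rfl
  refine ⟨τ, planeOriented_id_add hc hu, ?_, fun z hz => ?_⟩
  · rw [hτ]
    simp [u]
  · rw [hτ]
    have : max 0 (1 - ‖z - a‖ / ε) = 0 := max_eq_left (by
      rw [sub_nonpos, one_le_div hε]
      exact hz)
    simp [u, this]

/-- Any point of a connected open set `V` can be pulled by a homeomorphism fixing `F` pointwise to
a position where a round disc about the image of `x₀` reaching it misses `F`. -/
theorem exists_planeOriented_disc {F V : Set ℂ} (hV : IsOpen V) (hVc : IsPreconnected V)
    (hVF : Disjoint V F) {x₀ y : ℂ} (hx : x₀ ∈ V) (hy : y ∈ V) :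
    ∃ ψ : ℂ ≃ₜ ℂ, PlaneOriented ψ ∧ (∀ z ∈ F, ψ z = z) ∧
      ∀ z, ‖z - ψ x₀‖ ≤ ‖ψ y - ψ x₀‖ → z ∉ F := by
  set P : ℂ → Prop := fun y => ∃ ψ : ℂ ≃ₜ ℂ, PlaneOriented ψ ∧ (∀ z ∈ F, ψ z = z) ∧
      ∀ z, ‖z - ψ x₀‖ ≤ ‖ψ y - ψ x₀‖ → z ∉ F with hP
  have hnear : ∀ δ, Metric.ball x₀ δ ⊆ V → ∀ y ∈ Metric.ball x₀ δ, P y := by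
    intro δ hδ y hy
    refine ⟨Homeomorph.refl ℂ, planeOriented_id, fun z _ => rfl, fun z hz => ?_⟩
    refine hVF.notMem_of_mem_left (hδ ?_)
    rw [Metric.mem_ball, dist_eq_norm] at hy ⊢
    exact lt_of_le_of_lt hz hy
  have hstep : ∀ (c : ℂ) (δ : ℝ), Metric.ball c δ ⊆ V → x₀ ∉ Metric.ball c δ →
      ∀ y ∈ Metric.ball c (δ / 3), ∀ y' ∈ Metric.ball c (δ / 3), P y → P y' := by
    rintro c δ hδ hx₀ y hy y' hy' ⟨ψ, h1, h2, h3⟩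
    have hyy : ‖y - y'‖ < δ * (2 / 3) := by
      have := dist_triangle_right y y' c
      rw [Metric.mem_ball] at hy hy'
      rw [← dist_eq_norm]
      linarith
    have hfar : ∀ z, z ∉ Metric.ball c δ → δ * (2 / 3) ≤ ‖z - y'‖ := fun z hz => by
      have := dist_triangle z y' c
      rw [Metric.mem_ball] at hz hy'
      rw [← dist_eq_norm]
      linarith
    obtain ⟨τ, t1, t2, t3⟩ := exists_planeOriented_push y' hyy
    refine ⟨τ.trans ψ, h1.comp t1 τ.continuous, fun z hz => ?_, fun z hz => ?_⟩
    · rw [Homeomorph.trans_apply, t3 z (hfar z fun h => hVF.notMem_of_mem_left (hδ h) hz), h2 z hz]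
    · rw [Homeomorph.trans_apply, Homeomorph.trans_apply, t2, t3 _ (hfar _ hx₀),
        add_sub_cancel] at hz
      exact h3 z hz
  have key := hVc.induction₂ (fun y y' => P y ↔ P y') (fun c hc => ?_)
    (fun _ _ _ _ _ _ h h' => h.trans h') (fun _ _ _ _ h => h.symm) hx hy
  · obtain ⟨δ, hδ, h⟩ := Metric.isOpen_iff.1 hV x₀ hx
    exact key.1 (hnear δ h x₀ (Metric.mem_ball_self hδ))
  · obtain ⟨δ, hδ, h⟩ := Metric.isOpen_iff.1 hV c hc
    refine mem_nhdsWithin_of_mem_nhds ?_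
    by_cases hcx : c = x₀
    · subst hcx
      filter_upwards [Metric.ball_mem_nhds c hδ] with y hy
      exact ⟨fun _ => hnear δ h y hy, fun _ => hnear δ h c (Metric.mem_ball_self hδ)⟩
    · have hd : 0 < dist x₀ c := dist_pos.2 (Ne.symm hcx)
      set δ' := min δ (dist x₀ c)
      have hδ' : 0 < δ' := lt_min hδ hd
      have hs := hstep c δ' ((Metric.ball_subset_ball (min_le_left _ _)).trans h)
        (by rw [Metric.mem_ball, not_lt]; exact min_le_right _ _)
      have hcc : c ∈ Metric.ball c (δ' / 3) := Metric.mem_ball_self (by positivity)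
      filter_upwards [Metric.ball_mem_nhds c (show 0 < δ' / 3 by positivity)] with y hy
      exact ⟨hs c hcc y hy, hs y hy c hcc⟩

/-- With two fixed points, a periodic map of prime period moves every nonfixed point to another
component of the complement of the fixed point set. -/
theorem apply_notMem_of_two_fixed {E : Equiv.Perm ℂ} (hE : Continuous E)
    (ho : PlaneOriented E) {p : ℕ} (hp : p.Prime) (hEp : E ^ p = 1) {a b : ℂ} (hab : a ≠ b)
    (ha : E a = a) (hb : E b = b) {V : Set ℂ} (hV : IsOpen V) (hVc : IsPreconnected V)
    (hVF : ∀ z ∈ V, E z ≠ z) {x : ℂ} (hx : x ∈ V) : E x ∉ V := by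
  intro hEx
  obtain ⟨ψ, h1, h2, h3⟩ := exists_planeOriented_disc (F := {z | E z = z}) hV hVc
    (disjoint_left.2 hVF) hx hEx
  have h2s : ∀ z, E z = z → ψ.symm z = z := fun z hz => by
    rw [Homeomorph.symm_apply_eq, h2 z hz]
  have hcoe : ⇑(ψ.toEquiv.permCongr E) = ψ ∘ E ∘ ψ.symm := rfl
  have hsc : ψ.symm ∘ ψ = id := by ext z; simp
  obtain ⟨y, hy, hy'⟩ := exists_fixed_near_of_two_fixed (E := ψ.toEquiv.permCongr E)
    (by rw [hcoe]; fun_prop)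
    (by
      rw [hcoe]
      exact h1.comp (ho.comp h1.symm ψ.symm.continuous) (by fun_prop)) hp
    (by
      have : ψ.toEquiv.permCongr E ^ p = ψ.toEquiv.permCongrHom E ^ p := rfl
      rw [this, ← map_pow, hEp, map_one]) hab
    (by rw [hcoe]; simp [h2s a ha, ha, h2 a ha]) (by rw [hcoe]; simp [h2s b hb, hb, h2 b hb])
    (ψ x)
  rw [hcoe] at hy hy'
  simp only [Function.comp_apply, Homeomorph.symm_apply_apply] at hy hy'
  have h4 : E (ψ.symm y) = ψ.symm y := by
    rw [← ψ.symm_apply_apply (E _), hy']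
  have h5 := h2 _ h4
  rw [ψ.apply_symm_apply] at h5
  exact h3 y hy (show E y = y by rw [h5]; exact h4)

/-- A continuous injection of the plane which is the identity somewhere has degree one. -/
theorem planeOriented_of_eqOn_id {h : ℂ → ℂ} (hc : Continuous h) (hi : Function.Injective h)
    {W : Set ℂ} (hW : IsOpen W) (hne : W.Nonempty) (hid : ∀ z ∈ W, h z = z) :
    PlaneOriented h := by
  obtain ⟨N, hN, hN'⟩ := exists_continuous_log (E := ℂ × ℂ)
    (g := fun q => h (q.1 + exp q.2) - h q.1) (by fun_prop)
    fun q => sub_ne_zero.2 fun hq => exp_ne_zero q.2 (by simpa using hi hq)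
  obtain ⟨d, hd⟩ := exists_int_log_eq isPreconnected_univ
    (l₁ := fun q : ℂ × ℂ => N (q.1, q.2 + 2 * Real.pi * I)) (l₂ := N) (by fun_prop)
    hN.continuousOn fun q _ => by rw [hN', hN', exp_periodic]
  have hd1 : d = 1 := by
    obtain ⟨y, hy⟩ := hne
    obtain ⟨ρ, hρ, hball⟩ := Metric.isOpen_iff.1 hW y hy
    set s : Set ℂ := {w | w.re < Real.log ρ} with hs
    have hsc : Convex ℝ s := convex_halfSpace_re_lt _
    have hexp : ∀ w ∈ s, exp (N (y, w)) = exp w := fun w hw => by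
      have hw' : y + exp w ∈ W := hball (by
        rw [Metric.mem_ball, dist_eq_norm, add_sub_cancel_left, norm_exp]
        exact (Real.lt_log_iff_exp_lt hρ).1 hw)
      rw [hN']
      simp only
      rw [hid _ hw', hid y hy, add_sub_cancel_left]
    obtain ⟨m, hm⟩ := exists_int_log_eq hsc.isPreconnected (l₁ := fun w => N (y, w))
      (l₂ := fun w => w) (by fun_prop) continuousOn_id hexp
    set w : ℂ := ((Real.log ρ - 1 : ℝ) : ℂ)
    have h1 := hm w (by simp only [hs, mem_ofPred_eq, w, ofReal_re]; linarith)
    have h2 := hm (w + 2 * Real.pi * I) (by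
      simp only [hs, mem_ofPred_eq, w]; simp)
    have h3 := hd (y, w) trivial
    simp only at h1 h2 h3
    have h4 : (d : ℂ) * (2 * Real.pi * I) = 1 * (2 * Real.pi * I) := by
      linear_combination h2 - h1 - h3
    exact_mod_cast mul_right_cancel₀ two_pi_I_ne_zero h4
  subst hd1
  have hper : ∀ (y w w' : ℂ), exp w = exp w' → N (y, w) - w = N (y, w') - w' := by
    intro y w w' hww
    obtain ⟨n, rfl⟩ := exp_eq_exp_iff_exists_int.1 hww
    have hP : Function.Periodic (fun w => N (y, w) - w) (2 * Real.pi * I) := fun w => by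
      have := hd (y, w) trivial
      simp only at this ⊢
      rw [this]
      push_cast
      ring
    exact (hP.int_mul n) w'
  refine ⟨fun q => N (q.2, log (q.1 - q.2)) - log (q.1 - q.2), ?_, fun x y hxy => ?_⟩
  · refine continuousOn_of_forall_continuousAt fun q hq => ?_
    have hq0 : q.1 - q.2 ≠ 0 := sub_ne_zero.2 hq
    by_cases hsl : q.1 - q.2 ∈ slitPlane
    · have hl : ContinuousAt (fun q : ℂ × ℂ => log (q.1 - q.2)) q :=
        ContinuousAt.clog (by fun_prop) hsl
      exact (hN.continuousAt.comp (continuousAt_snd.prodMk hl)).sub hl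
    · have hsl' : -(q.1 - q.2) ∈ slitPlane := by
        rw [mem_slitPlane_iff, not_or] at hsl
        rw [mem_slitPlane_iff, neg_re]
        left
        have h1 : (q.1 - q.2).im = 0 := not_not.1 hsl.2
        have h2 : (q.1 - q.2).re ≠ 0 := fun h => hq0 (Complex.ext h h1)
        have := lt_of_le_of_ne (not_lt.1 hsl.1) h2
        linarith
      have hl : ContinuousAt (fun q : ℂ × ℂ => log (-(q.1 - q.2)) + Real.pi * I) q := by
        have hl0 : ContinuousAt (fun q : ℂ × ℂ => log (-(q.1 - q.2))) q :=
          ContinuousAt.clog (by fun_prop) hsl'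
        exact hl0.add continuousAt_const
      refine ((hN.continuousAt.comp (continuousAt_snd.prodMk hl)).sub hl).congr ?_
      have : {q : ℂ × ℂ | q.1 ≠ q.2} ∈ 𝓝 q :=
        (isOpen_ne_fun continuous_fst continuous_snd).mem_nhds hq
      filter_upwards [this] with q' hq'
      refine hper _ _ _ ?_
      have h0 := sub_ne_zero.2 hq'
      rw [exp_add, exp_pi_mul_I, exp_log (neg_ne_zero.2 h0), exp_log h0]
      ring
  · have h0 := sub_ne_zero.2 hxy
    rw [exp_sub, hN', exp_log h0, div_mul_cancel₀ _ h0]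
    simp only
    rw [add_sub_cancel]

theorem isOpen_diff_connectedComponentIn {X : Type*} [TopologicalSpace X]
    [LocallyConnectedSpace X] {U : Set X} (hU : IsOpen U) (x : X) :
    IsOpen (U \ connectedComponentIn U x) := by
  rw [isOpen_iff_mem_nhds]
  rintro z ⟨hz, hzx⟩
  filter_upwards [hU.connectedComponentIn.mem_nhds (mem_connectedComponentIn hz)] with w hw
  refine ⟨connectedComponentIn_subset _ _ hw, fun hwx => hzx ?_⟩
  rw [connectedComponentIn_eq hwx, ← connectedComponentIn_eq hw]
  exact mem_connectedComponentIn hz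

/-- A homeomorphism which swaps an open set with a disjoint one, when the frontier is fixed,
yields an involution swapping the two sets and fixing everything else. -/
theorem continuous_swap_of_disjoint {E : Equiv.Perm ℂ} (hE : Continuous E) (hE' : Continuous E.symm)
    {V : Set ℂ} (hV : IsOpen V) (hVF : IsOpen ({z | E z ≠ z} \ V)) [DecidablePred (· ∈ V)]
    (hdisj : ∀ z ∈ V, E z ∉ V) :
    Continuous fun z => if z ∈ V then E z else if E.symm z ∈ V then E.symm z else z := by
  rw [continuous_iff_continuousAt]
  intro z
  have hEV : IsOpen (E.symm ⁻¹' V) := hV.preimage hE'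
  by_cases h1 : z ∈ V
  · refine hE.continuousAt.congr ?_
    filter_upwards [hV.mem_nhds h1] with w hw
    rw [if_pos hw]
  by_cases h2 : E.symm z ∈ V
  · refine hE'.continuousAt.congr ?_
    filter_upwards [hEV.mem_nhds h2] with w hw
    rw [if_neg fun h => hdisj _ hw (by simpa using h),
      if_pos (show E.symm w ∈ V from hw)]
  by_cases hz : E z = z
  · have hz' : E.symm z = z := by rw [Equiv.symm_apply_eq, hz]
    rw [ContinuousAt, if_neg h1, if_neg h2]
    have t1 : Tendsto E (𝓝 z) (𝓝 z) := by simpa only [hz] using hE.tendsto z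
    have t2 : Tendsto E.symm (𝓝 z) (𝓝 z) := by simpa only [hz'] using hE'.tendsto z
    exact (t1.mono_left inf_le_left).if ((t2.mono_left inf_le_left).if
      (tendsto_id.mono_left inf_le_left) |>.mono_left inf_le_left)
  · have h3 : E.symm ⁻¹' ({z | E z ≠ z} \ V) ∈ 𝓝 z := (hVF.preimage hE').mem_nhds
      ⟨fun h => hz (by simpa using congrArg E h), h2⟩
    refine continuousAt_id.congr ?_
    filter_upwards [hVF.mem_nhds ⟨hz, h1⟩, h3] with w hw hw'
    rw [if_neg hw.2, if_neg hw'.2]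
    rfl

/-- An orientation-preserving periodic map of the plane of prime period has only one fixed
point. -/
theorem fixed_unique_of_prime_period {E : Equiv.Perm ℂ} (hE : Continuous E)
    (ho : PlaneOriented E) {p : ℕ} (hp : p.Prime) (hEp : E ^ p = 1) (hE1 : E ≠ 1) {a b : ℂ}
    (ha : E a = a) (hb : E b = b) : a = b := by
  classical
  by_contra hab
  obtain ⟨x, hx⟩ : ∃ x, E x ≠ x := by
    by_contra! h
    exact hE1 (Equiv.ext h)
  rcases hp.eq_two_or_odd' with rfl | hodd
  · refine hx (ho.involutive_eq_id hE (fun z => ?_) hab ha hb x)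
    rw [← Equiv.Perm.mul_apply, ← sq, hEp, Equiv.Perm.one_apply]
  have hEs : Continuous E.symm := by
    have := E.continuous_zpow hE hp.pos hEp (-1)
    rwa [zpow_neg_one] at this
  have hp2 : ¬ (p : ℤ) ∣ 2 := fun h => by
    have h1 : p ∣ 2 := by exact_mod_cast h
    rw [(Nat.prime_dvd_prime_iff_eq hp Nat.prime_two).1 h1] at hodd
    exact absurd hodd (by decide)
  have hU : IsOpen {z | E z ≠ z} := isOpen_ne_fun hE continuous_id
  set V := connectedComponentIn {z | E z ≠ z} x with hV
  have hVo : IsOpen V := hU.connectedComponentIn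
  have hVF : ∀ z ∈ V, E z ≠ z := fun z hz => connectedComponentIn_subset _ _ hz
  have hxV : x ∈ V := mem_connectedComponentIn hx
  have d1 : ∀ z ∈ V, E z ∉ V := fun z hz => apply_notMem_of_two_fixed hE ho hp hEp hab ha hb hVo
    isPreconnected_connectedComponentIn hVF hz
  have d2 : ∀ z ∈ V, E (E z) ∉ V := fun z hz => by
    have hsq : ⇑(E ^ (2 : ℕ)) = E ∘ E := by rw [sq]; rfl
    have := apply_notMem_of_two_fixed (E := E ^ (2 : ℕ)) (by rw [hsq]; fun_prop)
      (by rw [hsq]; exact ho.comp ho hE) hp (by rw [← pow_mul, mul_comm, pow_mul, hEp, one_pow]) hab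
      (by simp [hsq, ha]) (by simp [hsq, hb]) hVo isPreconnected_connectedComponentIn
      (fun z hz h => hVF z hz (Equiv.Perm.apply_eq_of_zpow_apply_eq hp hEp hp2
        (by rw [zpow_ofNat]; exact h))) hz
    rwa [hsq] at this
  set h : ℂ → ℂ := fun z => if z ∈ V then E z else if E.symm z ∈ V then E.symm z else z with hh
  have hc : Continuous h := continuous_swap_of_disjoint hE hEs hVo
    (isOpen_diff_connectedComponentIn hU x) d1
  have hfix : ∀ z, z ∉ V → E.symm z ∉ V → h z = z := fun z h1 h2 => by
    simp only [hh, if_neg h1, if_neg h2]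
  have hinv : Function.Involutive h := by
    intro z
    by_cases h1 : z ∈ V
    · have e : h z = E z := if_pos h1
      rw [e]
      simp only [hh, if_neg (d1 z h1), Equiv.symm_apply_apply, if_pos h1]
    · by_cases h2 : E.symm z ∈ V
      · have e : h z = E.symm z := by simp only [hh, if_neg h1, if_pos h2]
        rw [e]
        simp only [hh, if_pos h2, Equiv.apply_symm_apply]
      · rw [hfix z h1 h2, hfix z h1 h2]
  have hfixE : ∀ z, E z = z → h z = z := fun z hz => by
    have hzV : z ∉ V := fun h => hVF z h hz
    refine hfix z hzV ?_
    rwa [show E.symm z = z by rw [Equiv.symm_apply_eq, hz]]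
  have hho : PlaneOriented h := planeOriented_of_eqOn_id hc hinv.injective
    (W := (E.symm ∘ E.symm) ⁻¹' V) (hVo.preimage (hEs.comp hEs)) ⟨E (E x), by simpa using hxV⟩
    fun z hz => by
      refine hfix z (fun h' => ?_) (fun h' => ?_)
      · have := d2 _ hz
        simp at this
        exact this h'
      · have := d1 _ hz
        simp at this
        exact this h'
  have := hho.involutive_eq_id hc hinv hab (hfixE a ha) (hfixE b hb) x
  rw [show h x = E x from if_pos hxV] at this
  exact hx this

/-- The horizontal coordinates of a point of the sphere. -/
def TwoSphere.horiz (u : TwoSphere) : ℂ := ⟨u.1 0, u.1 1⟩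

/-- The height of a point of the sphere. -/
def TwoSphere.height (u : TwoSphere) : ℝ := u.1 2

namespace TwoSphere

theorem continuous_horiz : Continuous horiz := by
  have : horiz = fun u => ((u.1 0 : ℝ) : ℂ) + ((u.1 1 : ℝ) : ℂ) * I := by
    ext u
    exact mk_eq_add_mul_I _ _
  rw [this]
  fun_prop

theorem continuous_height : Continuous height := by
  unfold height
  fun_prop

theorem horiz_mul_conj (u : TwoSphere) :
    horiz u * conj (horiz u) = 1 - (height u : ℂ) ^ 2 := by
  have h := u.2
  rw [mem_sphere_zero_iff_norm, EuclideanSpace.norm_eq, Real.sqrt_eq_one, Fin.sum_univ_three] at h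
  simp only [Real.norm_eq_abs, sq_abs] at h
  rw [mul_conj, normSq_apply, horiz, height]
  have h' : u.1 0 * u.1 0 + u.1 1 * u.1 1 = 1 - (u.1 2) ^ 2 := by linarith
  simp only
  rw [h']
  push_cast
  rfl

theorem ext_coords {u v : TwoSphere} (h1 : horiz u = horiz v) (h2 : height u = height v) :
    u = v := by
  have ha := congrArg Complex.re h1
  have hb := congrArg Complex.im h1
  refine Subtype.ext (PiLp.ext fun i => ?_)
  fin_cases i
  · exact ha
  · exact hb
  · exact h2

/-- The point of the sphere with given coordinates. -/
noncomputable def mk (z : ℂ) (t : ℝ) (h : normSq z + t ^ 2 = 1) : TwoSphere :=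
  ⟨!₂[z.re, z.im, t], by
    rw [mem_sphere_zero_iff_norm, EuclideanSpace.norm_eq, Real.sqrt_eq_one, Fin.sum_univ_three]
    rw [normSq_apply] at h
    simp
    linarith⟩

/-- The north pole. -/
noncomputable def north : TwoSphere := mk 0 1 (by simp)

theorem horiz_north : horiz north = 0 := rfl

theorem height_north : height north = 1 := rfl

theorem horiz_neg (u : TwoSphere) : horiz (-u) = -horiz u := by
  apply Complex.ext <;> simp [horiz]

theorem height_neg (u : TwoSphere) : height (-u) = -height u := by
  simp [height]

/-- The point `u` of the sphere is the complex line spanned by `w`. -/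
def Spans (w : ℂ × ℂ) (u : TwoSphere) : Prop :=
  (1 - height u : ℂ) * w.1 = horiz u * w.2 ∧ (1 + height u : ℂ) * w.2 = conj (horiz u) * w.1

theorem normSq_add_pos {w : ℂ × ℂ} (hw : w ≠ 0) : 0 < normSq w.1 + normSq w.2 := by
  by_cases h : w.1 = 0
  · have : w.2 ≠ 0 := fun h' => hw (Prod.ext h h')
    exact add_pos_of_nonneg_of_pos (normSq_nonneg _) (normSq_pos.2 this)
  · exact add_pos_of_pos_of_nonneg (normSq_pos.2 h) (normSq_nonneg _)

theorem Spans.unique {w : ℂ × ℂ} (hw : w ≠ 0) {u v : TwoSphere} (hu : Spans w u)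
    (hv : Spans w v) : u = v := by
  have hS : (w.1 * conj w.1 + w.2 * conj w.2 : ℂ) ≠ 0 := by
    rw [mul_conj, mul_conj]
    exact_mod_cast (normSq_add_pos hw).ne'
  have key : ∀ u, Spans w u →
      horiz u * (w.1 * conj w.1 + w.2 * conj w.2) = 2 * w.1 * conj w.2 ∧
      height u * (w.1 * conj w.1 + w.2 * conj w.2) = w.1 * conj w.1 - w.2 * conj w.2 := by
    rintro u ⟨h1, h2⟩
    have h3 := congrArg conj h2
    simp only [map_mul, map_add, map_one, conj_ofReal, conj_conj] at h3
    constructor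
    · linear_combination -w.1 * h3 - conj w.2 * h1
    · linear_combination w.2 * h3 - conj w.1 * h1
  obtain ⟨a1, a2⟩ := key u hu
  obtain ⟨b1, b2⟩ := key v hv
  refine ext_coords (mul_right_cancel₀ hS (a1.trans b1.symm)) ?_
  have := mul_right_cancel₀ hS (a2.trans b2.symm)
  exact_mod_cast this

theorem Spans.parallel {w w' : ℂ × ℂ} {u : TwoSphere} (h : Spans w u) (h' : Spans w' u) :
    w.1 * w'.2 = w.2 * w'.1 := by
  obtain ⟨h1, h2⟩ := h
  obtain ⟨h3, h4⟩ := h'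
  have e1 : (1 - height u : ℂ) * (w.1 * w'.2) = (1 - height u : ℂ) * (w.2 * w'.1) := by
    linear_combination w'.2 * h1 - w.2 * h3
  have e2 : (1 + height u : ℂ) * (w.1 * w'.2) = (1 + height u : ℂ) * (w.2 * w'.1) := by
    linear_combination w.1 * h4 - w'.1 * h2
  linear_combination (e1 + e2) / 2

theorem Spans.smul {w : ℂ × ℂ} {u : TwoSphere} (h : Spans w u) (c : ℂ) : Spans (c • w) u := by
  obtain ⟨h1, h2⟩ := h
  constructor
  · simp only [Prod.smul_fst, Prod.smul_snd, smul_eq_mul]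
    linear_combination c * h1
  · simp only [Prod.smul_fst, Prod.smul_snd, smul_eq_mul]
    linear_combination c * h2

theorem exists_smul_of_parallel {w w' : ℂ × ℂ} (hw' : w' ≠ 0) (h : w.1 * w'.2 = w.2 * w'.1) :
    ∃ c : ℂ, w = c • w' := by
  by_cases h1 : w'.1 = 0
  · have h2 : w'.2 ≠ 0 := fun h' => hw' (Prod.ext h1 h')
    rw [h1, mul_zero] at h
    refine ⟨w.2 / w'.2, Prod.ext ?_ ?_⟩
    · simp [h1, (mul_eq_zero.1 h).resolve_right h2]
    · simp [h2]
  · refine ⟨w.1 / w'.1, Prod.ext ?_ ?_⟩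
    · simp [h1]
    · simp only [Prod.smul_snd, smul_eq_mul]
      field_simp
      exact h.symm

theorem Spans.of_parallel {w w' : ℂ × ℂ} (hw' : w' ≠ 0) (h : w.1 * w'.2 = w.2 * w'.1)
    {u : TwoSphere} (hu : Spans w' u) : Spans w u := by
  obtain ⟨c, rfl⟩ := exists_smul_of_parallel hw' h
  exact hu.smul c

theorem spans_north {w : ℂ × ℂ} : Spans w north ↔ w.2 = 0 := by
  rw [Spans, horiz_north, height_north]
  simp

open Classical in
/-- The Hopf map, sending a nonzero vector to the complex line it spans. -/
noncomputable def hopf (w : ℂ × ℂ) : TwoSphere :=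
  if hw : w = 0 then north else
    mk (2 * w.1 * conj w.2 / (normSq w.1 + normSq w.2))
      ((normSq w.1 - normSq w.2) / (normSq w.1 + normSq w.2)) (by
        have h := (normSq_add_pos hw).ne'
        rw [← ofReal_add, normSq_div, normSq_mul, normSq_mul, normSq_conj, normSq_ofReal]
        have : normSq 2 = 4 := by rw [normSq_ofNat]; norm_num
        rw [this]
        field_simp
        ring)

theorem horiz_hopf {w : ℂ × ℂ} (hw : w ≠ 0) :
    horiz (hopf w) = 2 * w.1 * conj w.2 / (normSq w.1 + normSq w.2) := by
  rw [hopf, dif_neg hw]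
  rfl

theorem height_hopf {w : ℂ × ℂ} (hw : w ≠ 0) :
    height (hopf w) = (normSq w.1 - normSq w.2) / (normSq w.1 + normSq w.2) := by
  rw [hopf, dif_neg hw]
  rfl

theorem spans_hopf {w : ℂ × ℂ} (hw : w ≠ 0) : Spans w (hopf w) := by
  have hS : (normSq w.1 + normSq w.2 : ℂ) ≠ 0 := by exact_mod_cast (normSq_add_pos hw).ne'
  have hS' : (w.1 * conj w.1 + w.2 * conj w.2 : ℂ) ≠ 0 := by rwa [mul_conj, mul_conj]
  rw [Spans, horiz_hopf hw, height_hopf hw]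
  push_cast
  simp only [map_div₀, map_mul, map_add, conj_ofReal, conj_conj, map_ofNat]
  rw [← mul_conj, ← mul_conj]
  constructor <;> · field_simp; ring

theorem hopf_eq {w : ℂ × ℂ} (hw : w ≠ 0) {u : TwoSphere} (h : Spans w u) : hopf w = u :=
  (spans_hopf hw).unique hw h

theorem continuousOn_hopf : ContinuousOn hopf {0}ᶜ := by
  rw [IsInducing.subtypeVal.continuousOn_iff]
  have h0 : ∀ w ∈ ({0}ᶜ : Set (ℂ × ℂ)), normSq w.1 + normSq w.2 ≠ 0 := fun w hw =>
    (normSq_add_pos hw).ne'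
  have c : Continuous fun w : ℂ × ℂ => normSq w.1 + normSq w.2 :=
    (continuous_normSq.comp continuous_fst).add (continuous_normSq.comp continuous_snd)
  have c' : Continuous fun w : ℂ × ℂ => normSq w.1 - normSq w.2 :=
    (continuous_normSq.comp continuous_fst).sub (continuous_normSq.comp continuous_snd)
  have c1 : ContinuousOn (fun w : ℂ × ℂ => 2 * w.1 * conj w.2 / (normSq w.1 + normSq w.2)) {0}ᶜ := by
    refine ContinuousOn.div (by fun_prop) ?_ fun w hw => by exact_mod_cast h0 w hw
    have := (continuous_ofReal.comp c).continuousOn (s := {0}ᶜ)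
    refine this.congr fun w _ => by simp
  have c2 : ContinuousOn (fun w : ℂ × ℂ => (normSq w.1 - normSq w.2) / (normSq w.1 + normSq w.2))
      {0}ᶜ := c'.continuousOn.div c.continuousOn h0
  have c3 : ContinuousOn (fun w : ℂ × ℂ =>
      ![(2 * w.1 * conj w.2 / (normSq w.1 + normSq w.2)).re,
        (2 * w.1 * conj w.2 / (normSq w.1 + normSq w.2)).im,
        (normSq w.1 - normSq w.2) / (normSq w.1 + normSq w.2)]) {0}ᶜ := by
    refine continuousOn_pi.2 fun i => ?_
    fin_cases i
    · exact continuous_re.comp_continuousOn c1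
    · exact continuous_im.comp_continuousOn c1
    · exact c2
  refine ((PiLp.continuous_toLp 2 fun _ : Fin 3 => ℝ).comp_continuousOn c3).congr fun w hw => ?_
  rw [Function.comp_apply, hopf, dif_neg (show w ≠ 0 from hw)]
  rfl

theorem hopf_smul {w : ℂ × ℂ} (hw : w ≠ 0) {c : ℂ} (hc : c ≠ 0) : hopf (c • w) = hopf w :=
  hopf_eq (smul_ne_zero hc hw) ((spans_hopf hw).smul c)

/-- A self-map of the sphere of lines lifts to a homogeneous map of nonzero vectors. -/
def Lifts (f : TwoSphere → TwoSphere) : Prop :=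
  ∃ F : ℂ × ℂ → ℂ × ℂ, ContinuousOn F {0}ᶜ ∧ ∀ w, w ≠ 0 →
    F w ≠ 0 ∧ Spans (F w) (f (hopf w)) ∧ ∀ c : ℂ, c ≠ 0 → F (c • w) = c • F w

theorem lifts_id : Lifts id :=
  ⟨id, continuousOn_id, fun _ hw => ⟨hw, spans_hopf hw, fun _ _ => rfl⟩⟩

theorem Lifts.comp {f g : TwoSphere → TwoSphere} (hf : Lifts f) (hg : Lifts g) :
    Lifts (f ∘ g) := by
  obtain ⟨F, hF, hF'⟩ := hf
  obtain ⟨G, hG, hG'⟩ := hg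
  refine ⟨F ∘ G, hF.comp hG fun w hw => (hG' w hw).1, fun w hw => ?_⟩
  obtain ⟨h0, h1, h2⟩ := hG' w hw
  obtain ⟨k0, k1, k2⟩ := hF' _ h0
  refine ⟨k0, ?_, fun c hc => ?_⟩
  · rw [hopf_eq h0 h1] at k1
    exact k1
  · rw [Function.comp_apply, h2 c hc, k2 c hc]
    rfl

theorem Lifts.iterate {f : TwoSphere → TwoSphere} (hf : Lifts f) : ∀ n, Lifts f^[n]
  | 0 => lifts_id
  | n + 1 => (hf.iterate n).comp hf

theorem Lifts.of_ne_neg {f g : TwoSphere → TwoSphere} (hf : Lifts f) (hg : Continuous g)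
    (hne : ∀ u, g u ≠ -f u) : Lifts g := by
  obtain ⟨F, hF, hF'⟩ := hf
  have cz := (continuous_horiz.comp hg).comp_continuousOn continuousOn_hopf
  have ct := (continuous_ofReal.comp (continuous_height.comp hg)).comp_continuousOn
    continuousOn_hopf
  have c1 := continuous_fst.comp_continuousOn hF
  have c2 := continuous_snd.comp_continuousOn hF
  refine ⟨fun w => ((1 + height (g (hopf w))) * (F w).1 + horiz (g (hopf w)) * (F w).2,
    conj (horiz (g (hopf w))) * (F w).1 + (1 - height (g (hopf w))) * (F w).2), ?_, ?_⟩
  · exact (((continuousOn_const.add ct).mul c1).add (cz.mul c2)).prodMk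
      (((continuous_conj.comp_continuousOn cz).mul c1).add ((continuousOn_const.sub ct).mul c2))
  · intro w hw
    obtain ⟨h0, h1, h2⟩ := hF' w hw
    have hz := horiz_mul_conj (g (hopf w))
    refine ⟨fun h => ?_, ⟨?_, ?_⟩, fun c hc => ?_⟩
    · have e1 := congrArg Prod.fst h
      have e2 := congrArg Prod.snd h
      simp only [Prod.fst_zero, Prod.snd_zero] at e1 e2
      have : Spans (F w) (-g (hopf w)) := by
        rw [Spans, horiz_neg, height_neg, map_neg]
        push_cast
        constructor
        · linear_combination e1
        · linear_combination e2
      have := this.unique h0 h1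
      exact hne _ (by rw [← this, neg_neg])
    · simp only
      linear_combination (-(F w).1) * hz
    · simp only
      linear_combination (-(F w).2) * hz
    · beta_reduce
      rw [hopf_smul hw hc, h2 c hc]
      refine Prod.ext ?_ ?_ <;> · simp only [Prod.smul_fst, Prod.smul_snd, smul_eq_mul]; ring

theorem dist_neg_self (u : TwoSphere) : dist (-u) u = 2 := by
  have h := mem_sphere_zero_iff_norm.1 u.2
  rw [Subtype.dist_eq, dist_eq_norm, coe_neg_sphere, ← neg_add', norm_neg, ← two_smul ℝ,
    norm_smul, h]
  norm_num

theorem lifts_of_homotopic {f : C(TwoSphere, TwoSphere)}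
    (h : f.Homotopic (ContinuousMap.id TwoSphere)) : Lifts f := by
  obtain ⟨H⟩ := h
  set K := H.toContinuousMap.curry
  have near : ∀ a b, dist (K a) (K b) < 2 → Lifts (K a) → Lifts (K b) := by
    refine fun a b hab ha => ha.of_ne_neg (K b).continuous fun u hu => ?_
    have := ContinuousMap.dist_apply_le_dist (f := K b) (g := K a) u
    rw [hu, dist_neg_self, dist_comm] at this
    exact hab.not_ge this
  have key := isPreconnected_univ.induction₂ (α := unitInterval)
    (fun a b => Lifts (K a) ↔ Lifts (K b)) (fun a _ => ?_) (fun a b c _ _ _ => Iff.trans)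
    (fun a b _ _ => Iff.symm) (mem_univ 0) (mem_univ 1)
  · have e0 : (K 0 : TwoSphere → TwoSphere) = f := funext fun u => H.apply_zero u
    have e1 : (K 1 : TwoSphere → TwoSphere) = id := funext fun u => H.apply_one u
    rw [e0, e1] at key
    exact key.2 lifts_id
  · rw [nhdsWithin_univ]
    filter_upwards [Metric.continuous_iff'.1 K.continuous a 2 two_pos] with b hb
    exact ⟨near a b (by rwa [dist_comm]), near b a hb⟩

theorem Lifts.exists_fixed {f : TwoSphere → TwoSphere} (hf : Lifts f) : ∃ u, f u = u := by
  by_contra! hne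
  obtain ⟨F, hF, hF'⟩ := hf
  set g : ℂ × ℂ → ℂ := fun w => w.1 * (F w).2 - w.2 * (F w).1 with hg
  have gc : ContinuousOn g {0}ᶜ :=
    (continuous_fst.continuousOn.mul (continuous_snd.comp_continuousOn hF)).sub
      (continuous_snd.continuousOn.mul (continuous_fst.comp_continuousOn hF))
  have g0 : ∀ w, w ≠ 0 → g w ≠ 0 := fun w hw h => by
    obtain ⟨h0, h1, -⟩ := hF' w hw
    have := h1.of_parallel h0 (sub_eq_zero.1 h)
    exact hne _ (hopf_eq hw this).symm
  have gs : ∀ w, w ≠ 0 → ∀ c : ℂ, c ≠ 0 → g (c • w) = c ^ 2 * g w := fun w hw c hc => by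
    simp only [hg, (hF' w hw).2.2 c hc, Prod.smul_fst, Prod.smul_snd, smul_eq_mul]
    ring
  have n1 : ∀ x : ℂ, ((x, 1) : ℂ × ℂ) ≠ 0 := fun x h => one_ne_zero (congrArg Prod.snd h)
  have n2 : ∀ x : ℂ, ((1, x) : ℂ × ℂ) ≠ 0 := fun x h => one_ne_zero (congrArg Prod.fst h)
  obtain ⟨A, hA, hA'⟩ := exists_continuous_log (g := fun x : ℂ => g (x, 1))
    (gc.comp_continuous (by fun_prop) n1) fun x => g0 _ (n1 x)
  obtain ⟨B, hB, hB'⟩ := exists_continuous_log (g := fun x : ℂ => g (1, x))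
    (gc.comp_continuous (by fun_prop) n2) fun x => g0 _ (n2 x)
  obtain ⟨n, hn⟩ := exists_int_log_eq (s := (univ : Set ℝ))
    (l₁ := fun θ : ℝ => A (exp (θ * I))) (l₂ := fun θ : ℝ => B (exp (-(θ * I))) + 2 * (θ * I))
    isPreconnected_univ (by fun_prop) (by fun_prop) fun θ _ => by
      rw [exp_add, hA', hB', two_mul, exp_add, ← pow_two, mul_comm (g _), ← gs _ (n2 _) _ (exp_ne_zero _)]
      simp [exp_neg, exp_ne_zero]
  have h0 := hn 0 (mem_univ _)
  have h1 := hn (2 * Real.pi) (mem_univ _)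
  have e1 : exp ((2 * Real.pi : ℝ) * I) = 1 := by push_cast; exact exp_two_pi_mul_I
  simp only [exp_neg, e1, ofReal_zero, zero_mul, exp_zero, inv_one, mul_zero, add_zero] at h0 h1
  rw [h0] at h1
  have : (Real.pi : ℂ) * I = 0 := by
    push_cast at h1
    linear_combination -h1 / 4
  simp [Real.pi_ne_zero] at this

theorem mk_one_ne_zero (x : ℂ) : ((x, 1) : ℂ × ℂ) ≠ 0 := fun h => one_ne_zero (congrArg Prod.snd h)

/-- The inverse stereographic projection from the north pole. -/
noncomputable def chart (x : ℂ) : TwoSphere := hopf (x, 1)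

theorem spans_chart (x : ℂ) : Spans (x, 1) (chart x) := spans_hopf (mk_one_ne_zero x)

theorem chart_injective : Function.Injective chart := fun x y h => by
  have h1 := spans_chart x
  rw [h] at h1
  simpa using h1.parallel (spans_chart y)

theorem chart_ne_north (x : ℂ) : chart x ≠ north := fun h => by
  have h1 := spans_chart x
  rw [h, spans_north] at h1
  exact one_ne_zero h1

theorem exists_chart_eq {u : TwoSphere} (hu : u ≠ north) : ∃ x, chart x = u := by
  have hz := horiz_mul_conj u
  have ht : (1 - height u : ℂ) ≠ 0 := fun h => by
    have h1 : (height u : ℂ) = 1 := (sub_eq_zero.1 h).symm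
    refine hu (ext_coords ?_ ?_)
    · rw [h1, mul_conj, one_pow, sub_self, ofReal_eq_zero, normSq_eq_zero] at hz
      exact hz
    · exact_mod_cast h1
  refine ⟨horiz u / (1 - height u), hopf_eq (mk_one_ne_zero _) ⟨?_, ?_⟩⟩
  · simp only
    field_simp
  · simp only
    field_simp
    linear_combination -hz

theorem Lifts.exists_planeOriented {φ : TwoSphere → TwoSphere} (hφ : Lifts φ)
    (hinj : Function.Injective φ) (hn : φ north = north) :
    ∃ g : ℂ → ℂ, Continuous g ∧ PlaneOriented g ∧ ∀ x, chart (g x) = φ (chart x) := by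
  obtain ⟨F, hF, hF'⟩ := hφ
  have cF : Continuous fun x : ℂ => F (x, 1) := hF.comp_continuous (by fun_prop) mk_one_ne_zero
  have F2 : ∀ x : ℂ, (F (x, 1)).2 ≠ 0 := fun x h => by
    obtain ⟨h0, h1, -⟩ := hF' _ (mk_one_ne_zero x)
    have := h1.unique h0 (spans_north.2 h)
    exact chart_ne_north x (hinj (this.trans hn.symm))
  set g : ℂ → ℂ := fun x => (F (x, 1)).1 / (F (x, 1)).2 with hg
  refine ⟨g, (continuous_fst.comp cF).div (continuous_snd.comp cF) F2, ?_, fun x => ?_⟩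
  · have w0 : ∀ q : ℂ × ℂ, ((1 + q.1 * q.2, q.2) : ℂ × ℂ) ≠ 0 := fun q h => by
      have h1 := congrArg Prod.fst h
      have h2 := congrArg Prod.snd h
      simp only [Prod.fst_zero, Prod.snd_zero] at h1 h2
      simp [h2] at h1
    set D : ℂ × ℂ → ℂ := fun q => (F (q.1, 1)).2 * (F (1 + q.1 * q.2, q.2)).1 -
      (F (q.1, 1)).1 * (F (1 + q.1 * q.2, q.2)).2 with hD
    have cF1 : Continuous fun q : ℂ × ℂ => F (q.1, 1) := cF.comp continuous_fst
    have cF2 : Continuous fun q : ℂ × ℂ => F (1 + q.1 * q.2, q.2) :=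
      hF.comp_continuous (by fun_prop) w0
    have cD : Continuous D := ((continuous_snd.comp cF1).mul (continuous_fst.comp cF2)).sub
      ((continuous_fst.comp cF1).mul (continuous_snd.comp cF2))
    have D0 : ∀ q, D q ≠ 0 := fun q h => by
      obtain ⟨h0, h1, -⟩ := hF' _ (w0 q)
      obtain ⟨k0, k1, -⟩ := hF' _ (mk_one_ne_zero q.1)
      have h2 := h1.of_parallel (w := F (q.1, 1)) h0 (sub_eq_zero.1 h).symm
      have h3 := hinj (h2.unique k0 k1)
      have h4 := spans_hopf (w0 q)
      rw [h3] at h4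
      have := h4.parallel (spans_hopf (mk_one_ne_zero q.1))
      simp only at this
      exact one_ne_zero (α := ℂ) (by linear_combination this)
    obtain ⟨K, hK, hK'⟩ := exists_continuous_log cD D0
    obtain ⟨P, hP, hP'⟩ := exists_continuous_log (continuous_snd.comp cF) F2
    refine ⟨fun q => K (q.2, (q.1 - q.2)⁻¹) - P q.1 - P q.2, ?_, fun x y hxy => ?_⟩
    · refine ((hK.comp_continuousOn (continuous_snd.continuousOn.prodMk
        (ContinuousOn.inv₀ (by fun_prop) fun q hq => sub_ne_zero.2 hq))).sub ?_).sub ?_ <;> fun_prop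
    · have hxy' := sub_ne_zero.2 hxy
      simp only [exp_sub, hK', hP', Function.comp_apply, hD]
      have e : ((1 + y * (x - y)⁻¹, (x - y)⁻¹) : ℂ × ℂ) = (x - y)⁻¹ • (x, 1) := by
        refine Prod.ext ?_ ?_
        · simp only [Prod.smul_fst, smul_eq_mul]
          field_simp
          ring
        · simp
      rw [e, (hF' _ (mk_one_ne_zero x)).2.2 _ (inv_ne_zero hxy')]
      simp only [hg, Prod.smul_fst, Prod.smul_snd, smul_eq_mul]
      have := F2 x
      have := F2 y
      field_simp
  · obtain ⟨-, h1, -⟩ := hF' _ (mk_one_ne_zero x)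
    refine hopf_eq (mk_one_ne_zero _) ?_
    have := h1.smul (F (x, 1)).2⁻¹
    rwa [show ((g x, 1) : ℂ × ℂ) = (F (x, 1)).2⁻¹ • F (x, 1) from ?_]
    refine Prod.ext ?_ ?_
    · simp [hg, div_eq_inv_mul]
    · simp [F2 x]

theorem Lifts.existsUnique_fixed_of_prime_period {φ : TwoSphere → TwoSphere} (hφ : Lifts φ)
    (hn : φ north = north) {p : ℕ} (hp : p.Prime) (hφp : φ^[p] = id) (hφ1 : φ ≠ id) :
    ∃ b, b ≠ north ∧ φ b = b ∧ ∀ c, c ≠ north → φ c = c → c = b := by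
  have hp' : p - 1 + 1 = p := Nat.sub_add_cancel hp.one_le
  have hinj : Function.Injective φ := by
    refine Function.LeftInverse.injective (g := φ^[p - 1]) fun x => ?_
    rw [← Function.iterate_succ_apply, Nat.succ_eq_add_one, hp', hφp]
    rfl
  obtain ⟨g, hg, hgo, hgφ⟩ := hφ.exists_planeOriented hinj hn
  have hgp : ∀ x, g^[p] x = x := fun x => chart_injective <| by
    rw [(show Function.Semiconj chart g φ from hgφ).iterate_right p x, hφp]
    rfl
  let E : Equiv.Perm ℂ := ⟨g, g^[p - 1],
    fun x => by rw [← Function.iterate_succ_apply, Nat.succ_eq_add_one, hp', hgp],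
    fun x => (Function.iterate_succ_apply' g (p - 1) x).symm.trans (by
      rw [Nat.succ_eq_add_one, hp', hgp])⟩
  have hEp : E ^ p = 1 := Equiv.ext fun x => by
    rw [← Equiv.Perm.iterate_eq_pow]
    exact hgp x
  have hE1 : E ≠ 1 := fun h => hφ1 <| funext fun u => by
    by_cases hu : u = north
    · rw [hu, hn, id]
    · obtain ⟨x, rfl⟩ := exists_chart_eq hu
      rw [← hgφ, show g x = x from congrArg (fun e : Equiv.Perm ℂ => e x) h, id]
  obtain ⟨z, hz⟩ := exists_fixed_of_prime_period (E := E) hg hp hEp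
  refine ⟨chart z, chart_ne_north z, ?_, fun c hc hcφ => ?_⟩
  · rw [← hgφ]
    exact congrArg chart hz
  · obtain ⟨x, rfl⟩ := exists_chart_eq hc
    rw [← hgφ] at hcφ
    exact congrArg chart
      (fixed_unique_of_prime_period (E := E) hg hgo hp hEp hE1 (chart_injective hcφ) hz)

theorem Lifts.existsUnique_fixed {f : TwoSphere → TwoSphere} (hf : Lifts f)
    (hn : f north = north) {n : ℕ} (h2 : 2 ≤ n) (hfn : f^[n] = id)
    (hmin : ∀ m, 0 < m → m < n → f^[m] ≠ id) :
    ∃ b, b ≠ north ∧ f b = b ∧ ∀ c, c ≠ north → f c = c → c = b := by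
  have hp : n.minFac.Prime := Nat.minFac_prime (by lia)
  obtain ⟨k, hk⟩ := n.minFac_dvd
  have hk0 : 0 < k := Nat.pos_of_ne_zero fun h => by rw [h, mul_zero] at hk; lia
  have hkn : k < n := by nlinarith [hp.two_le]
  obtain ⟨b, hb, hfb, huniq⟩ := (hf.iterate k).existsUnique_fixed_of_prime_period
    (Function.iterate_fixed hn k) hp (by rw [← Function.iterate_mul, mul_comm, ← hk, hfn])
    (hmin k hk0 hkn)
  have hinj : Function.Injective f := by
    refine Function.LeftInverse.injective (g := f^[n - 1]) fun x => ?_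
    rw [← Function.iterate_succ_apply, Nat.succ_eq_add_one, Nat.sub_add_cancel (by lia), hfn]
    rfl
  refine ⟨b, hb, huniq _ (fun h => hb (hinj (h.trans hn.symm))) ?_, fun c hc hfc =>
    huniq c hc (Function.iterate_fixed hfc k)⟩
  rw [← Function.iterate_succ_apply, Function.iterate_succ_apply', hfb]

theorem exists_involution_eq_north (a : TwoSphere) :
    ∃ σ : C(TwoSphere, TwoSphere), (∀ u, σ (σ u) = u) ∧ σ a = north := by
  set R := (Submodule.span ℝ {a.1 - north.1})ᗮ.reflection
  refine ⟨⟨fun u => ⟨R u.1, by simp⟩, by fun_prop⟩, fun u => Subtype.ext ?_, Subtype.ext ?_⟩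
  · exact Submodule.reflection_reflection _ _
  · refine Submodule.reflection_sub ?_
    rw [mem_sphere_zero_iff_norm.1 a.2, mem_sphere_zero_iff_norm.1 north.2]

theorem homeoGroup_pow_apply (f : TwoSphere ≃ₜ TwoSphere) (m : ℕ) :
    ⇑((homeoGroup TwoSphere).toMonoid.npow m f) = f^[m] := by
  induction m with
  | zero => rfl
  | succ m ih =>
    rw [Function.iterate_succ, ← ih]
    rfl

end TwoSphere

end

/-- An orientation-preserving homeomorphism of `S²` of finite order `n ≥ 2` has
exactly two fixed points. -/
theorem sphere_finite_order_two_fixed_points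
    (f : TwoSphere ≃ₜ TwoSphere) (n : ℕ) (hn : 2 ≤ n)
    (hord : orderOf f = n)
    (hor : SphereOrientationPreserving f) :
    ∃ a b : TwoSphere, a ≠ b ∧ {x : TwoSphere | f x = x} = {a, b} := by
  have hpow : ∀ m : ℕ, ⇑(f ^ m) = f^[m] := TwoSphere.homeoGroup_pow_apply f
  obtain ⟨a, ha⟩ := (TwoSphere.lifts_of_homotopic hor).exists_fixed
  obtain ⟨σ, hσ, hσa⟩ := TwoSphere.exists_involution_eq_north a
  have hσn : σ TwoSphere.north = a := by rw [← hσa, hσ]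
  set g : C(TwoSphere, TwoSphere) := (σ.comp ⟨f, f.continuous⟩).comp σ
  have hg : TwoSphere.Lifts g := by
    refine TwoSphere.lifts_of_homotopic ?_
    have := ((ContinuousMap.Homotopic.refl σ).comp hor).comp (ContinuousMap.Homotopic.refl σ)
    convert this using 1
    exact ContinuousMap.ext fun u => (hσ u).symm
  have hsemi : Function.Semiconj σ g f := fun u => hσ _
  have hgid : ∀ m, g^[m] = id ↔ f^[m] = id := fun m => by
    constructor
    · intro h
      funext u
      have := hsemi.iterate_right m (σ u)
      rw [h, hσ] at this
      exact this.symm.trans (hσ u)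
    · intro h
      funext u
      have := hsemi.iterate_right m u
      rw [h] at this
      have := congrArg σ this
      rwa [hσ, id, hσ] at this
  obtain ⟨b, hb, hgb, huniq⟩ := hg.existsUnique_fixed (n := n)
    (by change σ (f (σ TwoSphere.north)) = TwoSphere.north; rw [hσn]; exact (congrArg σ ha).trans hσa) hn
    ((hgid n).2 (by rw [← hpow, ← hord, pow_orderOf_eq_one]; rfl)) fun m hm hmn h => by
      refine pow_ne_one_of_lt_orderOf hm.ne' (hord.symm ▸ hmn : m < orderOf f) ?_
      refine Homeomorph.ext fun x => ?_
      rw [hpow, (hgid m).1 h]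
      rfl
  refine ⟨a, σ b, fun h => hb ?_, ?_⟩
  · rw [← hσ b, ← h, hσa]
  · ext x
    simp only [Set.mem_ofPred_eq, Set.mem_insert_iff, Set.mem_singleton_iff]
    constructor
    · intro hx
      by_cases h : σ x = TwoSphere.north
      · left
        rw [← hσ x, h, hσn]
      · right
        rw [← huniq (σ x) h (by change σ (f (σ (σ x))) = σ x; rw [hσ, hx]), hσ]
    · rintro (rfl | rfl)
      · exact ha
      · rw [← hsemi, hgb]
end

section
/- Let f : ℝ² → ℝ² be an orientation-preserving homeomorphism of finite order n ≥ 2. Then f has exactly one fixed point. -/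
/-- A homeomorphism of the plane is orientation preserving iff (equivalently) it
is isotopic to the identity: there is a family of homeomorphisms `F t`,
continuous in `(t, x)` (also for the inverses), with `F 0 = id` and `F 1 = f`. -/
def PlaneOrientationPreserving (f : (ℝ × ℝ) ≃ₜ (ℝ × ℝ)) : Prop :=
  ∃ F : ℝ → (ℝ × ℝ) ≃ₜ (ℝ × ℝ),
    Continuous (fun p : ℝ × (ℝ × ℝ) => F p.1 p.2) ∧
    Continuous (fun p : ℝ × (ℝ × ℝ) => (F p.1).symm p.2) ∧
    F 0 = Homeomorph.refl (ℝ × ℝ) ∧ F 1 = f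

open Set Topology unitInterval

/-- A nowhere vanishing homotopy with a logarithm at time `0` has a continuous logarithm. -/
theorem exists_log_homotopy {X : Type*} [TopologicalSpace X] {H : I × X → ℂ}
    (hH : Continuous H) (hne : ∀ q, H q ≠ 0) {l : X → ℂ} (hl : Continuous l)
    (h0 : ∀ x, H (0, x) = Complex.exp (l x)) :
    ∃ G : I × X → ℂ, Continuous G ∧ (∀ x, G (0, x) = l x) ∧ ∀ q, Complex.exp (G q) = H q := by
  let H' : C(I × X, {z : ℂ // z ≠ 0}) := ⟨fun q => ⟨H q, hne q⟩, by fun_prop⟩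
  have h0' : ∀ x, H' (0, x) = (fun z : ℂ => (⟨_, z.exp_ne_zero⟩ : {z : ℂ // z ≠ 0}))
      ((⟨l, hl⟩ : C(X, ℂ)) x) := fun x => Subtype.ext (h0 x)
  refine ⟨Complex.isCoveringMap_exp.liftHomotopy H' ⟨l, hl⟩ h0', ContinuousMap.continuous _,
    fun x => Complex.isCoveringMap_exp.liftHomotopy_zero H' ⟨l, hl⟩ h0' x, fun q => ?_⟩
  exact congrArg Subtype.val
    (congrFun (Complex.isCoveringMap_exp.liftHomotopy_lifts H' ⟨l, hl⟩ h0') q)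

/-- A nowhere vanishing continuous function on a star-convex set has a continuous logarithm. -/
theorem StarConvex.exists_log {E : Type*} [AddCommGroup E] [Module ℝ E] [TopologicalSpace E]
    [ContinuousAdd E] [ContinuousSMul ℝ E] {S : Set E} {x₀ : E}
    (hS : StarConvex ℝ x₀ S) (hx₀ : x₀ ∈ S) {g : E → ℂ} (hg : ContinuousOn g S)
    (hne : ∀ x ∈ S, g x ≠ 0) :
    ∃ L : E → ℂ, ContinuousOn L S ∧ ∀ x ∈ S, Complex.exp (L x) = g x := by
  classical
  let P : I × S → S := fun q => ⟨(1 - (q.1 : ℝ)) • x₀ + (q.1 : ℝ) • (q.2 : E),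
    hS q.2.2 (by linarith [q.1.2.2]) q.1.2.1 (by ring)⟩
  have hP : Continuous P := by
    refine Continuous.subtype_mk ?_ _
    fun_prop
  have hg' : Continuous (fun q => g (P q)) := (continuousOn_iff_continuous_domRestrict.1 hg).comp hP
  obtain ⟨G, hGc, -, hG⟩ := exists_log_homotopy hg' (fun q => hne _ (P q).2)
    (l := fun _ => Complex.log (g x₀)) continuous_const (fun x => by
      simp [P, Complex.exp_log (hne _ hx₀)])
  refine ⟨fun x => if hx : x ∈ S then G (1, ⟨x, hx⟩) else 0, ?_, fun x hx => ?_⟩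
  · rw [continuousOn_iff_continuous_domRestrict]
    have : (S.domRestrict fun x => if hx : x ∈ S then G (1, ⟨x, hx⟩) else 0) =
        fun x : S => G (1, x) := by
      ext x
      simp [x.2]
    rw [this]
    fun_prop
  · simp [hx, hG, P]

/-- A continuous function with constant exponential is constant on preconnected sets. -/
theorem IsPreconnected.eq_of_exp_eq {X : Type*} [TopologicalSpace X] {S : Set X}
    (hS : IsPreconnected S) {g : X → ℂ} (hg : ContinuousOn g S) {k : ℂ}
    (h : ∀ x ∈ S, Complex.exp (g x) = k) : ∀ x ∈ S, ∀ y ∈ S, g x = g y := fun _ hx _ hy =>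
  Complex.isCoveringMap_exp.constOn_of_comp hS hg
    (fun a ha b hb => Subtype.ext ((h a ha).trans (h b hb).symm)) hx hy

theorem Homeomorph.zpow_add_apply {X : Type*} [TopologicalSpace X] (f : X ≃ₜ X) (i j : ℤ) (z : X) :
    (f ^ (i + j)) z = (f ^ i) ((f ^ j) z) := by
  rw [zpow_add]
  rfl

theorem Homeomorph.zpow_neg_apply_zpow_apply {X : Type*} [TopologicalSpace X] (f : X ≃ₜ X) (i : ℤ)
    (z : X) : (f ^ (-i)) ((f ^ i) z) = z := by
  rw [zpow_neg]
  exact (f ^ i).symm_apply_apply z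

theorem Homeomorph.zpow_apply_fixed {X : Type*} [TopologicalSpace X] {f : X ≃ₜ X} {z : X}
    (hz : f z = z) (j : ℤ) : (f ^ j) z = z := by
  induction j with
  | zero => rfl
  | succ n ih => rw [Homeomorph.zpow_add_apply, zpow_one, hz, ih]
  | pred n ih =>
    rw [sub_eq_add_neg, Homeomorph.zpow_add_apply, zpow_neg_one]
    exact (congrArg _ (f.symm_apply_eq.2 hz.symm)).trans ih

theorem Homeomorph.pow_period_apply_fixed {X : Type*} [TopologicalSpace X] {f : X ≃ₜ X} {p : ℕ}
    (hp : p.Prime) (hf : f ^ p = 1) {i : ℤ} (hi : ¬ (p : ℤ) ∣ i) {z : X} (hz : (f ^ i) z = z) :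
    f z = z := by
  have hcop : IsCoprime (p : ℤ) i := (Nat.prime_iff_prime_int.1 hp).coprime_iff_not_dvd.2 hi
  obtain ⟨a, b, hab⟩ := hcop
  have : f = (f ^ i) ^ b := by
    calc f = f ^ (a * p + b * i) := by rw [hab, zpow_one]
      _ = (f ^ i) ^ b := by
        rw [zpow_add, mul_comm a, zpow_mul, zpow_natCast, hf, one_zpow, one_mul, mul_comm b,
          zpow_mul]
  rw [this]
  exact Homeomorph.zpow_apply_fixed hz b

/-- A fixed point free continuous map `h` of the plane cannot rotate a simple closed curve,
parametrized with period `p`, by the parameter `1`. -/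
theorem false_of_rotated_simple_loop {h : ℂ → ℂ} (hh : Continuous h) (hfix : ∀ z, h z ≠ z)
    {p : ℕ} (hp : 2 ≤ p) {γ : ℝ → ℂ} (hγ : Continuous γ) (hshift : ∀ s, γ (s + 1) = h (γ s))
    (hper : ∀ s, γ (s + p) = γ s) (hinj : ∀ s t, γ s = γ t → ∃ n : ℤ, s - t = n * p) : False := by
  have hp' : (2 : ℝ) ≤ p := by exact_mod_cast hp
  let S : Set (ℝ × ℝ) := {q | q.1 < q.2 ∧ q.2 < q.1 + p}
  have hSconv : Convex ℝ S := by
    rintro ⟨a, b⟩ ⟨h1, h2⟩ ⟨c, d⟩ ⟨h3, h4⟩ x y hx hy hxy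
    simp only at h1 h2 h3 h4
    constructor <;> simp only [Prod.smul_mk, Prod.mk_add_mk, smul_eq_mul] <;>
    · have : p = x * (p : ℝ) + y * p := by rw [← add_mul, hxy, one_mul]
      rcases hx.eq_or_lt with rfl | hx
      · have : y = 1 := by linarith
        subst this
        linarith
      · nlinarith
  obtain ⟨L, hL, hLe⟩ := (hSconv.starConvex (x := ((0 : ℝ), (1 : ℝ)))
    ⟨by norm_num, by norm_num; linarith⟩).exists_log ⟨by norm_num, by norm_num; linarith⟩
    (g := fun q => γ q.2 - γ q.1) (by fun_prop) (by
      rintro ⟨s, t⟩ ⟨h1, h2⟩ h0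
      simp only at h1 h2
      obtain ⟨n, hn⟩ := hinj t s (sub_eq_zero.1 h0)
      have h3 : (0 : ℝ) < n := by
        by_contra h; nlinarith
      have h4 : (n : ℝ) < 1 := by
        by_contra h; nlinarith
      have h3' : 0 < n := by exact_mod_cast h3
      have h4' : n < 1 := by exact_mod_cast h4
      omega)
  obtain ⟨l, hl, hle⟩ := (convex_univ.starConvex (mem_univ (0 : ℂ)) :
    StarConvex ℝ (0 : ℂ) univ).exists_log (mem_univ _) (g := fun z => h z - z) (by fun_prop)
    (fun z _ => sub_ne_zero.2 (hfix z))
  have hl' : Continuous l := by rwa [← continuousOn_univ]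
  have hmem : ∀ q ∈ S, (q.2, q.1 + p) ∈ S := by
    rintro ⟨s, t⟩ ⟨h1, h2⟩
    exact ⟨h2, by simpa using h1⟩
  have hconst := hSconv.isPreconnected.eq_of_exp_eq
    (g := fun q => L (q.2, q.1 + p) - L q) (k := -1)
    ((hL.comp (f := fun q : ℝ × ℝ => (q.2, q.1 + (p : ℝ))) (by fun_prop) hmem).sub hL) (by
      rintro ⟨s, t⟩ hq
      have h0 := Complex.exp_ne_zero (L (s, t))
      rw [Complex.exp_sub, hLe _ (hmem _ hq), div_eq_iff h0, hLe _ hq, hper]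
      ring)
  have h01 : ((0 : ℝ), (1 : ℝ)) ∈ S := ⟨by norm_num, by norm_num; linarith⟩
  have h1p : ((1 : ℝ), (p : ℝ)) ∈ S := ⟨by norm_num; linarith, by norm_num⟩
  have e1 := hconst _ h01 _ h1p
  have hline : ∀ s ∈ (univ : Set ℝ), (s, s + 1) ∈ S := fun s _ => ⟨by simp, by
    simp only; linarith⟩
  have e2 := isPreconnected_univ.eq_of_exp_eq (g := fun s : ℝ => L (s, s + 1) - l (γ s)) (k := 1)
    ((hL.comp (f := fun s : ℝ => (s, s + 1)) (by fun_prop) hline).sub (by fun_prop)) (by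
      intro s _
      have h0 := Complex.exp_ne_zero (l (γ s))
      rw [Complex.exp_sub, div_eq_iff h0, hLe _ (hline s trivial), hle _ trivial, one_mul, hshift])
    _ (mem_univ 0) _ (mem_univ (p : ℝ))
  have hγp : γ p = γ 0 := by simpa using hper 0
  simp only [zero_add] at e1 e2
  rw [hγp, add_comm (p : ℝ) 1] at e2
  have hk : L (1, (p : ℝ)) = L (0, 1) := by
    linear_combination (1 / 2 : ℂ) * e1 - (1 / 2 : ℂ) * e2
  have h5 := hLe _ h01
  have h6 := hLe _ h1p
  rw [hk, h5, hγp] at h6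
  simp only at h6
  have h7 := Complex.exp_ne_zero (L (0, 1))
  rw [h5] at h7
  exact h7 (by linear_combination (1 / 2 : ℂ) * h6)

/-- For a fixed point free homeomorphism of prime order `p`, some power `h` has the property that
the translates of an open ball are disjoint from the closed ball, except that a boundary point
is sent to a boundary point by `h`. -/
theorem exists_touching_ball {f : ℂ ≃ₜ ℂ} {p : ℕ} (hp : p.Prime) (hf : f ^ p = 1)
    (hfix : ∀ z, f z ≠ z) :
    ∃ (h : ℂ ≃ₜ ℂ) (u : ℂ) (r : ℝ), h ^ p = 1 ∧ (∀ z, h z ≠ z) ∧ ‖u‖ = r ∧ ‖h u‖ = r ∧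
      ∀ j : ℤ, ¬ (p : ℤ) ∣ j → ∀ y, ‖y‖ < r → r < ‖(h ^ j) y‖ := by
  have hmod : ∀ i : ℤ, f ^ i = f ^ (i % (p : ℤ)) := fun i => zpow_eq_zpow_emod' i hf
  have hcont : ∀ i : ℤ, Continuous fun y => max ‖y‖ ‖(f ^ i) y‖ := fun i =>
    continuous_norm.max ((f ^ i).continuous.norm)
  have hmin : ∀ i : ℤ, ∃ u, ∀ y, max ‖u‖ ‖(f ^ i) u‖ ≤ max ‖y‖ ‖(f ^ i) y‖ := fun i =>
    (hcont i).exists_forall_le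
      (Filter.tendsto_atTop_mono (fun y => le_max_left _ _) (tendsto_norm_cocompact_atTop))
  choose U hU using hmin
  obtain ⟨k, hk, hkmin⟩ := (Finset.Ioo (0 : ℤ) p).exists_min_image
    (fun i => max ‖U i‖ ‖(f ^ i) (U i)‖) ⟨1, by simpa using hp.one_lt⟩
  rw [Finset.mem_Ioo] at hk
  have hkp : ¬ (p : ℤ) ∣ k := fun h => by
    have := Int.le_of_dvd hk.1 h
    omega
  obtain ⟨r, hr⟩ : ∃ r, r = max ‖U k‖ ‖(f ^ k) (U k)‖ := ⟨_, rfl⟩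
  have hle : ∀ i : ℤ, ¬ (p : ℤ) ∣ i → ∀ y, r ≤ max ‖y‖ ‖(f ^ i) y‖ := by
    intro i hi y
    have hp0 : (0 : ℤ) < p := by exact_mod_cast hp.pos
    have hpos : i % p ≠ 0 := fun h => hi (Int.dvd_of_emod_eq_zero h)
    have h1 := Int.emod_nonneg i hp0.ne'
    have h2 := Int.emod_lt_of_pos i hp0
    rw [hmod i, hr]
    exact (hkmin _ (Finset.mem_Ioo.2 ⟨by omega, h2⟩)).trans (hU _ y)
  have hlt : ∀ i : ℤ, ¬ (p : ℤ) ∣ i → ∀ y, ‖y‖ < r → r < ‖(f ^ i) y‖ := by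
    intro i hi y hy
    refine lt_of_le_of_ne (((le_max_iff.1 (hle i hi y)).resolve_left hy.not_ge)) fun heq => ?_
    have hev : ∀ᶠ t : ℝ in 𝓝[<] 1, ‖(f ^ i).symm (t • (f ^ i) y)‖ < r := by
      have : ContinuousAt (fun t : ℝ => ‖(f ^ i).symm (t • (f ^ i) y)‖) 1 := by
        have := (f ^ i).symm.continuous
        fun_prop
      refine (this.eventually_lt continuousAt_const ?_).filter_mono nhdsWithin_le_nhds
      simpa using hy
    have hev' : ∀ᶠ t : ℝ in 𝓝[<] 1, 0 < t :=
      (lt_mem_nhds one_pos).filter_mono nhdsWithin_le_nhds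
    obtain ⟨t, ht, ht0, ht1 : t < 1⟩ := (hev.and (hev'.and self_mem_nhdsWithin)).exists
    have h1 := hle i hi ((f ^ i).symm (t • (f ^ i) y))
    rw [(f ^ i).apply_symm_apply, norm_smul, ← heq, Real.norm_of_nonneg ht0.le] at h1
    have hr0 : 0 < r := (norm_nonneg y).trans_lt hy
    rcases le_max_iff.1 h1 with h2 | h2
    · linarith
    · nlinarith
  have h1 : ‖U k‖ ≤ r := hr ▸ le_max_left _ _
  have h2 : ‖(f ^ k) (U k)‖ ≤ r := hr ▸ le_max_right _ _
  refine ⟨f ^ k, U k, r, ?_, fun z hz => hfix z (Homeomorph.pow_period_apply_fixed hp hf hkp hz),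
    h1.antisymm (not_lt.1 fun h => (hlt k hkp _ h).not_ge h2), h2.antisymm (not_lt.1 fun h => ?_),
    fun j hj y hy => ?_⟩
  · rw [← zpow_natCast, ← zpow_mul, mul_comm, zpow_mul, zpow_natCast, hf, one_zpow]
  · have := hlt (-k) (by rwa [dvd_neg]) _ h
    rw [Homeomorph.zpow_neg_apply_zpow_apply] at this
    exact this.not_ge h1
  · rw [← zpow_mul]
    exact hlt _ (fun h => (((Nat.prime_iff_prime_int.1 hp).dvd_or_dvd h).elim hkp hj)) y hy

/-- A homeomorphism of the plane of prime order has a fixed point. -/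
theorem Homeomorph.exists_fixed_of_prime_order {f : ℂ ≃ₜ ℂ} {p : ℕ} (hp : p.Prime)
    (hf : f ^ p = 1) : ∃ z, f z = z := by
  by_contra! hfix
  obtain ⟨h, u, r, hh, hhfix, hu, hw, hball⟩ := exists_touching_ball hp hf hfix
  have hdvd : ∀ j : ℤ, (p : ℤ) ∣ j → h ^ j = 1 := by
    rintro _ ⟨m, rfl⟩
    rw [zpow_mul, zpow_natCast, hh, one_zpow]
  have hr : 0 < r := by
    refine (hu ▸ norm_nonneg u).lt_of_ne fun h0 => hhfix u ?_
    rw [norm_eq_zero.1 (hu.trans h0.symm), ← norm_eq_zero, h0,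
      ← norm_eq_zero.1 (hu.trans h0.symm), hw]
  let α : ℝ → ℂ := fun s => max (1 - 2 * s) 0 • u + max (2 * s - 1) 0 • h u
  have hα : Continuous α := by fun_prop
  have hα1 : ∀ s, s ≤ 1 / 2 → α s = (1 - 2 * s) • u := fun s hs => by
    simp only [α]
    rw [max_eq_left (by linarith), max_eq_right (by linarith), zero_smul, add_zero]
  have hα2 : ∀ s, 1 / 2 ≤ s → α s = (2 * s - 1) • h u := fun s hs => by
    simp only [α]
    rw [max_eq_right (by linarith), max_eq_left (by linarith), zero_smul, zero_add]
  have hα0 : α 0 = u := by rw [hα1 _ (by norm_num)]; simp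
  have hnorm : ∀ s, ‖α s‖ = |1 - 2 * s| * r := fun s => by
    rcases le_total s (1 / 2) with hs | hs
    · rw [hα1 s hs, norm_smul, hu, Real.norm_eq_abs]
    · rw [hα2 s hs, norm_smul, hw, Real.norm_eq_abs, abs_sub_comm]
  have hnormle : ∀ s ∈ Ico (0 : ℝ) 1, ‖α s‖ ≤ r := fun s hs => by
    rw [hnorm]
    exact mul_le_of_le_one_left hr.le (abs_le.2 ⟨by linarith [hs.2], by linarith [hs.1]⟩)
  have hnormlt : ∀ s ∈ Ico (0 : ℝ) 1, s ≠ 0 → ‖α s‖ < r := fun s hs hs0 => by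
    have := hs.1.lt_of_ne hs0.symm
    rw [hnorm]
    exact mul_lt_of_lt_one_left hr (abs_lt.2 ⟨by linarith [hs.2], by linarith⟩)
  have hinj : ∀ a ∈ Ico (0 : ℝ) 1, ∀ b ∈ Ico (0 : ℝ) 1, α a = α b → a = b := by
    have key : ∀ a b : ℝ, a ≤ 1 / 2 → 1 / 2 ≤ b → α a = α b → a = b := fun a b ha hb hab => by
      have hn := congrArg norm hab
      rw [hnorm, hnorm, abs_of_nonneg (by linarith), abs_of_nonpos (by linarith)] at hn
      have hn' := mul_right_cancel₀ hr.ne' hn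
      rw [hα1 a ha, hα2 b hb, hn', neg_sub] at hab
      by_contra hne
      have h0 : 2 * b - 1 ≠ 0 := fun h0 => hne (by linarith)
      exact hhfix u (smul_right_injective ℂ h0 hab).symm
    intro a ha b hb hab
    have hn := congrArg norm hab
    rw [hnorm, hnorm] at hn
    have hn' := mul_right_cancel₀ hr.ne' hn
    rcases le_total a (1 / 2) with h1 | h1 <;> rcases le_total b (1 / 2) with h2 | h2
    · rw [abs_of_nonneg (by linarith), abs_of_nonneg (by linarith)] at hn'
      linarith
    · exact key a b h1 h2 hab
    · exact (key b a h2 h1 hab.symm).symm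
    · rw [abs_of_nonpos (by linarith), abs_of_nonpos (by linarith)] at hn'
      linarith
  have hdisj : ∀ j : ℤ, ∀ a ∈ Ico (0 : ℝ) 1, ∀ b ∈ Ico (0 : ℝ) 1, (h ^ j) (α a) = α b →
      (p : ℤ) ∣ j := by
    intro j a ha b hb hab
    by_contra hj
    by_cases ha0 : a = 0
    · by_cases hb0 : b = 0
      · subst ha0 hb0
        exact hhfix _ (Homeomorph.pow_period_apply_fixed hp hh hj hab)
      · have h1 := hball (-j) (by rwa [dvd_neg]) _ (hnormlt b hb hb0)
        rw [← hab, Homeomorph.zpow_neg_apply_zpow_apply] at h1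
        exact h1.not_ge (hnormle a ha)
    · have h1 := hball j hj _ (hnormlt a ha ha0)
      rw [hab] at h1
      exact h1.not_ge (hnormle b hb)
  let γ : ℝ → ℂ := fun s => (h ^ ⌊s⌋) (α (Int.fract s))
  have hγc : Continuous γ := by
    refine LocallyFinite.continuous (f := fun n : ℤ => Icc (n : ℝ) (n + 1))
      (locallyFinite_Icc_of_tendsto tendsto_intCast_atTop_atTop
        (Filter.tendsto_atBot_add_const_right _ _ (tendsto_intCast_atBot_iff.2 Filter.tendsto_id)))
      (iUnion_Icc_intCast ℝ) (fun n => isClosed_Icc) fun n => ?_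
    have hc : Continuous fun s : ℝ => (h ^ n) (α (s - n)) :=
      (h ^ n).continuous.comp (hα.comp (by fun_prop))
    refine hc.continuousOn.congr fun s hs => ?_
    rcases hs.2.eq_or_lt with h1 | h1
    · have h2 : s = ((n + 1 : ℤ) : ℝ) := by rw [h1]; push_cast; rfl
      simp only [γ]
      rw [h2, Int.floor_intCast, Int.fract_intCast, hα0, Homeomorph.zpow_add_apply, zpow_one,
        hα2 _ (by push_cast; linarith)]
      congr 1
      push_cast
      ring_nf
      simp
    · have h2 : ⌊s⌋ = n := Int.floor_eq_iff.2 ⟨hs.1, h1⟩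
      simp only [γ]
      rw [h2, Int.fract, h2]
  refine false_of_rotated_simple_loop h.continuous hhfix hp.two_le hγc (fun s => ?_) (fun s => ?_)
    fun s t hst => ?_
  · simp only [γ]
    rw [Int.floor_add_one, Int.fract_add_one, add_comm, Homeomorph.zpow_add_apply, zpow_one]
  · simp only [γ]
    rw [Int.floor_add_natCast, Int.fract_add_natCast, zpow_add, zpow_natCast, hh, mul_one]
  · have h1 : (h ^ (-⌊t⌋ + ⌊s⌋)) (α (Int.fract s)) = α (Int.fract t) := by
      rw [Homeomorph.zpow_add_apply]
      exact (congrArg _ hst).trans (Homeomorph.zpow_neg_apply_zpow_apply _ _ _)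
    have hs := (⟨Int.fract_nonneg s, Int.fract_lt_one s⟩ : Int.fract s ∈ Ico (0 : ℝ) 1)
    have ht := (⟨Int.fract_nonneg t, Int.fract_lt_one t⟩ : Int.fract t ∈ Ico (0 : ℝ) 1)
    have h2 := hdisj _ _ hs _ ht h1
    rw [hdvd _ h2] at h1
    obtain ⟨n, hn⟩ := h2
    refine ⟨n, ?_⟩
    have h3 := hinj _ hs _ ht h1
    have h4 : (-⌊t⌋ + ⌊s⌋ : ℝ) = p * n := by exact_mod_cast hn
    linarith [Int.floor_add_fract s, Int.floor_add_fract t]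

/-- Given a logarithm `c` of the difference quotients of a homeomorphism `f` fixing two points
`u ≠ v`, an arc `B` from `u` to `v` that is disjoint from its image under `f` (away from the ends)
cannot have a point `B τ` that is accessible by a ray missing the images of `B` under `f` and its
inverse. -/
theorem false_of_accessible_point {f : ℂ ≃ₜ ℂ} {c : ℂ × ℂ → ℂ}
    (hc : ContinuousOn c {q | q.1 ≠ q.2})
    (hce : ∀ y z, y ≠ z → Complex.exp (c (y, z)) = (f y - f z) / (y - z))
    {u v : ℂ} (huv : u ≠ v) (hcuv : c (u, v) = c (v, u)) (hu : f u = u) (hv : f v = v)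
    {B : ℝ → ℂ} (hB : Continuous B) {a b S T τ : ℝ} (hS : S ≤ a) (hT : b ≤ T)
    (hτ : τ ∈ Ioo a b) (hBS : B S = u) (hBT : B T = v)
    (hdisj : ∀ s t, (a < s ∨ a < t) → (s < b ∨ t < b) → f (B s) ≠ B t)
    {d : ℂ} (hd1 : ∀ s, d * (f (B s) - B τ) ∈ Complex.slitPlane)
    (hd2 : ∀ s, d * (f.symm (B s) - B τ) ∈ Complex.slitPlane) : False := by
  have hfc := f.continuous
  have hfc' := f.symm.continuous
  let R : Set (ℝ × ℝ) := {q | (a < q.1 ∨ a < q.2) ∧ (q.1 < b ∨ q.2 < b)}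
  have hR : ∀ s t, (s, t) ∈ R → (t, s) ∈ R := fun s t h => ⟨h.1.symm, h.2.symm⟩
  have hab : a < b := hτ.1.trans hτ.2
  have hτR : (τ, τ) ∈ R := ⟨.inl hτ.1, .inl hτ.2⟩
  have hstar : StarConvex ℝ (τ, τ) R := by
    rintro ⟨s, t⟩ ⟨h1, h2⟩ x y hx hy hxy
    rcases hx.eq_or_lt with rfl | hx
    · have : y = 1 := by linarith
      subst this
      rw [zero_smul, one_smul, zero_add]
      exact ⟨h1, h2⟩
    · have ha : a = x * a + y * a := by rw [← add_mul, hxy, one_mul]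
      have hb : b = x * b + y * b := by rw [← add_mul, hxy, one_mul]
      have hxa : x * a < x * τ := mul_lt_mul_of_pos_left hτ.1 hx
      have hxb : x * τ < x * b := mul_lt_mul_of_pos_left hτ.2 hx
      simp only at h1 h2
      constructor
      · refine h1.imp (fun h => ?_) fun h => ?_ <;>
        · simp only [Prod.smul_mk, Prod.mk_add_mk, smul_eq_mul]
          have := mul_le_mul_of_nonneg_left h.le hy
          linarith
      · refine h2.imp (fun h => ?_) fun h => ?_ <;>
        · simp only [Prod.smul_mk, Prod.mk_add_mk, smul_eq_mul]
          have := mul_le_mul_of_nonneg_left h.le hy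
          linarith
  have hpre : IsPreconnected R := (hstar.isPathConnected hτR).isConnected.isPreconnected
  have hne : ∀ s t, (s, t) ∈ R → f (B s) ≠ B t := fun s t h => hdisj s t h.1 h.2
  have hne' : ∀ s t, (s, t) ∈ R → f.symm (B s) ≠ B t := fun s t h h' =>
    hne t s (hR _ _ h) ((f.symm_apply_eq.1 h').symm)
  obtain ⟨l, hl, hle⟩ := hstar.exists_log hτR (g := fun q => f (B q.1) - B q.2) (by fun_prop)
    fun q hq => sub_ne_zero.2 (hne _ _ hq)
  obtain ⟨m, hm, hme⟩ := hstar.exists_log hτR (g := fun q => f.symm (B q.1) - B q.2)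
    (by fun_prop) fun q hq => sub_ne_zero.2 (hne' _ _ hq)
  have hu' : f.symm u = u := f.symm_apply_eq.2 hu.symm
  have hv' : f.symm v = v := f.symm_apply_eq.2 hv.symm
  have hSR : ∀ t, a < t → (S, t) ∈ R := fun t ht => ⟨.inr ht, .inl (hS.trans_lt hab)⟩
  have hTR : ∀ t, t < b → (T, t) ∈ R := fun t ht => ⟨.inl (hab.trans_le hT), .inr ht⟩
  have hτR' : ∀ s, (s, τ) ∈ R := fun s => ⟨.inr hτ.1, .inr hτ.2⟩
  have hline : ∀ (s₀ : ℝ) (w : ℂ) (J : Set ℝ), IsPreconnected J → B s₀ = w → f w = w →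
      f.symm w = w → (∀ t ∈ J, (s₀, t) ∈ R) → ∀ t ∈ J, ∀ t' ∈ J,
      l (s₀, t) - m (s₀, t) = l (s₀, t') - m (s₀, t') := by
    intro s₀ w J hJ hBw hw hw' hJR
    have hco : Continuous fun t : ℝ => (s₀, t) := by fun_prop
    refine hJ.eq_of_exp_eq (g := fun t => l (s₀, t) - m (s₀, t)) (k := 1)
      ((hl.comp hco.continuousOn hJR).sub (hm.comp hco.continuousOn hJR)) fun t ht => ?_
    rw [Complex.exp_sub, div_eq_one_iff_eq (Complex.exp_ne_zero _), hle _ (hJR t ht),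
      hme _ (hJR t ht), hBw, hw, hw']
  have hD1 := hline S u (Ioi a) isPreconnected_Ioi hBS hu hu' hSR τ hτ.1 T (hab.trans_le hT)
  have hD2 := hline T v (Iio b) isPreconnected_Iio hBT hv hv' hTR τ hτ.2 S (hS.trans_lt hab)
  have hd0 : d ≠ 0 := fun h => Complex.slitPlane_ne_zero (hd1 0) (by rw [h, zero_mul])
  have hcross : ∀ (k : ℂ → ℂ) (n : ℝ × ℝ → ℂ), Continuous k → ContinuousOn n R →
      (∀ q ∈ R, Complex.exp (n q) = k (B q.1) - B q.2) →
      (∀ s, d * (k (B s) - B τ) ∈ Complex.slitPlane) →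
      n (S, τ) - Complex.log (d * (k (B S) - B τ)) =
        n (T, τ) - Complex.log (d * (k (B T) - B τ)) := by
    intro k n hk hn hne hkd
    have hco : Continuous fun s : ℝ => (s, τ) := by fun_prop
    refine isPreconnected_univ.eq_of_exp_eq
      (g := fun s => n (s, τ) - Complex.log (d * (k (B s) - B τ))) (k := d⁻¹)
      ((hn.comp hco.continuousOn fun s _ => hτR' s).sub
        (ContinuousOn.clog (by fun_prop) fun s _ => hkd s)) (fun s _ => ?_)
      _ (mem_univ S) _ (mem_univ T)
    have h0 := Complex.slitPlane_ne_zero (hkd s)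
    rw [Complex.exp_sub, Complex.exp_log h0, hne _ (hτR' s), div_eq_iff h0,
      inv_mul_cancel_left₀ hd0]
  have hX1 := hcross f l hfc hl hle hd1
  have hX2 := hcross f.symm m hfc' hm hme hd2
  rw [hBS, hBT] at hX1 hX2
  rw [hu, hv] at hX1
  rw [hu', hv'] at hX2
  have hST := hSR T (hab.trans_le hT)
  have hTS := hR _ _ hST
  have hsw := hpre.eq_of_exp_eq
    (g := fun q => l (q.2, q.1) - m q - c (f.symm (B q.1), B q.2)) (k := -1)
    (((hl.comp (f := fun q : ℝ × ℝ => (q.2, q.1)) (by fun_prop) fun q hq => hR _ _ hq).sub hm).sub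
      (hc.comp (f := fun q : ℝ × ℝ => (f.symm (B q.1), B q.2)) (by fun_prop)
        fun q hq => hne' _ _ hq)) (fun ⟨s, t⟩ hq => by
      have h0 := sub_ne_zero.2 (hne' _ _ hq)
      have h1 := sub_ne_zero.2 (hne _ _ (hR _ _ hq))
      have h2 : B s - f (B t) ≠ 0 := fun h => h1 (by linear_combination -h)
      rw [Complex.exp_sub, Complex.exp_sub, hce _ _ (hne' _ _ hq), hle _ (hR _ _ hq), hme _ hq,
        f.apply_symm_apply]
      field_simp
      ring) _ hST _ hTS
  simp only [hBS, hBT, hu', hv', hcuv] at hsw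
  have hQ : l (T, S) = l (S, T) := by
    linear_combination (1 / 2 : ℂ) * (hsw - hX1 + hX2 + hD1 - hD2)
  have h1 := hle _ hST
  have h2 := hle _ hTS
  rw [hQ, h1] at h2
  simp only [hBS, hBT, hu, hv] at h2
  exact huv (by linear_combination (1 / 2 : ℂ) * h2)

/-- The difference quotients of a map of the plane that is isotopic to the identity have a
symmetric continuous logarithm. -/
theorem exists_log_difference_quotient {F : ℝ → ℂ → ℂ}
    (hF : Continuous fun q : ℝ × ℂ => F q.1 q.2) (hinj : ∀ t, Function.Injective (F t))
    (h0 : ∀ z, F 0 z = z) :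
    ∃ c : ℂ × ℂ → ℂ, ContinuousOn c {q | q.1 ≠ q.2} ∧
      (∀ y z, y ≠ z → Complex.exp (c (y, z)) = (F 1 y - F 1 z) / (y - z)) ∧
      ∀ y z, y ≠ z → c (y, z) = c (z, y) := by
  classical
  let D : Set (ℂ × ℂ) := {q | q.1 ≠ q.2}
  let H : I × D → ℂ := fun q => (F q.1 q.2.1.1 - F q.1 q.2.1.2) / (q.2.1.1 - q.2.1.2)
  have hD : ∀ q : D, q.1.1 - q.1.2 ≠ 0 := fun q => sub_ne_zero.2 q.2
  have hH : Continuous H := by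
    refine Continuous.div (.sub ?_ ?_) (by fun_prop) fun q => hD q.2
    · exact hF.comp (f := fun q : I × D => ((q.1 : ℝ), q.2.1.1)) (by fun_prop)
    · exact hF.comp (f := fun q : I × D => ((q.1 : ℝ), q.2.1.2)) (by fun_prop)
  have hHne : ∀ q, H q ≠ 0 := fun q =>
    div_ne_zero (sub_ne_zero.2 fun h => q.2.2 (hinj _ h)) (hD q.2)
  obtain ⟨G, hGc, hG0, hG⟩ := exists_log_homotopy hH hHne (l := fun _ => 0) continuous_const
    fun q => by simp [H, h0, div_self (hD q)]
  have hsymm : ∀ q : D, G (1, q) = G (1, ⟨(q.1.2, q.1.1), q.2.symm⟩) := by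
    intro q
    have h := isPreconnected_univ.eq_of_exp_eq
      (g := fun t : I => G (t, q) - G (t, ⟨(q.1.2, q.1.1), q.2.symm⟩)) (k := 1)
      (by fun_prop) (fun t _ => by
        rw [Complex.exp_sub, div_eq_one_iff_eq (Complex.exp_ne_zero _), hG, hG]
        simp only [H]
        rw [← neg_sub, ← neg_sub q.1.2, neg_div_neg_eq]) 1 (mem_univ _) 0 (mem_univ _)
    simpa [hG0, sub_eq_zero] using h
  refine ⟨fun q => if hq : q ∈ D then G (1, ⟨q, hq⟩) else 0, ?_, fun y z h => ?_, fun y z h => ?_⟩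
  · change ContinuousOn _ D
    rw [continuousOn_iff_continuous_domRestrict]
    have : (D.domRestrict fun q => if hq : q ∈ D then G (1, ⟨q, hq⟩) else 0) =
        fun q : D => G (1, q) := by
      ext x
      simp [x.2]
    rw [this]
    fun_prop
  · have hq : (y, z) ∈ D := h
    simp only [hq, dif_pos, hG]
    simp [H]
  · have hq : (y, z) ∈ D := h
    have hq' : (z, y) ∈ D := h.symm
    simp only [hq, hq', dif_pos]
    exact hsymm ⟨(y, z), h⟩

/-- Let `f` be a homeomorphism of prime order `p` fixing `u ≠ v`, with a logarithm `c` of its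
difference quotients. There is no arc `β` from `u` to `v` whose translates are disjoint, apart from
end pieces near `u` and `v`. -/
theorem false_of_equivariant_arc {f : ℂ ≃ₜ ℂ} {p : ℕ} (hp : p.Prime) (hf : f ^ p = 1)
    {c : ℂ × ℂ → ℂ} (hc : ContinuousOn c {q | q.1 ≠ q.2})
    (hce : ∀ y z, y ≠ z → Complex.exp (c (y, z)) = (f y - f z) / (y - z))
    {u v : ℂ} (huv : u ≠ v) (hcuv : c (u, v) = c (v, u)) (hu : f u = u) (hv : f v = v)
    {β : ℝ → ℂ} (hβ : Continuous β) {a b : ℝ} (hab : a < b)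
    (hβu : ∀ s ≤ a - 1, β s = u) (hβv : ∀ s, b + 1 ≤ s → β s = v)
    (hleft : ∀ s ≤ a, ∀ j : ℤ, (((f ^ j) (β s) - u) / (v - u)).re < 1 / 2)
    (hright : ∀ s, b ≤ s → ∀ j : ℤ, 1 / 2 < (((f ^ j) (β s) - u) / (v - u)).re)
    (hdisj : ∀ s t, (a < s ∨ a < t) → (s < b ∨ t < b) → ∀ i : ℤ, ¬ (p : ℤ) ∣ i →
      (f ^ i) (β s) ≠ β t) : False := by
  have hvu : v - u ≠ 0 := sub_ne_zero.2 huv.symm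
  let ζ : ℂ → ℂ := fun z => (z - u) / (v - u)
  have hζ : Continuous ζ := by fun_prop
  let W : Set ℂ := ⋃ j ∈ Finset.range p, (fun s => (f ^ (j : ℤ)) (β s)) '' Icc (a - 1) (b + 1)
  have hWc : IsCompact W := (Finset.range p).isCompact_biUnion fun j _ =>
    isCompact_Icc.image ((f ^ (j : ℤ)).continuous.comp hβ)
  have hclamp : ∀ s, ∃ s' ∈ Icc (a - 1) (b + 1), β s' = β s := by
    intro s
    rcases le_total s (a - 1) with h | h
    · exact ⟨a - 1, ⟨le_rfl, by linarith⟩, by rw [hβu _ le_rfl, hβu s h]⟩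
    · rcases le_total (b + 1) s with h' | h'
      · exact ⟨b + 1, ⟨by linarith, le_rfl⟩, by rw [hβv _ le_rfl, hβv s h']⟩
      · exact ⟨s, ⟨h, h'⟩, rfl⟩
  have hW : ∀ (j : ℤ) (s : ℝ), (f ^ j) (β s) ∈ W := by
    intro j s
    obtain ⟨s', hs', hss⟩ := hclamp s
    have hp0 : (0 : ℤ) < p := by exact_mod_cast hp.pos
    have h1 := Int.emod_nonneg j hp0.ne'
    have h2 := Int.emod_lt_of_pos j hp0
    obtain ⟨n, hn⟩ := Int.eq_ofNat_of_zero_le h1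
    refine mem_biUnion (x := n) ?_ ⟨s', hs', ?_⟩
    · simp only [SetLike.mem_coe, Finset.mem_range]
      omega
    · rw [zpow_eq_zpow_emod' j hf, hn]
      simp only [hss]
  obtain ⟨ρ, -, hρ⟩ := intermediate_value_Icc (a := a - 1) (b := b + 1) (by linarith)
    (f := fun s => (ζ (β s)).re) (by fun_prop) (show (1 / 2 : ℝ) ∈ _ by
      simp only [ζ]
      rw [hβu _ le_rfl, hβv _ le_rfl, div_self hvu]
      norm_num)
  obtain ⟨x, ⟨hxW, hx⟩, hmax⟩ := (hWc.inter_right (isClosed_eq (f := fun z => (ζ z).re)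
    (g := fun _ => (1 / 2 : ℝ)) (by fun_prop) (by fun_prop))).exists_isMaxOn
    ⟨β ρ, hW 0 ρ, hρ⟩ (f := fun z => (ζ z).im) (by fun_prop)
  obtain ⟨k, -, τ, -, rfl⟩ : ∃ k ∈ Finset.range p, ∃ τ ∈ Icc (a - 1) (b + 1),
      (f ^ (k : ℤ)) (β τ) = x := by simpa [W] using hxW
  have hτ : τ ∈ Ioo a b := by
    constructor <;> by_contra! h
    · exact (hleft τ h k).ne hx
    · exact (hright τ h k).ne' hx
  have hp1 : ¬ (p : ℤ) ∣ 1 := fun h =>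
    hp.one_lt.ne' (by exact_mod_cast Int.eq_one_of_dvd_one (Int.natCast_nonneg p) h)
  have hdisj' : ∀ s t, (a < s ∨ a < t) → (s < b ∨ t < b) →
      f ((f ^ (k : ℤ)) (β s)) ≠ (f ^ (k : ℤ)) (β t) := by
    intro s t h1 h2 h
    have h3 : f ((f ^ (k : ℤ)) (β s)) = (f ^ (k : ℤ)) ((f ^ (1 : ℤ)) (β s)) := by
      rw [← Homeomorph.zpow_add_apply, add_comm, Homeomorph.zpow_add_apply, zpow_one]
    exact hdisj s t h1 h2 1 hp1 ((f ^ (k : ℤ)).injective (h3.symm.trans h))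
  have hslit : ∀ z ∈ W, z ≠ (f ^ (k : ℤ)) (β τ) →
      Complex.I / (v - u) * (z - (f ^ (k : ℤ)) (β τ)) ∈ Complex.slitPlane := by
    intro z hz hne
    have h1 : Complex.I / (v - u) * (z - (f ^ (k : ℤ)) (β τ)) =
        Complex.I * (ζ z - ζ ((f ^ (k : ℤ)) (β τ))) := by
      simp only [ζ]
      ring
    rw [h1, Complex.mem_slitPlane_iff]
    simp only [Complex.mul_re, Complex.mul_im, Complex.I_re, Complex.I_im, Complex.sub_re,
      Complex.sub_im]
    by_contra! h
    have hre : (ζ z).re = (ζ ((f ^ (k : ℤ)) (β τ))).re := by linarith [h.2]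
    have him : (ζ z).im ≤ (ζ ((f ^ (k : ℤ)) (β τ))).im := hmax ⟨hz, hre.trans hx⟩
    have heq : ζ z = ζ ((f ^ (k : ℤ)) (β τ)) := Complex.ext hre (by linarith [h.1])
    exact hne (by simpa [ζ, div_left_inj' hvu] using heq)
  refine false_of_accessible_point hc hce huv hcuv hu hv (B := fun s => (f ^ (k : ℤ)) (β s))
    ((f ^ (k : ℤ)).continuous.comp hβ) (S := a - 1) (T := b + 1) (by linarith) (by linarith) hτ
    (by rw [hβu _ le_rfl, Homeomorph.zpow_apply_fixed hu]) (by rw [hβv _ le_rfl, Homeomorph.zpow_apply_fixed hv]) hdisj'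
    (d := Complex.I / (v - u)) (fun s => hslit _ ?_ ?_) fun s => hslit _ ?_ fun h => ?_
  · have := hW (1 + k) s
    rwa [Homeomorph.zpow_add_apply, zpow_one] at this
  · exact hdisj' s τ (.inr hτ.1) (.inr hτ.2)
  · have := hW (-1 + k) s
    rwa [Homeomorph.zpow_add_apply, zpow_neg_one] at this
  · exact hdisj' τ s (.inl hτ.1) (.inl hτ.2) (f.symm_apply_eq.1 h).symm

theorem Homeomorph.eventually_zpow_apply {X : Type*} [TopologicalSpace X] {f : X ≃ₜ X} {p : ℕ}
    (hp : 0 < p) (hf : f ^ p = 1) {L : Type*} {l : Filter L} {P : (X ≃ₜ X) → L → Prop}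
    (h : ∀ i : ℤ, ∀ᶠ x in l, P (f ^ i) x) : ∀ᶠ x in l, ∀ i : ℤ, P (f ^ i) x := by
  have h1 : ∀ᶠ x in l, ∀ i ∈ Finset.range p, P (f ^ (i : ℤ)) x :=
    (Filter.eventually_all_finset _).2 fun i _ => h i
  filter_upwards [h1] with x hx i
  have hp0 : (0 : ℤ) < p := by exact_mod_cast hp
  have h2 := Int.emod_lt_of_pos i hp0
  obtain ⟨n, hn⟩ := Int.eq_ofNat_of_zero_le (Int.emod_nonneg i hp0.ne')
  rw [zpow_eq_zpow_emod' i hf, hn]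
  exact hx n (Finset.mem_range.2 (by omega))

/-- The saturation of a closed set under a homeomorphism of finite order is closed. -/
theorem Homeomorph.isClosed_saturation {X : Type*} [TopologicalSpace X] {f : X ≃ₜ X} {p : ℕ}
    (hp : 0 < p) (hf : f ^ p = 1) {C : Set X} (hC : IsClosed C) :
    IsClosed {z | ∃ j : ℤ, (f ^ j) z ∈ C} := by
  rw [← isOpen_compl_iff, isOpen_iff_mem_nhds]
  intro z hz
  simp only [mem_compl_iff, mem_ofPred_eq, not_exists] at hz
  have := Homeomorph.eventually_zpow_apply (l := 𝓝 z) (P := fun g x => g x ∉ C) hp hf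
    fun i => (f ^ i).continuous.continuousAt.eventually (hC.isOpen_compl.mem_nhds (hz i))
  filter_upwards [this] with x hx
  simpa using hx

/-- Two points in the same component of the complement of the fixed point set are joined, up to
translation of one of them, by a path that is disjoint from its translates. -/
theorem exists_equivariant_path {f : ℂ ≃ₜ ℂ} {p : ℕ} (hp : p.Prime) (hf : f ^ p = 1)
    {U : Set ℂ} (hU : IsPreconnected U) (hUf : ∀ z ∈ U, f z ≠ z) {y₀ y₁ : ℂ} (h₀ : y₀ ∈ U)
    (h₁ : y₁ ∈ U) :
    ∃ (α : ℝ → ℂ) (b : ℝ) (j : ℤ), Continuous α ∧ 0 ≤ b ∧ α 0 = (f ^ j) y₀ ∧ α b = y₁ ∧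
      ∀ s ∈ Icc 0 b, ∀ t ∈ Icc 0 b, ∀ i : ℤ, ¬ (p : ℤ) ∣ i → (f ^ i) (α s) ≠ α t := by
  let E : Set ℂ := {y | ∃ (α : ℝ → ℂ) (b : ℝ) (j : ℤ), Continuous α ∧ 0 ≤ b ∧ α 0 = (f ^ j) y₀ ∧
    α b = y ∧ ∀ s ∈ Icc 0 b, ∀ t ∈ Icc 0 b, ∀ i : ℤ, ¬ (p : ℤ) ∣ i → (f ^ i) (α s) ≠ α t}
  have hE₀ : y₀ ∈ E := ⟨fun _ => y₀, 0, 0, continuous_const, le_rfl, rfl, rfl,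
    fun s _ t _ i hi h => hUf _ h₀ (Homeomorph.pow_period_apply_fixed hp hf hi h)⟩
  have hloc : ∀ y ∈ U, ∃ B ∈ 𝓝 y, ∀ y' ∈ B, y' ∈ E → B ⊆ E := by
    intro y hy
    have hev : ∀ᶠ q : ℂ × ℂ in 𝓝 y ×ˢ 𝓝 y, ∀ i : ℤ, ¬ (p : ℤ) ∣ i → (f ^ i) q.1 ≠ q.2 := by
      rw [← nhds_prod_eq]
      have h1 := Homeomorph.eventually_zpow_apply (l := 𝓝 (y, y))
        (P := fun g q => g ≠ 1 → g q.1 ≠ q.2) hp.pos hf fun i => ?_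
      · filter_upwards [h1] with q hq i hi
        exact hq i fun h => hUf y hy
          (Homeomorph.pow_period_apply_fixed hp hf hi (congrArg (fun g : ℂ ≃ₜ ℂ => g y) h))
      · by_cases hi : (p : ℤ) ∣ i
        · obtain ⟨m, rfl⟩ := hi
          exact Filter.Eventually.of_forall fun q h => absurd
            (by rw [zpow_mul, zpow_natCast, hf, one_zpow]) h
        · have hc : Continuous fun q : ℂ × ℂ => (f ^ i) q.1 :=
            (f ^ i).continuous.comp continuous_fst
          filter_upwards [(isOpen_ne_fun hc continuous_snd).mem_nhds (show (f ^ i) y ≠ y from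
            fun h => hUf y hy (Homeomorph.pow_period_apply_fixed hp hf hi h))] with q hq _
          exact hq
    obtain ⟨δ, hδ, hB⟩ := (Metric.nhds_basis_closedBall.prod_self).eventually_iff.1 hev
    refine ⟨Metric.closedBall y δ, Metric.closedBall_mem_nhds y hδ, ?_⟩
    rintro y' hy'B ⟨α, b, j₀, hα, hb, hα0, rfl, hdisj⟩ z hz
    obtain ⟨B, hBdef⟩ : ∃ B, B = Metric.closedBall y δ := ⟨_, rfl⟩
    rw [← hBdef] at hy'B hz
    have hBdisj : ∀ x ∈ B, ∀ x' ∈ B, ∀ i : ℤ, ¬ (p : ℤ) ∣ i → (f ^ i) x ≠ x' := by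
      intro x hx x' hx'
      rw [hBdef] at hx hx'
      exact hB (show (x, x') ∈ _ from ⟨hx, hx'⟩)
    have hBc : IsClosed B := hBdef ▸ Metric.isClosed_closedBall
    have hBconv : Convex ℝ B := hBdef ▸ convex_closedBall y δ
    obtain ⟨τ, ⟨⟨hτ0, hτb⟩, j, hj⟩, hτmin⟩ := (isCompact_Icc.inter_right
      ((Homeomorph.isClosed_saturation hp.pos hf hBc).preimage hα)).exists_isLeast
      ⟨b, ⟨hb, le_rfl⟩, 0, hy'B⟩
    let Q : ℝ → ℂ := fun s => (f ^ j) (α (min s τ)) + max (s - τ) 0 • (z - (f ^ j) (α τ))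
    have hQ1 : ∀ s ≤ τ, Q s = (f ^ j) (α s) := fun s hs => by
      simp only [Q]
      rw [min_eq_left hs, max_eq_right (by linarith), zero_smul, add_zero]
    have hQ2 : ∀ s, τ ≤ s → s ≤ τ + 1 → Q s ∈ B := fun s hs hs' => by
      simp only [Q]
      rw [min_eq_right hs, max_eq_left (by linarith)]
      exact hBconv.add_smul_sub_mem hj hz ⟨by linarith, by linarith⟩
    have hQ3 : ∀ s, 0 ≤ s → s < τ → ∀ i : ℤ, (f ^ i) (Q s) ∉ B := fun s hs hsτ i h => by
      rw [hQ1 s hsτ.le, ← Homeomorph.zpow_add_apply] at h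
      exact hsτ.not_ge (hτmin ⟨⟨hs, hsτ.le.trans hτb⟩, _, h⟩)
    refine ⟨Q, τ + 1, j + j₀, ?_, by linarith, ?_, ?_, ?_⟩
    · have := (f ^ j).continuous
      fun_prop
    · rw [hQ1 0 hτ0, hα0, Homeomorph.zpow_add_apply]
    · simp [Q]
    · rintro s ⟨hs0, hs1⟩ t ⟨ht0, ht1⟩ i hi h
      rcases lt_or_ge s τ with hs | hs <;> rcases lt_or_ge t τ with ht | ht
      · rw [hQ1 s hs.le, hQ1 t ht.le, ← Homeomorph.zpow_add_apply, add_comm,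
          Homeomorph.zpow_add_apply] at h
        exact hdisj s ⟨hs0, hs.le.trans hτb⟩ t ⟨ht0, ht.le.trans hτb⟩ i hi ((f ^ j).injective h)
      · exact hQ3 s hs0 hs i (h ▸ hQ2 t ht ht1)
      · refine hQ3 t ht0 ht (-i) ?_
        rw [← h, Homeomorph.zpow_neg_apply_zpow_apply]
        exact hQ2 s hs hs1
      · exact hBdisj _ (hQ2 s hs hs1) _ (hQ2 t ht ht1) i hi h
  have hsub : U ⊆ interior E ∪ interior Eᶜ := by
    intro y hy
    obtain ⟨B, hB, h⟩ := hloc y hy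
    by_cases hBE : ∃ y' ∈ B, y' ∈ E
    · obtain ⟨y', hy', hyE⟩ := hBE
      exact .inl (mem_interior_iff_mem_nhds.2 (Filter.mem_of_superset hB (h y' hy' hyE)))
    · exact .inr (mem_interior_iff_mem_nhds.2 (Filter.mem_of_superset hB
        fun y' hy' hyE => hBE ⟨y', hy', hyE⟩))
  have hdis : Disjoint (interior E) (interior Eᶜ) :=
    disjoint_compl_right.mono interior_subset interior_subset
  have h₀' : y₀ ∈ interior E := (hsub h₀).resolve_right fun h => interior_subset h hE₀
  have h₁' : y₁ ∈ interior E := IsPreconnected.subset_left_of_subset_union isOpen_interior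
    isOpen_interior hdis hsub ⟨y₀, h₀, h₀'⟩ hU h₁
  have h₁E : y₁ ∈ E := interior_subset h₁'
  exact h₁E

/-- A component of the complement of a closed set with at least two points in the plane has
two points of that set in its closure. -/
theorem exists_pair_mem_closure_connectedComponentIn {K : Set ℂ} (hK : IsClosed K)
    (hK2 : K.Nontrivial) {x₀ : ℂ} (hx₀ : x₀ ∉ K) :
    ∃ u ∈ K, ∃ v ∈ K, u ≠ v ∧ u ∈ closure (connectedComponentIn Kᶜ x₀) ∧
      v ∈ closure (connectedComponentIn Kᶜ x₀) := by
  obtain ⟨U, hU⟩ : ∃ U, U = connectedComponentIn Kᶜ x₀ := ⟨_, rfl⟩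
  rw [← hU]
  have hUo : IsOpen U := hU ▸ hK.isOpen_compl.connectedComponentIn
  have hUx : x₀ ∈ U := hU ▸ mem_connectedComponentIn hx₀
  have hUK : U ⊆ Kᶜ := hU ▸ connectedComponentIn_subset _ _
  have hfr : frontier U ⊆ K := by
    intro y hy
    rw [hUo.frontier_eq] at hy
    by_contra hyK
    obtain ⟨z, hz, hzU⟩ := mem_closure_iff.1 hy.1 _ hK.isOpen_compl.connectedComponentIn
      (mem_connectedComponentIn hyK)
    rw [hU] at hzU
    refine hy.2 ?_
    rw [hU, connectedComponentIn_eq hzU, ← connectedComponentIn_eq hz]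
    exact mem_connectedComponentIn hyK
  by_cases hsub : (frontier U).Subsingleton
  · exfalso
    obtain ⟨u, huK, hu⟩ : ∃ u ∈ K, frontier U ⊆ {u} := by
      rcases hsub.eq_empty_or_singleton with h | ⟨u, h⟩
      · obtain ⟨u, hu⟩ := hK2.nonempty
        exact ⟨u, hu, by simp [h]⟩
      · exact ⟨u, hfr (by simp [h]), h.subset⟩
    have hconn : IsPreconnected ({u}ᶜ : Set ℂ) :=
      (isConnected_compl_singleton_of_one_lt_rank (by simp) u).isPreconnected
    have hsub' : ({u}ᶜ : Set ℂ) ⊆ U := by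
      refine hconn.subset_left_of_subset_union hUo isClosed_closure.isOpen_compl
        (disjoint_compl_right.mono_left subset_closure) (fun z hz => ?_)
        ⟨x₀, fun h => hx₀ (h ▸ huK), hUx⟩
      by_contra! h
      rw [mem_union, not_or, notMem_compl_iff] at h
      exact hz (hu (hUo.frontier_eq ▸ ⟨h.2, h.1⟩))
    obtain ⟨v, hvK, hvu⟩ := hK2.exists_ne u
    exact hUK (hsub' hvu) hvK
  · obtain ⟨u, hu, v, hv, huv⟩ := not_subsingleton_iff.1 hsub
    exact ⟨u, hfr hu, v, hfr hv, huv, frontier_subset_closure hu, frontier_subset_closure hv⟩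

/-- A homeomorphism of the plane of prime order, other than the identity, that is isotopic to the
identity has at most one fixed point. -/
theorem Homeomorph.fixed_unique_of_prime_order {f : ℂ ≃ₜ ℂ} {p : ℕ} (hp : p.Prime)
    (hf : f ^ p = 1) (hf1 : f ≠ 1) {F : ℝ → ℂ → ℂ} (hF : Continuous fun q : ℝ × ℂ => F q.1 q.2)
    (hinj : ∀ t, Function.Injective (F t)) (hF0 : ∀ z, F 0 z = z) (hF1 : ∀ z, F 1 z = f z) :
    {z | f z = z}.Subsingleton := by
  by_contra hns
  obtain ⟨c, hc, hce, hcs⟩ := exists_log_difference_quotient hF hinj hF0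
  simp only [hF1] at hce
  obtain ⟨x₀, hx₀⟩ : ∃ x, f x ≠ x := by
    by_contra! h
    exact hf1 (Homeomorph.ext h)
  have hK : IsClosed {z | f z = z} := isClosed_eq f.continuous continuous_id
  obtain ⟨u, hu, v, hv, huv, huU, hvU⟩ := exists_pair_mem_closure_connectedComponentIn hK
    (not_subsingleton_iff.1 hns) (x₀ := x₀) hx₀
  obtain ⟨U, hU⟩ : ∃ U, U = connectedComponentIn {z | f z = z}ᶜ x₀ := ⟨_, rfl⟩
  rw [← hU] at huU hvU
  have hUpre : IsPreconnected U := hU ▸ isPreconnected_connectedComponentIn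
  have hUf : ∀ z ∈ U, f z ≠ z := fun z hz => connectedComponentIn_subset _ _ (hU ▸ hz)
  have hvu : v - u ≠ 0 := sub_ne_zero.2 huv.symm
  let ζ : ℂ → ℂ := fun z => (z - u) / (v - u)
  have hζ : Continuous ζ := by fun_prop
  have hnhds : ∀ O : Set ℂ, IsOpen O → ∀ w, f w = w → w ∈ O → ∃ ε > 0,
      ∀ z, (∃ j : ℤ, (f ^ j) z ∈ Metric.closedBall w ε) → ∀ j : ℤ, (f ^ j) z ∈ O := by
    intro O hO w hw hwO
    have := Homeomorph.eventually_zpow_apply (l := 𝓝 w) (P := fun g z => g z ∈ O) hp.pos hf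
      fun i => (f ^ i).continuous.continuousAt.eventually
        (hO.mem_nhds (by rwa [Homeomorph.zpow_apply_fixed hw]))
    obtain ⟨ε, hε, hεO⟩ := Metric.nhds_basis_closedBall.eventually_iff.1 this
    refine ⟨ε, hε, fun z ⟨j, hj⟩ i => ?_⟩
    have := hεO hj (i - j)
    rwa [← Homeomorph.zpow_add_apply, sub_add_cancel] at this
  have hpath : ∀ w ε, f w = w → 0 < ε → ∀ z, (∃ j : ℤ, (f ^ j) z ∈ Metric.closedBall w ε) →
      ∃ P : ℝ → ℂ, Continuous P ∧ (∀ s ≤ 0, P s = w) ∧ (∀ s, 1 ≤ s → P s = z) ∧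
        ∀ s, ∃ j : ℤ, (f ^ j) (P s) ∈ Metric.closedBall w ε := by
    intro w ε hw hε z ⟨j, hj⟩
    have hcan : ∀ x, (f ^ j) ((f ^ (-j)) x) = x := fun x => by
      have := Homeomorph.zpow_neg_apply_zpow_apply f (-j) x
      rwa [neg_neg] at this
    refine ⟨fun s => (f ^ (-j)) (w + max 0 (min s 1) • ((f ^ j) z - w)),
      (f ^ (-j)).continuous.comp (by fun_prop), fun s hs => ?_, fun s hs => ?_, fun s => ⟨j, ?_⟩⟩
    · beta_reduce
      rw [min_eq_left (hs.trans zero_le_one), max_eq_left hs, zero_smul, add_zero,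
        Homeomorph.zpow_apply_fixed hw]
    · beta_reduce
      rw [min_eq_right hs, max_eq_right zero_le_one, one_smul, add_sub_cancel,
        Homeomorph.zpow_neg_apply_zpow_apply]
    · rw [hcan]
      exact (convex_closedBall w ε).add_smul_sub_mem (Metric.mem_closedBall_self hε.le) hj
        ⟨le_max_left _ _, max_le zero_le_one (min_le_right _ _)⟩
  obtain ⟨ε, hε, hεO⟩ := hnhds {z | (ζ z).re < 1 / 2} (isOpen_lt (by fun_prop) (by fun_prop)) u hu
    (by simp [ζ])
  obtain ⟨η, hη, hηO⟩ := hnhds {z | 1 / 2 < (ζ z).re} (isOpen_lt (by fun_prop) (by fun_prop)) v hv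
    (by simp only [ζ, mem_ofPred_eq, div_self hvu]; norm_num)
  let M : Set ℂ := {z | ∃ j : ℤ, (f ^ j) z ∈ Metric.closedBall u ε}
  let N : Set ℂ := {z | ∃ j : ℤ, (f ^ j) z ∈ Metric.closedBall v η}
  have hMc : IsClosed M := Homeomorph.isClosed_saturation hp.pos hf Metric.isClosed_closedBall
  have hNc : IsClosed N := Homeomorph.isClosed_saturation hp.pos hf Metric.isClosed_closedBall
  have hsat : ∀ (C : Set ℂ) (i : ℤ) (z : ℂ),
      (∃ j : ℤ, (f ^ j) ((f ^ i) z) ∈ C) ↔ ∃ j : ℤ, (f ^ j) z ∈ C := by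
    intro C i z
    constructor
    · rintro ⟨j, hj⟩
      exact ⟨j + i, by rwa [Homeomorph.zpow_add_apply]⟩
    · rintro ⟨j, hj⟩
      exact ⟨j - i, by rwa [← Homeomorph.zpow_add_apply, sub_add_cancel]⟩
  have hMN : ∀ z ∈ M, z ∉ N := fun z hzM hzN => by
    have h1 : (ζ z).re < 1 / 2 := hεO z hzM 0
    have h2 : 1 / 2 < (ζ z).re := hηO z hzN 0
    linarith
  obtain ⟨y₀, hy₀B, hy₀⟩ := mem_closure_iff_nhds.1 huU _ (Metric.closedBall_mem_nhds u hε)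
  obtain ⟨y₁, hy₁B, hy₁⟩ := mem_closure_iff_nhds.1 hvU _ (Metric.closedBall_mem_nhds v hη)
  obtain ⟨α, e, j, hα, he, hα0, hαe, hαdisj⟩ := exists_equivariant_path hp hf hUpre hUf hy₀ hy₁
  obtain ⟨a, ⟨⟨ha0, hae⟩, haM : α a ∈ M⟩, hamax⟩ :=
    (isCompact_Icc.inter_right (hMc.preimage hα)).exists_isGreatest
      ⟨0, ⟨le_rfl, he⟩, show α 0 ∈ M from hα0 ▸ (hsat _ _ _).2 ⟨0, hy₀B⟩⟩
  obtain ⟨b, ⟨⟨hab', hbe⟩, hbN : α b ∈ N⟩, hbmin⟩ :=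
    (isCompact_Icc.inter_right (hNc.preimage hα)).exists_isLeast
      ⟨e, ⟨hae, le_rfl⟩, show α e ∈ N from hαe ▸ ⟨0, hy₁B⟩⟩
  have hab : a < b := hab'.lt_of_ne fun h => hMN _ haM (h ▸ hbN)
  obtain ⟨P, hPc, hP0, hP1, hPM⟩ := hpath u ε hu hε _ haM
  obtain ⟨Q, hQc, hQ0, hQ1, hQN⟩ := hpath v η hv hη _ hbN
  let β : ℝ → ℂ := fun s =>
    P (s - a + 1) + (α (max a (min s b)) - α a) + (Q (b + 1 - s) - α b)
  have hβ : Continuous β := by fun_prop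
  have hβ1 : ∀ s ≤ a, β s = P (s - a + 1) := fun s hs => by
    simp only [β]
    rw [min_eq_left (by linarith), max_eq_left hs, hQ1 _ (by linarith)]
    ring
  have hβ2 : ∀ s, a ≤ s → s ≤ b → β s = α s := fun s hs hs' => by
    simp only [β]
    rw [min_eq_left hs', max_eq_right hs, hQ1 _ (by linarith), hP1 _ (by linarith)]
    ring
  have hβ3 : ∀ s, b ≤ s → β s = Q (b + 1 - s) := fun s hs => by
    simp only [β]
    rw [min_eq_right hs, max_eq_right hab.le, hP1 _ (by linarith)]
    ring
  have hβM : ∀ s, s ≤ a ↔ β s ∈ M := by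
    refine fun s => ⟨fun hs => hβ1 s hs ▸ hPM _, fun h => ?_⟩
    by_contra! hs
    rcases le_total b s with hsb | hsb
    · exact hMN _ h (hβ3 s hsb ▸ hQN _)
    · rw [hβ2 s hs.le hsb] at h
      exact hs.not_ge (hamax ⟨⟨ha0.trans hs.le, hsb.trans hbe⟩, h⟩)
  have hβN : ∀ s, b ≤ s ↔ β s ∈ N := by
    refine fun s => ⟨fun hs => hβ3 s hs ▸ hQN _, fun h => ?_⟩
    by_contra! hs
    rcases le_total s a with hsa | hsa
    · exact hMN _ ((hβM s).1 hsa) h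
    · rw [hβ2 s hsa hs.le] at h
      exact hs.not_ge (hbmin ⟨⟨hsa, hs.le.trans hbe⟩, h⟩)
  refine false_of_equivariant_arc hp hf hc hce huv (hcs u v huv) hu hv hβ hab
    (fun s hs => ?_) (fun s hs => ?_) (fun s hs => hεO _ ((hβM s).1 hs))
    (fun s hs => hηO _ ((hβN s).1 hs)) fun s t h1 h2 i hi h => ?_
  · rw [hβ1 s (by linarith), hP0 _ (by linarith)]
  · rw [hβ3 s (by linarith), hQ0 _ (by linarith)]
  · have hst : s ≤ a ↔ t ≤ a := by
      rw [hβM s, hβM t, ← h]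
      exact (hsat _ i _).symm
    have hst' : b ≤ s ↔ b ≤ t := by
      rw [hβN s, hβN t, ← h]
      exact (hsat _ i _).symm
    simp only [← not_le, ← hst, ← hst', or_self] at h1 h2
    have h1' := mt hst.2 h1
    have h2' := mt hst'.2 h2
    rw [not_le] at h1 h2 h1' h2'
    rw [hβ2 s h1.le h2.le, hβ2 t h1'.le h2'.le] at h
    exact hαdisj s ⟨ha0.trans h1.le, h2.le.trans hbe⟩ t ⟨ha0.trans h1'.le, h2'.le.trans hbe⟩ i hi h

/-- A homeomorphism of the plane `ℂ` of finite order `n ≥ 2` that is isotopic to the identity has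
exactly one fixed point. -/
theorem Homeomorph.existsUnique_fixed_of_orderOf {f : ℂ ≃ₜ ℂ} (hfin : 2 ≤ orderOf f)
    {F : ℝ → ℂ → ℂ} (hF : Continuous fun q : ℝ × ℂ => F q.1 q.2)
    (hinj : ∀ t, Function.Injective (F t)) (hF0 : ∀ z, F 0 z = z) (hF1 : ∀ z, F 1 z = f z) :
    ∃! z, f z = z := by
  obtain ⟨p, hp, k, hk⟩ := Nat.exists_prime_and_dvd (n := orderOf f) (by omega)
  have hgp : (f ^ k) ^ p = 1 := by rw [← pow_mul, mul_comm, ← hk, pow_orderOf_eq_one]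
  have hk0 : 0 < k := Nat.pos_of_ne_zero (by rintro rfl; omega)
  have hg1 : f ^ k ≠ 1 := pow_ne_one_of_lt_orderOf hk0.ne' (by
    rw [hk]
    nlinarith [hp.two_le])
  have hpow : ∀ (m : ℕ) (z : ℂ), (f ^ m) z = f^[m] z := by
    intro m
    induction m with
    | zero => exact fun z => rfl
    | succ m ih => exact fun z => by rw [pow_succ, Function.iterate_succ_apply, ← ih]; rfl
  have hit : ∀ m : ℕ, Continuous fun q : ℝ × ℂ => (F q.1)^[m] q.2 := by
    intro m
    induction m with
    | zero => exact continuous_snd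
    | succ m ih =>
      simp only [Function.iterate_succ_apply']
      exact hF.comp (continuous_fst.prodMk ih)
  have hsub : {z | (f ^ k) z = z}.Subsingleton :=
    Homeomorph.fixed_unique_of_prime_order hp hgp hg1 (F := fun t => (F t)^[k]) (hit k)
      (fun t => (hinj t).iterate k)
      (fun z => Function.iterate_fixed (hF0 z) k) fun z => by
        rw [hpow, show F 1 = f from funext hF1]
  obtain ⟨z, hz⟩ := Homeomorph.exists_fixed_of_prime_order hp hgp
  refine ⟨z, hsub ?_ hz, fun w hw => hsub ?_ hz⟩
  · have hcomm : (f ^ k) (f z) = f ((f ^ k) z) := by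
      rw [hpow, hpow, ← Function.iterate_succ_apply, Function.iterate_succ_apply']
    exact hcomm.trans (congrArg f hz)
  · have := Homeomorph.zpow_apply_fixed hw k
    rwa [zpow_natCast] at this

/-- An orientation-preserving homeomorphism of the plane of finite order `n ≥ 2`
has exactly one fixed point. -/
theorem plane_finite_order_unique_fixed_point
    (f : (ℝ × ℝ) ≃ₜ (ℝ × ℝ)) (n : ℕ) (hn : 2 ≤ n)
    (hord : orderOf f = n)
    (hor : PlaneOrientationPreserving f) :
    ∃! O : ℝ × ℝ, f O = O := by
  obtain ⟨F, hF, -, hF0, hF1⟩ := hor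
  let e : ℂ ≃ₜ ℝ × ℝ := Complex.equivRealProdCLM.toHomeomorph
  let conj : ((ℝ × ℝ) ≃ₜ (ℝ × ℝ)) ≃* (ℂ ≃ₜ ℂ) :=
    { toFun := fun g => (e.trans g).trans e.symm
      invFun := fun g => (e.symm.trans g).trans e
      left_inv := fun g => Homeomorph.ext fun x => by simp
      right_inv := fun g => Homeomorph.ext fun x => by simp
      map_mul' := fun g g' => Homeomorph.ext fun x => by
        change e.symm (g (g' (e x))) = e.symm (g (e (e.symm (g' (e x)))))
        rw [e.apply_symm_apply] }
  have hconj : ∀ g x, conj g x = e.symm (g (e x)) := fun g x => rfl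
  obtain ⟨z, hz, huniq⟩ := Homeomorph.existsUnique_fixed_of_orderOf (f := conj f)
    (by rw [MulEquiv.orderOf_eq, hord]; exact hn) (F := fun t => conj (F t))
    (e.symm.continuous.comp (hF.comp (f := fun q : ℝ × ℂ => (q.1, e q.2)) (by fun_prop)))
    (fun t => (conj (F t)).injective) (fun z => by rw [hconj, hF0]; simp)
    (fun z => by rw [hF1])
  refine ⟨e z, e.symm_apply_eq.1 hz, fun w hw => ?_⟩
  rw [← huniq (e.symm w) (congrArg e.symm ?_), e.apply_symm_apply]
  exact (congrArg f (e.apply_symm_apply w)).trans hw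
end
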